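/- There exist an integer k0 and a sequence eps_k -> 0 such that for every k >= k0 and density r = 2^k * ln 2 - rho with rho = (3/2) * ln 2 - eps_k, with high probability the uniform random formula Phi = Phi_k(n, floor(r*n)) satisfies |S(Phi)| >= E[|S(Phi)|] * exp(-n*r/(k^9 * 4^k)). -/

import Mathlib

open Classical Finset Filter

noncomputable section

/-- A literal: a variable index together with a sign (`true` = positive occurrence). -/
abbrev Lit (n : ℕ) := Fin n × Bool

/-- A clause: an ordered `k`-tuple of literals. -/
abbrev Clause (n k : ℕ) := Fin k → Lit n

/-- A `k`-CNF formula with `m` clauses over `n` variables. -/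
abbrev Formula (n k m : ℕ) := Fin m → Clause n k

/-- A truth assignment. -/
abbrev Assignment (n : ℕ) := Fin n → Bool

/-- The truth value of a literal under an assignment. -/
def litVal {n : ℕ} (σ : Assignment n) (l : Lit n) : Bool :=
  if l.2 then σ l.1 else !(σ l.1)

/-- `σ` satisfies `Φ` if every clause contains at least one true literal. -/
def Satisfies {n k m : ℕ} (σ : Assignment n) (Φ : Formula n k m) : Prop :=
  ∀ i : Fin m, ∃ j : Fin k, litVal σ (Φ i j) = true

/-- The set of satisfying assignments of `Φ`. -/
def satSet (n k m : ℕ) (Φ : Formula n k m) : Finset (Assignment n) :=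
  univ.filter fun σ => Satisfies σ Φ

/-- The number of satisfying assignments of `Φ`. -/
def satCount (n k m : ℕ) (Φ : Formula n k m) : ℕ := (satSet n k m Φ).card

/-- Probability of an event under the uniformly random formula `Φ_k(n,m)`. -/
def prF (n k m : ℕ) (E : Formula n k m → Prop) : ℝ :=
  ((univ.filter fun Φ : Formula n k m => E Φ).card : ℝ) / (Fintype.card (Formula n k m) : ℝ)

/-- Expectation of a function of the uniformly random formula `Φ_k(n,m)`. -/
def expF (n k m : ℕ) (f : Formula n k m → ℝ) : ℝ :=
  (∑ Φ : Formula n k m, f Φ) / (Fintype.card (Formula n k m) : ℝ)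

/-- The number of occurrences of the literal `l` in `Φ`. -/
def occ (n k m : ℕ) (Φ : Formula n k m) (l : Lit n) : ℕ :=
  (univ.filter fun p : Fin m × Fin k => Φ p.1 p.2 = l).card

/-- The (signed) degree sequence of `Φ`. -/
def degSeq (n k m : ℕ) (Φ : Formula n k m) : Lit n → ℕ := occ n k m Φ

/-- Hamming distance between two assignments. -/
def hdist {n : ℕ} (σ τ : Assignment n) : ℕ :=
  (univ.filter fun x => σ x ≠ τ x).card

/-- The majority-vote assignment: `x ↦ true` iff `x` occurs more often positively
than negatively. -/
def sigmaMaj (n k m : ℕ) (Φ : Formula n k m) : Assignment n :=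
  fun x => decide (occ n k m Φ (x, false) < occ n k m Φ (x, true))

noncomputable section

/-- Uniform average of a real function over a finite type. -/
def av {α : Type*} [Fintype α] (f : α → ℝ) : ℝ := (∑ a, f a) / (Fintype.card α : ℝ)

section av
variable {α β : Type*} [Fintype α] [Fintype β]

theorem av_add (f g : α → ℝ) : av (fun a => f a + g a) = av f + av g := by
  simp [av, sum_add_distrib, add_div]

theorem av_sub (f g : α → ℝ) : av (fun a => f a - g a) = av f - av g := by
  simp [av, sum_sub_distrib, sub_div]

theorem av_mul_left (c : ℝ) (f : α → ℝ) : av (fun a => c * f a) = c * av f := by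
  simp [av, ← mul_sum, mul_div_assoc]

theorem av_mul_right (c : ℝ) (f : α → ℝ) : av (fun a => f a * c) = av f * c := by
  simp [av, ← sum_mul, div_mul_eq_mul_div]

theorem av_sum {ι : Type*} (s : Finset ι) (f : ι → α → ℝ) :
    av (fun a => ∑ i ∈ s, f i a) = ∑ i ∈ s, av (f i) := by
  simp only [av]
  rw [sum_comm, sum_div]

theorem av_const [Nonempty α] (c : ℝ) : av (fun _ : α => c) = c := by
  have : (Fintype.card α : ℝ) ≠ 0 := by exact_mod_cast Fintype.card_ne_zero
  simp [av]

theorem av_mono {f g : α → ℝ} (h : ∀ a, f a ≤ g a) : av f ≤ av g := by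
  unfold av
  gcongr
  exact h _

theorem av_nonneg {f : α → ℝ} (h : ∀ a, 0 ≤ f a) : 0 ≤ av f := by
  unfold av
  exact div_nonneg (sum_nonneg fun a _ => h a) (by positivity)

theorem av_equiv (e : α ≃ β) (f : β → ℝ) : av (fun a => f (e a)) = av f := by
  simp only [av]
  rw [Equiv.sum_comp e f, Fintype.card_congr e]

theorem av_comm (f : α → β → ℝ) :
    av (fun a => av (fun b => f a b)) = av (fun b => av (fun a => f a b)) := by
  simp only [av]
  rw [← sum_div, ← sum_div, sum_comm, div_div, div_div, mul_comm]

theorem av_prod (f : α × β → ℝ) :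
    av f = av (fun a => av (fun b => f (a, b))) := by
  simp only [av]
  rw [Fintype.sum_prod_type, ← sum_div, div_div, Fintype.card_prod]
  push_cast
  rw [mul_comm]

theorem av_le_const [Nonempty α] {f : α → ℝ} {c : ℝ} (h : ∀ a, f a ≤ c) : av f ≤ c := by
  calc av f ≤ av (fun _ : α => c) := av_mono h
    _ = c := av_const c

end av

section avpi
variable {ι Ω : Type*} [Fintype ι] [DecidableEq ι] [Fintype Ω]

theorem av_pi_prod (g : ι → Ω → ℝ) :
    av (fun Φ : ι → Ω => ∏ t, g t (Φ t)) = ∏ t, av (g t) := by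
  simp only [av]
  rw [Finset.prod_div_distrib, Finset.prod_univ_sum, Fintype.piFinset_univ]
  congr 1
  rw [Fintype.card_pi]
  push_cast
  rfl

theorem av_update [Nonempty Ω] (t : ι) (f : (ι → Ω) → ℝ) :
    av f = av (fun Φ => av (fun c => f (Function.update Φ t c))) := by
  let e' : ((ι → Ω) × Ω) ≃ ((ι → Ω) × Ω) :=
    { toFun := fun p => (Function.update p.1 t p.2, p.1 t)
      invFun := fun p => (Function.update p.1 t p.2, p.1 t)
      left_inv := by rintro ⟨Φ, c⟩; simp
      right_inv := by rintro ⟨Φ, c⟩; simp }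
  have h1 := av_equiv e' (fun p : (ι → Ω) × Ω => f p.1)
  rw [av_prod, av_prod] at h1
  simp only [e', Equiv.coe_fn_mk, av_const] at h1
  exact h1.symm

theorem av_pi_prod_finset [Nonempty Ω] (I : Finset ι) (g : ι → Ω → ℝ) :
    av (fun Φ : ι → Ω => ∏ t ∈ I, g t (Φ t)) = ∏ t ∈ I, av (g t) := by
  have h := av_pi_prod (fun t c => if t ∈ I then g t c else (1:ℝ))
  have h2 : ∀ Φ : ι → Ω, (∏ t, if t ∈ I then g t (Φ t) else (1:ℝ)) = ∏ t ∈ I, g t (Φ t) := by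
    intro Φ; rw [Finset.prod_ite_mem]; simp
  simp only [h2] at h
  rw [h]
  have h3 : ∀ t, av (fun c => if t ∈ I then g t c else (1:ℝ)) = if t ∈ I then av (g t) else 1 := by
    intro t
    by_cases ht : t ∈ I
    · simp [ht]
    · simp [ht, av_const]
  simp only [h3]
  rw [Finset.prod_ite_mem]; simp

end avpi

/-- Indicator function. -/
def ind (P : Prop) : ℝ := if P then 1 else 0

theorem ind_nonneg (P : Prop) : 0 ≤ ind P := by unfold ind; split_ifs <;> norm_num
theorem ind_le_one (P : Prop) : ind P ≤ 1 := by unfold ind; split_ifs <;> norm_num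
theorem ind_true {P : Prop} (h : P) : ind P = 1 := by simp [ind, h]
theorem ind_false {P : Prop} (h : ¬P) : ind P = 0 := by simp [ind, h]
theorem ind_mono {P Q : Prop} (h : P → Q) : ind P ≤ ind Q := by
  by_cases hp : P
  · rw [ind_true hp, ind_true (h hp)]
  · rw [ind_false hp]; exact ind_nonneg _
theorem ind_and (P Q : Prop) : ind (P ∧ Q) = ind P * ind Q := by
  by_cases hp : P <;> by_cases hq : Q <;> simp [ind, hp, hq]
theorem ind_not (P : Prop) : ind (¬ P) = 1 - ind P := by
  by_cases hp : P <;> simp [ind, hp]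

theorem ind_forall_finset {ι : Type*} (s : Finset ι) (P : ι → Prop) :
    ind (∀ i ∈ s, P i) = ∏ i ∈ s, ind (P i) := by
  by_cases h : ∀ i ∈ s, P i
  · rw [ind_true h, Finset.prod_eq_one]
    intro i hi; exact ind_true (h i hi)
  · rw [ind_false h]
    push Not at h
    obtain ⟨i, hi, hp⟩ := h
    exact (Finset.prod_eq_zero hi (ind_false hp)).symm

theorem card_filter_eq_sum_ind {α : Type*} (s : Finset α) (P : α → Prop) [DecidablePred P] :
    ((s.filter P).card : ℝ) = ∑ a ∈ s, ind (P a) := by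
  rw [card_filter]
  push_cast
  apply sum_congr rfl
  intro a _
  by_cases h : P a <;> simp [ind, h]

theorem av_ind {α : Type*} [Fintype α] (P : α → Prop) [DecidablePred P] :
    av (fun a => ind (P a)) = ((univ.filter P).card : ℝ) / (Fintype.card α : ℝ) := by
  rw [card_filter_eq_sum_ind, av]

/-- Markov inequality. -/
theorem av_markov {α : Type*} [Fintype α] (f : α → ℝ) (hf : ∀ a, 0 ≤ f a) {c : ℝ} (hc : 0 < c) :
    av (fun a => ind (c ≤ f a)) ≤ av f / c := by
  rw [le_div_iff₀ hc, ← av_mul_right]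
  apply av_mono
  intro a
  by_cases h : c ≤ f a
  · rw [ind_true h]; linarith
  · rw [ind_false h]; simpa using hf a

theorem av_sq_le {α : Type*} [Fintype α] [Nonempty α] (f : α → ℝ) :
    (av f) ^ 2 ≤ av (fun a => (f a) ^ 2) := by
  have h : 0 ≤ av (fun a => (f a - av f) ^ 2) := av_nonneg fun a => sq_nonneg _
  have h2 : av (fun a => (f a - av f) ^ 2) = av (fun a => (f a)^2) - (av f)^2 := by
    have : (fun a => (f a - av f) ^ 2) = fun a => ((f a)^2 - (2 * av f) * f a) + (av f)^2 := by
      funext a; ring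
    rw [this, av_add, av_sub, av_mul_left, av_const]; ring
  linarith

/-- Efron-Stein inequality. -/
theorem efron_stein {Ω : Type*} [Fintype Ω] [Nonempty Ω] (m : ℕ) :
    ∀ (f : (Fin m → Ω) → ℝ) (g : Fin m → (Fin m → Ω) → ℝ)
      (_ : ∀ t Φ c, g t (Function.update Φ t c) = g t Φ),
    av (fun Φ => (f Φ - av f) ^ 2) ≤ ∑ t, av (fun Φ => (f Φ - g t Φ) ^ 2) := by
  induction m with
  | zero =>
    intro f g _
    have : ∀ Φ, f Φ - av f = 0 := by
      intro Φ
      have h : f = fun _ => f Φ := by funext Ψ; rw [Subsingleton.elim Ψ Φ]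
      have h3 : av f = f Φ := by rw [h, av_const]
      rw [h3, sub_self]
    simp [av]
  | succ m ih =>
    intro f g hg
    let e : (Ω × (Fin m → Ω)) ≃ (Fin (m+1) → Ω) := Fin.consEquiv (fun _ => Ω)
    have he : ∀ (F : (Fin (m+1) → Ω) → ℝ), av F = av fun c : Ω => av fun Φ : Fin m → Ω => F (Fin.cons c Φ : Fin (m+1) → Ω) := by
      intro F
      rw [← av_equiv e F, av_prod]
      rfl
    set h : Ω → ℝ := fun c => av fun Φ : Fin m → Ω => f (Fin.cons c Φ : Fin (m+1) → Ω) with hh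
    have hav : av f = av h := he f
    have hx : ∀ c, av (fun Φ : Fin m → Ω => (f (Fin.cons c Φ : Fin (m+1) → Ω) - av f) ^ 2)
        = av (fun Φ : Fin m → Ω => (f (Fin.cons c Φ : Fin (m+1) → Ω) - h c) ^ 2) + (h c - av f) ^ 2 := by
      intro c
      have e1 : (fun Φ : Fin m → Ω => (f (Fin.cons c Φ : Fin (m+1) → Ω) - av f) ^ 2) =
        fun Φ => ((f (Fin.cons c Φ : Fin (m+1) → Ω) - h c) ^ 2 + (2 * (h c - av f)) * (f (Fin.cons c Φ : Fin (m+1) → Ω) - h c)) + (h c - av f)^2 := by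
        funext Φ; ring
      rw [e1, av_add, av_add, av_mul_left, av_sub, av_const, av_const]
      simp only [hh]; ring
    rw [he]
    simp only [hx]
    rw [av_add, Fin.sum_univ_succ, add_comm]
    apply add_le_add
    · -- variance of h
      let g0 : (Fin m → Ω) → ℝ := fun Φ => g 0 (Fin.cons (Classical.arbitrary Ω) Φ : Fin (m+1) → Ω)
      have hg0 : ∀ c Φ, g 0 (Fin.cons c Φ : Fin (m+1) → Ω) = g0 Φ := by
        intro c Φ
        have := hg 0 (Fin.cons (Classical.arbitrary Ω) Φ : Fin (m+1) → Ω) c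
        rw [Fin.update_cons_zero] at this
        exact this
      have h1 : av (fun c => (h c - av f) ^ 2) ≤ av (fun c => (h c - av g0)^2) := by
        have : (fun c => (h c - av g0)^2) = fun c => ((h c - av f)^2 + (2 * (av f - av g0)) * (h c - av f)) + (av f - av g0)^2 := by
          funext c; ring
        rw [this, av_add, av_add, av_mul_left, av_sub, av_const, av_const, ← hav]
        nlinarith [sq_nonneg (av f - av g0)]
      refine h1.trans ?_
      rw [he]
      apply av_mono
      intro c
      simp only [hg0]
      have : h c - av g0 = av (fun Φ : Fin m → Ω => f (Fin.cons c Φ : Fin (m+1) → Ω) - g0 Φ) := by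
        rw [av_sub]
      rw [this]
      exact av_sq_le _
    · calc av (fun c => av fun Φ : Fin m → Ω => (f (Fin.cons c Φ : Fin (m+1) → Ω) - h c) ^ 2)
          ≤ av (fun c => ∑ t : Fin m, av fun Φ : Fin m → Ω => (f (Fin.cons c Φ : Fin (m+1) → Ω) - g t.succ (Fin.cons c Φ : Fin (m+1) → Ω))^2) := by
            apply av_mono
            intro c
            apply ih (fun Φ : Fin m → Ω => f (Fin.cons c Φ : Fin (m+1) → Ω)) (fun t Φ => g t.succ (Fin.cons c Φ : Fin (m+1) → Ω))
            intro t Φ d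
            have := hg t.succ (Fin.cons c Φ : Fin (m+1) → Ω) d
            rw [← this, Fin.cons_update]
        _ = _ := by
            rw [av_sum]
            apply sum_congr rfl
            intro t _
            rw [he]

end

noncomputable section

section NA
variable {ι Ω X : Type*} [Fintype ι] [DecidableEq ι] [Fintype Ω] [Nonempty Ω]

theorem na_coord (g : Ω → ℝ) (hg : ∀ c, 0 ≤ g c) (s : Ω → Prop) (h : Ω → ℝ)
    (mono : ∀ c c', s c → ¬ s c' → h c ≤ h c') :
    (av g - av (fun c => g c * ind (s c))) * av (fun c => g c * h c) ≤
      av g * av (fun c => g c * ind (¬ s c) * h c) := by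
  have e1 : av g - av (fun c => g c * ind (s c)) = av (fun c => g c * ind (¬ s c)) := by
    rw [← av_sub]; congr 1; funext c; rw [ind_not]; ring
  have e2 : av (fun c => g c * h c) = av (fun c => g c * ind (¬ s c) * h c) +
      av (fun c => g c * ind (s c) * h c) := by
    rw [← av_add]; congr 1; funext c; rw [ind_not]; ring
  have e3 : av g = av (fun c => g c * ind (¬ s c)) + av (fun c => g c * ind (s c)) := by
    rw [← e1]; ring
  rw [e1, e2]
  have key : av (fun c => g c * ind (¬ s c)) * av (fun c => g c * ind (s c) * h c) ≤
      av (fun c => g c * ind (s c)) * av (fun c => g c * ind (¬ s c) * h c) := by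
    rw [← av_mul_right, mul_comm (av fun c => g c * ind (s c)), ← av_mul_right]
    have l : ∀ c, g c * ind (¬ s c) * av (fun c => g c * ind (s c) * h c) =
      av (fun c' => g c * ind (¬ s c) * (g c' * ind (s c') * h c')) := fun c => by rw [av_mul_left]
    have l2 : ∀ c, g c * ind (¬ s c) * h c * av (fun c => g c * ind (s c)) =
      av (fun c' => g c * ind (¬ s c) * h c * (g c' * ind (s c'))) := fun c => by rw [av_mul_left]
    simp only [l, l2]
    apply av_mono; intro c; apply av_mono; intro c'
    by_cases h1 : s c
    · simp [ind, h1]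
    by_cases h2 : s c'
    · simp only [ind, h1, h2, not_false_eq_true, if_true, mul_one]
      have := mono c' c h2 h1
      have := mul_le_mul_of_nonneg_left this (mul_nonneg (hg c) (hg c'))
      linarith
    · simp [ind, h2]
  rw [e3, add_mul, mul_add]
  linarith [key]

theorem na_step (I : Finset ι) (g : Ω → ℝ) (hg : ∀ c, 0 ≤ g c) (s : Ω → Prop)
    (H : (ι → Ω) → ℝ)
    (mono : ∀ Φ, ∀ t ∈ I, ∀ c c', s c → ¬ s c' →
      H (Function.update Φ t c) ≤ H (Function.update Φ t c')) (J : Finset ι) (hJ : J ⊆ I) :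
    (av g - av (fun c => g c * ind (s c))) ^ J.card * av (fun Φ => (∏ t ∈ I, g (Φ t)) * H Φ) ≤
      (av g) ^ J.card * av (fun Φ => (∏ t ∈ I, g (Φ t)) * (∏ t ∈ J, ind (¬ s (Φ t))) * H Φ) := by
  have hgW : 0 ≤ av g := av_nonneg hg
  have hgw : 0 ≤ av g - av (fun c => g c * ind (s c)) := by
    rw [← av_sub]; apply av_nonneg; intro c
    nlinarith [hg c, ind_le_one (s c)]
  induction J using Finset.induction_on with
  | empty => simp
  | insert t J ht ih =>
    have htI : t ∈ I := hJ (mem_insert_self _ _)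
    have ih := ih (fun a ha => hJ (mem_insert_of_mem ha))
    rw [card_insert_of_notMem ht, pow_succ', pow_succ', mul_assoc, mul_assoc]
    have step : (av g - av (fun c => g c * ind (s c))) *
        av (fun Φ => (∏ t ∈ I, g (Φ t)) * (∏ t ∈ J, ind (¬ s (Φ t))) * H Φ) ≤
        av g * av (fun Φ => (∏ t ∈ I, g (Φ t)) * (∏ t ∈ insert t J, ind (¬ s (Φ t))) * H Φ) := by
      rw [av_update t, av_update t (fun Φ => (∏ t ∈ I, g (Φ t)) * (∏ t ∈ insert t J, ind (¬ s (Φ t))) * H Φ)]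
      rw [← av_mul_left, ← av_mul_left]
      apply av_mono
      intro Φ
      have p1 : ∀ c, (∏ t' ∈ I, g (Function.update Φ t c t')) = g c * ∏ t' ∈ I.erase t, g (Φ t') := by
        intro c
        rw [← mul_prod_erase I _ htI]
        simp only [Function.update_self]
        congr 1
        apply prod_congr rfl
        intro x hx
        rw [Function.update_of_ne (ne_of_mem_erase hx)]
      have p2 : ∀ c, (∏ t' ∈ J, ind (¬ s (Function.update Φ t c t'))) = ∏ t' ∈ J, ind (¬ s (Φ t')) := by
        intro c
        apply prod_congr rfl
        intro x hx
        rw [Function.update_of_ne (by rintro rfl; exact ht hx)]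
      have p3 : ∀ c, (∏ t' ∈ insert t J, ind (¬ s (Function.update Φ t c t'))) =
          ind (¬ s c) * ∏ t' ∈ J, ind (¬ s (Φ t')) := by
        intro c
        rw [prod_insert ht, p2]; simp
      set A0 := (∏ t' ∈ I.erase t, g (Φ t')) * (∏ t' ∈ J, ind (¬ s (Φ t'))) with hA0
      have hA0n : 0 ≤ A0 := mul_nonneg (prod_nonneg fun _ _ => hg _) (prod_nonneg fun _ _ => ind_nonneg _)
      have q1 : av (fun c => (∏ t' ∈ I, g (Function.update Φ t c t')) * (∏ t' ∈ J, ind (¬ s (Function.update Φ t c t'))) * H (Function.update Φ t c)) = A0 * av (fun c => g c * H (Function.update Φ t c)) := by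
        rw [← av_mul_left]; congr 1; funext c; rw [p1, p2, hA0]; ring
      have q2 : av (fun c => (∏ t' ∈ I, g (Function.update Φ t c t')) * (∏ t' ∈ insert t J, ind (¬ s (Function.update Φ t c t'))) * H (Function.update Φ t c)) = A0 * av (fun c => g c * ind (¬ s c) * H (Function.update Φ t c)) := by
        rw [← av_mul_left]; congr 1; funext c; rw [p1, p3, hA0]; ring
      rw [q1, q2]
      have := mul_le_mul_of_nonneg_left (na_coord g hg s (fun c => H (Function.update Φ t c)) (mono Φ t htI)) hA0n
      linarith
    calc _ ≤ (av g - av (fun c => g c * ind (s c))) * ((av g) ^ J.card * av (fun Φ => (∏ t ∈ I, g (Φ t)) * (∏ t ∈ J, ind (¬ s (Φ t))) * H Φ)) :=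
          mul_le_mul_of_nonneg_left ih hgw
      _ = (av g) ^ J.card * ((av g - av (fun c => g c * ind (s c))) * av (fun Φ => (∏ t ∈ I, g (Φ t)) * (∏ t ∈ J, ind (¬ s (Φ t))) * H Φ)) := by ring
      _ ≤ (av g) ^ J.card * (av g * av (fun Φ => (∏ t ∈ I, g (Φ t)) * (∏ t ∈ insert t J, ind (¬ s (Φ t))) * H Φ)) :=
          mul_le_mul_of_nonneg_left step (pow_nonneg hgW _)
      _ = _ := by ring

theorem na_prod (I : Finset ι) (g : Ω → ℝ) (hg : ∀ c, 0 ≤ g c) (hW : 0 < av g)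
    (s : X → Ω → Prop) (hs : ∀ x y c, s x c → s y c → x = y) (a : ℝ) (ha : a ≤ 1) (S : Finset X) :
    av (fun Φ : ι → Ω => (∏ t ∈ I, g (Φ t)) * ∏ x ∈ S, (1 - a * ind (∀ t ∈ I, ¬ s x (Φ t)))) ≤
      (av g) ^ I.card *
        ∏ x ∈ S, (1 - a * ((av g - av (fun c => g c * ind (s x c))) / av g) ^ I.card) := by
  have hρ : ∀ x, 0 ≤ (av g - av (fun c => g c * ind (s x c))) / av g ∧
      (av g - av (fun c => g c * ind (s x c))) / av g ≤ 1 := by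
    intro x
    constructor
    · apply div_nonneg _ hW.le
      rw [← av_sub]; apply av_nonneg; intro c
      nlinarith [hg c, ind_le_one (s x c)]
    · rw [div_le_one hW]
      have : 0 ≤ av (fun c => g c * ind (s x c)) := av_nonneg fun c => mul_nonneg (hg c) (ind_nonneg _)
      linarith
  induction S using Finset.induction_on with
  | empty =>
    simp only [prod_empty, mul_one]
    rw [av_pi_prod_finset I (fun _ => g)]; simp
  | insert y S hy ih =>
    rw [prod_insert hy]
    simp only [prod_insert hy]
    set H : (ι → Ω) → ℝ := fun Φ => ∏ x ∈ S, (1 - a * ind (∀ t ∈ I, ¬ s x (Φ t))) with hH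
    set ρ := (av g - av (fun c => g c * ind (s y c))) / av g with hρd
    have hρI0 : 0 ≤ ρ ^ I.card := pow_nonneg (hρ y).1 _
    have hρI1 : ρ ^ I.card ≤ 1 := pow_le_one₀ (hρ y).1 (hρ y).2
    have fac0 : ∀ P, 0 ≤ 1 - a * ind P := by
      intro P; unfold ind; split_ifs <;> linarith
    have nonz : ∀ (Φ : ι → Ω) (t) (_ : t ∈ I) (c c') (_ : s y c) (x) (_ : x ∈ S),
        ind (∀ t' ∈ I, ¬ s x (Function.update Φ t c' t')) ≤
        ind (∀ t' ∈ I, ¬ s x (Function.update Φ t c t')) := by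
      intro Φ t ht c c' hc x hx
      apply ind_mono
      intro h t' ht'
      by_cases htt : t' = t
      · subst htt; simp only [Function.update_self]
        intro hxc
        exact hy (hs x y c hxc hc ▸ hx)
      · have := h t' ht'
        rw [Function.update_of_ne htt] at this ⊢
        exact this
    have key : a * (ρ ^ I.card * av (fun Φ => (∏ t ∈ I, g (Φ t)) * H Φ)) ≤
        a * av (fun Φ => (∏ t ∈ I, g (Φ t)) * (∏ t ∈ I, ind (¬ s y (Φ t))) * H Φ) := by
      rcases le_total 0 a with h0 | h0
      · apply mul_le_mul_of_nonneg_left _ h0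
        have := na_step I g hg (s y) H ?_ I (Subset.refl _)
        · rw [hρd, div_pow, div_mul_eq_mul_div, div_le_iff₀ (pow_pos hW _)]
          linarith
        · intro Φ t ht c c' hc _
          apply prod_le_prod (fun x _ => fac0 _)
          intro x hx
          have := nonz Φ t ht c c' hc x hx
          nlinarith
      · have := na_step I g hg (s y) (fun Φ => - H Φ) ?_ I (Subset.refl _)
        · have e1 : av (fun Φ => (∏ t ∈ I, g (Φ t)) * (- H Φ)) = - av (fun Φ => (∏ t ∈ I, g (Φ t)) * H Φ) := by
            rw [← neg_one_mul, ← av_mul_left]; congr 1; funext Φ; ring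
          have e2 : av (fun Φ => (∏ t ∈ I, g (Φ t)) * (∏ t ∈ I, ind (¬ s y (Φ t))) * (- H Φ)) = - av (fun Φ => (∏ t ∈ I, g (Φ t)) * (∏ t ∈ I, ind (¬ s y (Φ t))) * H Φ) := by
            rw [← neg_one_mul, ← av_mul_left]; congr 1; funext Φ; ring
          rw [e1, e2] at this
          apply mul_le_mul_of_nonpos_left _ h0
          rw [hρd, div_pow, div_mul_eq_mul_div, le_div_iff₀ (pow_pos hW _)]
          linarith
        · intro Φ t ht c c' hc _
          apply neg_le_neg
          apply prod_le_prod (fun x _ => fac0 _)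
          intro x hx
          have := nonz Φ t ht c c' hc x hx
          nlinarith
    have split : av (fun Φ : ι → Ω => (∏ t ∈ I, g (Φ t)) * ((1 - a * ind (∀ t ∈ I, ¬ s y (Φ t))) * H Φ))
        = av (fun Φ => (∏ t ∈ I, g (Φ t)) * H Φ) - a * av (fun Φ => (∏ t ∈ I, g (Φ t)) * (∏ t ∈ I, ind (¬ s y (Φ t))) * H Φ) := by
      rw [← av_mul_left, ← av_sub]
      congr 1; funext Φ; rw [ind_forall_finset]; ring
    rw [split]
    have hfac : 0 ≤ 1 - a * ρ ^ I.card := by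
      rcases le_total 0 a with h0 | h0 <;> nlinarith
    calc _ ≤ (1 - a * ρ ^ I.card) * av (fun Φ => (∏ t ∈ I, g (Φ t)) * H Φ) := by linarith
      _ ≤ (1 - a * ρ ^ I.card) * ((av g) ^ I.card * ∏ x ∈ S, (1 - a * ((av g - av (fun c => g c * ind (s x c))) / av g) ^ I.card)) :=
        mul_le_mul_of_nonneg_left ih hfac
      _ = _ := by ring

end NA
end

noncomputable section

theorem litVal_iff {n : ℕ} (σ : Assignment n) (l : Lit n) : litVal σ l = true ↔ σ l.1 = l.2 := by
  unfold litVal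
  cases h : l.2 <;> simp

/-- A clause is satisfied by an assignment. -/
def csat {n k : ℕ} (σ : Assignment n) (c : Clause n k) : Prop := ∃ j, litVal σ (c j) = true

/-- Assignments satisfying the clauses with index in `I` and the literals of `A`. -/
def sol {n k m : ℕ} (I : Finset (Fin m)) (A : Finset (Lit n)) (Φ : Formula n k m) :
    Finset (Assignment n) :=
  univ.filter fun σ => (∀ t ∈ I, csat σ (Φ t)) ∧ ∀ l ∈ A, litVal σ l = true

/-- Number of solutions as a real number. -/
def Zc {n k m : ℕ} (I : Finset (Fin m)) (A : Finset (Lit n)) (Φ : Formula n k m) : ℝ :=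
  ((sol I A Φ).card : ℝ)

/-- Number of variables on which two assignments agree. -/
def agr {n : ℕ} (σ τ : Assignment n) : ℕ := (univ.filter fun x => σ x = τ x).card

theorem av_lit {n : ℕ} (f : Lit n → ℝ) :
    av f = (∑ x : Fin n, (f (x, true) + f (x, false))) / (2 * n) := by
  unfold av
  rw [Fintype.sum_prod_type]
  simp [mul_comm]

theorem litVal_pair_sum {n : ℕ} (σ : Assignment n) (x : Fin n) :
    ind (litVal σ (x, true) = true) + ind (litVal σ (x, false) = true) = 1 := by
  simp only [litVal_iff]
  cases σ x <;> simp [ind]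

theorem lit_false_av {n : ℕ} (hn : 0 < n) (σ : Assignment n) :
    av (fun l : Lit n => ind (¬ litVal σ l = true)) = 1 / 2 := by
  rw [av_lit]
  have : ∀ x : Fin n, ind (¬ litVal σ (x, true) = true) + ind (¬ litVal σ (x, false) = true) = 1 := by
    intro x
    rw [ind_not, ind_not]; linarith [litVal_pair_sum σ x]
  simp only [this]
  have hn' : (n:ℝ) ≠ 0 := by positivity
  simp
  field_simp

theorem lit_both_false_av {n : ℕ} (σ τ : Assignment n) :
    av (fun l : Lit n => ind (¬ litVal σ l = true ∧ ¬ litVal τ l = true)) = (agr σ τ) / (2 * n) := by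
  rw [av_lit]
  congr 1
  unfold agr
  rw [card_filter_eq_sum_ind]
  apply sum_congr rfl
  intro x _
  simp only [litVal_iff]
  cases h1 : σ x <;> cases h2 : τ x <;> simp [ind]

theorem ind_not_csat {n k : ℕ} (σ : Assignment n) (c : Clause n k) :
    ind (¬ csat σ c) = ∏ j, ind (¬ litVal σ (c j) = true) := by
  rw [← ind_forall_finset]
  simp [csat]

theorem viol_av {n k : ℕ} (hn : 0 < n) (σ : Assignment n) :
    av (fun c : Clause n k => ind (¬ csat σ c)) = (1 / 2) ^ k := by
  simp only [ind_not_csat]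
  rw [av_pi_prod (fun (_ : Fin k) l => ind (¬ litVal σ l = true))]
  simp only [lit_false_av hn]
  simp

theorem viol_both_av {n k : ℕ} (σ τ : Assignment n) :
    av (fun c : Clause n k => ind (¬ csat σ c ∧ ¬ csat τ c)) = ((agr σ τ) / (2 * n)) ^ k := by
  simp only [ind_and, ind_not_csat, ← prod_mul_distrib]
  rw [av_pi_prod (fun (_ : Fin k) l => ind (¬ litVal σ l = true) * ind (¬ litVal τ l = true))]
  simp only [← ind_and, lit_both_false_av]
  rw [prod_const, card_univ, Fintype.card_fin]

instance litNonempty {n : ℕ} [NeZero n] : Nonempty (Lit n) := ⟨(0, true)⟩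

theorem sat_av {n k : ℕ} [NeZero n] (σ : Assignment n) :
    av (fun c : Clause n k => ind (csat σ c)) = 1 - (1 / 2) ^ k := by
  have h := viol_av (k := k) (Nat.pos_of_ne_zero (NeZero.ne n)) σ
  have : (fun c : Clause n k => ind (csat σ c)) = fun c => 1 - ind (¬ csat σ c) := by
    funext c; rw [ind_not]; ring
  rw [this, av_sub, h, av_const]

theorem sat_both_av {n k : ℕ} [NeZero n] (σ τ : Assignment n) :
    av (fun c : Clause n k => ind (csat σ c ∧ csat τ c)) =
      1 - 2 * (1 / 2) ^ k + ((agr σ τ) / (2 * n)) ^ k := by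
  have h := viol_av (k := k) (Nat.pos_of_ne_zero (NeZero.ne n)) σ
  have h' := viol_av (k := k) (Nat.pos_of_ne_zero (NeZero.ne n)) τ
  have h2 := viol_both_av (k := k) σ τ
  have : (fun c : Clause n k => ind (csat σ c ∧ csat τ c)) =
      fun c => (1 - ind (¬ csat σ c) - ind (¬ csat τ c)) + ind (¬ csat σ c ∧ ¬ csat τ c) := by
    funext c; rw [ind_and, ind_and, ind_not, ind_not]; ring
  rw [this, av_add, av_sub, av_sub, h, h', h2, av_const]; ring

/-- Flip the assignment on the set `D`. -/
def flipA {n : ℕ} (σ : Assignment n) (D : Finset (Fin n)) : Assignment n :=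
  fun x => if x ∈ D then !(σ x) else σ x

theorem agr_flipA {n : ℕ} (σ : Assignment n) (D : Finset (Fin n)) :
    (agr σ (flipA σ D) : ℝ) = n - D.card := by
  have h : agr σ (flipA σ D) = (Dᶜ).card := by
    unfold agr
    congr 1
    ext x
    simp only [flipA, mem_filter, mem_univ, true_and, mem_compl]
    by_cases hx : x ∈ D <;> simp [hx]
  rw [h, card_compl, Fintype.card_fin]
  rw [Nat.cast_sub]
  simpa using card_le_univ D

/-- Flipping as an equivalence between sets and assignments. -/
def flipEquiv {n : ℕ} (σ : Assignment n) : Finset (Fin n) ≃ Assignment n where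
  toFun D := flipA σ D
  invFun τ := univ.filter fun x => σ x ≠ τ x
  left_inv D := by
    ext x
    simp only [flipA, mem_filter, mem_univ, true_and]
    by_cases hx : x ∈ D <;> simp [hx]
  right_inv τ := by
    funext x
    simp only [flipA, mem_filter, mem_univ, true_and]
    by_cases hx : σ x = τ x
    · simp [hx]
    · simp only [hx, ne_eq, not_false_eq_true, if_true]
      cases h1 : σ x <;> cases h2 : τ x <;> simp_all

theorem sum_flipA {n : ℕ} (σ : Assignment n) (f : Assignment n → ℝ) :
    ∑ τ, f τ = ∑ D : Finset (Fin n), f (flipA σ D) :=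
  (Equiv.sum_comp (flipEquiv σ) f).symm

/-- `x` supports the clause `c` under `σ`. -/
def critAt {n k : ℕ} (σ : Assignment n) (x : Fin n) (c : Clause n k) (j : Fin k) : Prop :=
  ((c j).1 = x ∧ litVal σ (c j) = true) ∧ ∀ j' ∈ univ.erase j, ¬ litVal σ (c j') = true

def crit {n k : ℕ} (σ : Assignment n) (x : Fin n) (c : Clause n k) : Prop :=
  ∃ j, critAt σ x c j

theorem critAt_unique {n k : ℕ} {σ : Assignment n} {x y : Fin n} {c : Clause n k} {j j' : Fin k}
    (h : critAt σ x c j) (h' : critAt σ y c j') : j = j' := by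
  by_contra hne
  exact h'.2 j (mem_erase.2 ⟨hne, mem_univ _⟩) h.1.2

theorem crit_unique {n k : ℕ} {σ : Assignment n} (x y : Fin n) (c : Clause n k)
    (h : crit σ x c) (h' : crit σ y c) : x = y := by
  obtain ⟨j, hj⟩ := h
  obtain ⟨j', hj'⟩ := h'
  have := critAt_unique hj hj'
  subst this
  rw [← hj.1.1, ← hj'.1.1]

theorem crit_csat {n k : ℕ} {σ : Assignment n} {x : Fin n} {c : Clause n k} (h : crit σ x c) :
    csat σ c := by
  obtain ⟨j, hj⟩ := h
  exact ⟨j, hj.1.2⟩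

theorem ind_crit {n k : ℕ} (σ : Assignment n) (x : Fin n) (c : Clause n k) :
    ind (crit σ x c) = ∑ j, ind (critAt σ x c j) := by
  by_cases h : crit σ x c
  · obtain ⟨j, hj⟩ := h
    rw [ind_true ⟨j, hj⟩, Finset.sum_eq_single j, ind_true hj]
    · intro b _ hb
      apply ind_false
      intro hb'
      exact hb (critAt_unique hb' hj)
    · simp
  · rw [ind_false h, Finset.sum_eq_zero]
    intro j _
    exact ind_false fun hj => h ⟨j, hj⟩

theorem lit_x_av {n : ℕ} (σ : Assignment n) (x : Fin n) :
    av (fun l : Lit n => ind (l.1 = x ∧ litVal σ l = true)) = 1 / (2 * n) := by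
  rw [av_lit]
  congr 1
  rw [Finset.sum_eq_single x]
  · have := litVal_pair_sum σ x
    simpa using this
  · intro b _ hb
    simp [ind, hb]
  · simp

theorem lit_D_av {n : ℕ} (σ : Assignment n) (D : Finset (Fin n)) :
    av (fun l : Lit n => ind (l.1 ∈ D ∧ ¬ litVal σ l = true)) = D.card / (2 * n) := by
  rw [av_lit]
  congr 1
  have : (D.card : ℝ) = ∑ x, ind (x ∈ D) := by
    rw [← card_filter_eq_sum_ind]; simp
  rw [this]
  apply sum_congr rfl
  intro x _
  rw [ind_and, ind_and, ind_not, ind_not]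
  have := litVal_pair_sum σ x
  simp only
  linear_combination (-ind (x ∈ D)) * this

theorem prod_fin_one {k : ℕ} (j : Fin k) (a b : ℝ) :
    (∏ i : Fin k, if i = j then a else b) = a * b ^ (k - 1) := by
  rw [← mul_prod_erase univ _ (mem_univ j)]
  simp only [if_true]
  congr 1
  rw [Finset.prod_congr rfl (g := fun _ => b)]
  · simp
  · intro i hi
    simp [ne_of_mem_erase hi]

theorem prod_fin_two {k : ℕ} (j j' : Fin k) (h : j' ≠ j) (a a' b : ℝ) :
    (∏ i : Fin k, if i = j then a else if i = j' then a' else b) = a * a' * b ^ (k - 2) := by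
  rw [← mul_prod_erase univ _ (mem_univ j), ← mul_prod_erase (univ.erase j) _ (mem_erase.2 ⟨h, mem_univ j'⟩)]
  simp only [if_true, h, if_false]
  rw [mul_assoc]
  congr 2
  rw [Finset.prod_congr rfl (g := fun _ => b)]
  · simp [h, Nat.sub_sub]
  · intro i hi
    have h1 := ne_of_mem_erase hi
    have h2 := ne_of_mem_erase (mem_of_mem_erase hi)
    simp [h1, h2]

theorem critAt_av {n k : ℕ} (hn : 0 < n) (σ : Assignment n) (x : Fin n) (j : Fin k) :
    av (fun c : Clause n k => ind (critAt σ x c j)) = (1 / 2) ^ k / n := by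
  have e : (fun c : Clause n k => ind (critAt σ x c j)) = fun c =>
      ∏ i, (if i = j then (fun l : Lit n => ind (l.1 = x ∧ litVal σ l = true))
        else (fun l : Lit n => ind (¬ litVal σ l = true))) (c i) := by
    funext c
    rw [← mul_prod_erase univ _ (mem_univ j)]
    simp only [if_true]
    unfold critAt
    rw [ind_and, ind_forall_finset]
    congr 1
    apply prod_congr rfl
    intro i hi
    simp [ne_of_mem_erase hi]
  rw [e, av_pi_prod (fun i => if i = j then (fun l : Lit n => ind (l.1 = x ∧ litVal σ l = true))
        else (fun l : Lit n => ind (¬ litVal σ l = true)))]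
  have e2 : ∀ i, av (if i = j then (fun l : Lit n => ind (l.1 = x ∧ litVal σ l = true))
        else (fun l : Lit n => ind (¬ litVal σ l = true))) = if i = j then 1 / (2 * (n:ℝ)) else 1/2 := by
    intro i
    split_ifs
    · exact lit_x_av σ x
    · exact lit_false_av hn σ
  simp only [e2]
  rw [prod_fin_one]
  obtain ⟨k', rfl⟩ : ∃ k', k = k' + 1 := ⟨k - 1, by have := j.pos; omega⟩
  simp only [Nat.add_sub_cancel, pow_succ]
  have : (n:ℝ) ≠ 0 := by positivity
  field_simp

theorem crit_av {n k : ℕ} (hn : 0 < n) (σ : Assignment n) (x : Fin n) :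
    av (fun c : Clause n k => ind (crit σ x c)) = k * (1 / 2) ^ k / n := by
  simp only [ind_crit]
  rw [av_sum]
  simp only [critAt_av hn]
  simp; ring

theorem crit_two_av {n k : ℕ} (hn : 0 < n) (σ : Assignment n) (D : Finset (Fin n)) (x : Fin n)
    (hx : x ∈ D) :
    av (fun c : Clause n k => ind (csat σ c ∧ csat (flipA σ D) c) * ind (crit σ x c)) ≤
      (k:ℝ) ^ 2 * (D.card / n) * (1 / 2) ^ k / n := by
  let g : Fin k → Fin k → Fin k → Lit n → ℝ := fun j j' i =>
    if i = j then (fun l : Lit n => ind (l.1 = x ∧ litVal σ l = true))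
        else if i = j' then (fun l : Lit n => ind (l.1 ∈ D ∧ ¬ litVal σ l = true))
        else (fun l : Lit n => ind (¬ litVal σ l = true))
  have gn : ∀ j j' i l, 0 ≤ g j j' i l := by
    intro j j' i l
    simp only [g]
    split_ifs <;> exact ind_nonneg _
  have hpt : ∀ c : Clause n k, ind (csat σ c ∧ csat (flipA σ D) c) * ind (crit σ x c) ≤
      ∑ j : Fin k, ∑ j' ∈ univ.erase j, ∏ i, g j j' i (c i) := by
    intro c
    have R0 : 0 ≤ ∑ j : Fin k, ∑ j' ∈ univ.erase j, ∏ i, g j j' i (c i) :=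
      sum_nonneg fun _ _ => sum_nonneg fun _ _ => prod_nonneg fun _ _ => gn _ _ _ _
    rw [← ind_and]
    by_cases h : (csat σ c ∧ csat (flipA σ D) c) ∧ crit σ x c
    · rw [ind_true h]
      obtain ⟨⟨_, j', hj'⟩, j, hj⟩ := h
      have hjj : j' ≠ j := by
        rintro rfl
        rw [litVal_iff] at hj'
        have h1 := hj.1.2
        rw [litVal_iff] at h1
        simp only [flipA, hj.1.1, hx, if_true] at hj'
        rw [hj.1.1] at h1
        rw [h1] at hj'
        cases h : (c j').2 <;> simp_all
      have hf := hj.2 j' (mem_erase.2 ⟨hjj, mem_univ _⟩)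
      have hD : (c j').1 ∈ D := by
        by_contra hD
        rw [litVal_iff] at hj' hf
        simp only [flipA, hD, if_false] at hj'
        exact hf hj'
      have h1 : ∏ i, g j j' i (c i) = 1 := by
        apply prod_eq_one
        intro i _
        simp only [g]
        split_ifs with h1 h2
        · subst h1; exact ind_true hj.1
        · subst h2; exact ind_true ⟨hD, hf⟩
        · exact ind_true (hj.2 i (mem_erase.2 ⟨h1, mem_univ _⟩))
      rw [← h1]
      refine le_trans ?_ (single_le_sum (f := fun j => ∑ j' ∈ univ.erase j, ∏ i, g j j' i (c i)) (fun a _ => sum_nonneg fun _ _ => prod_nonneg fun _ _ => gn _ _ _ _) (mem_univ j))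
      exact single_le_sum (f := fun j' => ∏ i, g j j' i (c i)) (fun a _ => prod_nonneg fun _ _ => gn _ _ _ _) (mem_erase.2 ⟨hjj, mem_univ _⟩)
    · rw [ind_false h]; exact R0
  refine (av_mono hpt).trans ?_
  rw [av_sum]
  have hn' : (0:ℝ) < n := by exact_mod_cast hn
  have h1 : ∀ j : Fin k, av (fun c : Clause n k => ∑ j' ∈ univ.erase j, ∏ i, g j j' i (c i)) ≤
      (k:ℝ) * (D.card / n) * (1 / 2) ^ k / n := by
    intro j
    rw [av_sum]
    have h2 : ∀ j' ∈ univ.erase j, av (fun c : Clause n k => ∏ i, g j j' i (c i)) = (D.card / n) * (1 / 2) ^ k / n := by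
      intro j' hj'
      have hne := ne_of_mem_erase hj'
      rw [av_pi_prod (g j j')]
      have e2 : ∀ i, av (g j j' i) = if i = j then 1 / (2 * (n:ℝ)) else if i = j' then D.card / (2 * (n:ℝ)) else 1/2 := by
        intro i
        simp only [g]
        split_ifs
        · exact lit_x_av σ x
        · exact lit_D_av σ D
        · exact lit_false_av hn σ
      simp only [e2]
      rw [prod_fin_two j j' hne]
      obtain ⟨k', rfl⟩ : ∃ k', k = k' + 2 := ⟨k - 2, by
        have := j.isLt
        have := j'.isLt
        have : (j:ℕ) ≠ j' := fun h => hne (Fin.ext h.symm)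
        omega⟩
      simp only [Nat.add_sub_cancel, pow_succ]
      field_simp
    rw [sum_congr rfl h2]
    simp only [sum_const, nsmul_eq_mul]
    have : (((univ.erase j).card : ℕ) : ℝ) ≤ k := by
      have := card_erase_le (s := (univ : Finset (Fin k))) (a := j)
      rw [card_univ, Fintype.card_fin] at this
      exact_mod_cast this
    calc _ ≤ (k:ℝ) * (D.card / n * (1 / 2) ^ k / n) := by gcongr
      _ = _ := by ring
  calc _ ≤ ∑ j : Fin k, (k:ℝ) * (D.card / n) * (1 / 2) ^ k / n := sum_le_sum fun j _ => h1 j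
    _ = _ := by simp; ring

end

noncomputable section

/-- Logarithm truncated from below. -/
def Lw (w z : ℝ) : ℝ := Real.log (max z w)

theorem Lw_mono {w z z' : ℝ} (hw : 0 < w) (h : z ≤ z') : Lw w z ≤ Lw w z' := by
  unfold Lw
  apply Real.log_le_log (lt_max_of_lt_right hw)
  exact max_le_max_right _ h

theorem Lw_le_of_le_mul {w z z' K : ℝ} (hw : 0 < w) (hK : 1 ≤ K) (h : z ≤ K * z') :
    Lw w z ≤ Real.log K + Lw w z' := by
  unfold Lw
  have hm : 0 < max z' w := lt_max_of_lt_right hw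
  rw [← Real.log_mul (by positivity) hm.ne']
  apply Real.log_le_log (lt_max_of_lt_right hw)
  apply max_le
  · exact h.trans (mul_le_mul_of_nonneg_left (le_max_left _ _) (by linarith))
  · calc w ≤ max z' w := le_max_right _ _
      _ ≤ K * max z' w := le_mul_of_one_le_left hm.le hK

theorem Lw_ge {w z : ℝ} (hw : 0 < w) : Real.log w ≤ Lw w z :=
  Real.log_le_log hw (le_max_right _ _)

theorem Lw_flat {w z : ℝ} (h : z ≤ w) : Lw w z = Real.log w := by
  unfold Lw; rw [max_eq_right h]

theorem Lw_sub_le {n : ℕ} {w z z' : ℝ} (hw : 1 ≤ w) (hz : z ≤ 2 ^ n) : Lw w z - Lw w z' ≤ n := by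
  rcases le_total z w with h | h
  · rw [Lw_flat h]
    have := Lw_ge (z := z') (lt_of_lt_of_le one_pos hw)
    have : (0:ℝ) ≤ n := by positivity
    linarith
  · have h1 := Lw_ge (z := z') (lt_of_lt_of_le one_pos hw)
    have h2 := Real.log_nonneg hw
    have h3 : Lw w z ≤ n := by
      unfold Lw
      rw [max_eq_left h]
      calc Real.log z ≤ Real.log (2 ^ n) := Real.log_le_log (by linarith) hz
        _ = n * Real.log 2 := by rw [Real.log_pow]
        _ ≤ n * 1 := by
          gcongr
          have := Real.log_two_lt_d9; linarith
        _ = n := mul_one _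
    linarith

section Z
variable {n k m : ℕ}

theorem Zc_nonneg (I : Finset (Fin m)) (A : Finset (Lit n)) (Φ : Formula n k m) : 0 ≤ Zc I A Φ := by
  unfold Zc; positivity

theorem Zc_le (I : Finset (Fin m)) (A : Finset (Lit n)) (Φ : Formula n k m) : Zc I A Φ ≤ 2 ^ n := by
  unfold Zc
  have := card_le_univ (sol I A Φ)
  simp at this
  exact_mod_cast this

theorem Zc_anti_I {I J : Finset (Fin m)} (h : I ⊆ J) (A : Finset (Lit n)) (Φ : Formula n k m) :
    Zc J A Φ ≤ Zc I A Φ := by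
  unfold Zc
  have : sol J A Φ ⊆ sol I A Φ := by
    intro σ
    simp only [sol, mem_filter, mem_univ, true_and]
    exact fun hσ => ⟨fun t ht => hσ.1 t (h ht), hσ.2⟩
  exact_mod_cast card_le_card this

theorem Zc_insert_le (I : Finset (Fin m)) (l : Lit n) (A : Finset (Lit n)) (Φ : Formula n k m) :
    Zc I (insert l A) Φ ≤ Zc I A Φ := by
  unfold Zc
  have : sol I (insert l A) Φ ⊆ sol I A Φ := by
    intro σ
    simp only [sol, mem_filter, mem_univ, true_and]
    exact fun hσ => ⟨hσ.1, fun l hl => hσ.2 l (mem_insert_of_mem hl)⟩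
  exact_mod_cast card_le_card this

theorem Zc_clause_le {I : Finset (Fin m)} {t : Fin m} (j : Fin k)
    (A : Finset (Lit n)) (Φ : Formula n k m) :
    Zc (I.erase t) (insert (Φ t j) A) Φ ≤ Zc I A Φ := by
  unfold Zc
  have : sol (I.erase t) (insert (Φ t j) A) Φ ⊆ sol I A Φ := by
    intro σ
    simp only [sol, mem_filter, mem_univ, true_and]
    intro hσ
    refine ⟨fun s hs => ?_, fun l hl => hσ.2 l (mem_insert_of_mem hl)⟩
    by_cases hst : s = t
    · subst hst; exact ⟨j, hσ.2 _ (mem_insert_self _ _)⟩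
    · exact hσ.1 s (mem_erase.2 ⟨hst, hs⟩)
  exact_mod_cast card_le_card this

theorem Zc_congr {I : Finset (Fin m)} (A : Finset (Lit n)) {Φ Ψ : Formula n k m}
    (h : ∀ t ∈ I, Φ t = Ψ t) : Zc I A Φ = Zc I A Ψ := by
  unfold Zc
  congr 2
  ext σ
  simp only [sol, mem_filter, mem_univ, true_and]
  constructor
  · exact fun hσ => ⟨fun t ht => h t ht ▸ hσ.1 t ht, hσ.2⟩
  · exact fun hσ => ⟨fun t ht => (h t ht).symm ▸ hσ.1 t ht, hσ.2⟩

theorem Zc_update (I : Finset (Fin m)) (A : Finset (Lit n)) (Φ : Formula n k m) (t : Fin m)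
    (c : Clause n k) : Zc (I.erase t) A (Function.update Φ t c) = Zc (I.erase t) A Φ :=
  Zc_congr A fun s hs => Function.update_of_ne (ne_of_mem_erase hs) _ _

/-- Negated literal. -/
def ngl (l : Lit n) : Lit n := (l.1, !l.2)

theorem litVal_ngl (σ : Assignment n) (l : Lit n) : litVal σ (ngl l) = true ↔ ¬ litVal σ l = true := by
  rw [litVal_iff, litVal_iff]
  unfold ngl
  cases h : l.2 <;> simp

theorem Zc_split (I : Finset (Fin m)) (A : Finset (Lit n)) (l : Lit n) (Φ : Formula n k m) :
    Zc I A Φ = Zc I (insert l A) Φ + Zc I (insert (ngl l) A) Φ := by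
  unfold Zc
  have h := card_filter_add_card_filter_not (s := sol I A Φ) (fun σ => litVal σ l = true)
  have h1 : (sol I A Φ).filter (fun σ => litVal σ l = true) = sol I (insert l A) Φ := by
    ext σ; simp only [sol, mem_filter, mem_univ, true_and, mem_insert, forall_eq_or_imp]; tauto
  have h2 : (sol I A Φ).filter (fun σ => ¬ litVal σ l = true) = sol I (insert (ngl l) A) Φ := by
    ext σ; simp only [sol, mem_filter, mem_univ, true_and, mem_insert, forall_eq_or_imp, litVal_ngl]; tauto
  rw [h1, h2] at h
  rw [← h]; push_cast; rfl

/-- Flip the sign of the occurrences of variable `x` in a clause. -/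
def flipC (x : Fin n) (c : Clause n k) : Clause n k := fun j => if (c j).1 = x then ngl (c j) else c j

theorem flipC_flipC (x : Fin n) (c : Clause n k) : flipC x (flipC x c) = c := by
  funext j
  unfold flipC
  by_cases h : (c j).1 = x
  · simp [h, ngl, Prod.ext_iff]
  · simp [h]

/-- The clause contains the variable `x`. -/
def has (x : Fin n) (c : Clause n k) : Prop := ∃ j, (c j).1 = x

theorem has_flipC (x : Fin n) (c : Clause n k) : has x (flipC x c) ↔ has x c := by
  unfold has flipC
  have : ∀ j, ((if (c j).1 = x then ngl (c j) else c j).1 = x) ↔ (c j).1 = x := by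
    intro j; split_ifs with h <;> simp [ngl, h]
  simp only [this]

theorem flipC_of_not_has {x : Fin n} {c : Clause n k} (h : ¬ has x c) : flipC x c = c := by
  funext j
  unfold flipC
  rw [if_neg]
  exact fun hj => h ⟨j, hj⟩

theorem litVal_flip_same (σ : Assignment n) (l : Lit n) :
    litVal (flipA σ {l.1}) (ngl l) = true ↔ litVal σ l = true := by
  rw [litVal_iff, litVal_iff]
  simp [flipA, ngl]

theorem litVal_flip_ne (σ : Assignment n) (x : Fin n) (l : Lit n) (h : l.1 ≠ x) :
    litVal (flipA σ {x}) l = true ↔ litVal σ l = true := by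
  rw [litVal_iff, litVal_iff]
  simp [flipA, h]

theorem csat_flip (σ : Assignment n) (x : Fin n) (c : Clause n k) :
    csat (flipA σ {x}) (flipC x c) ↔ csat σ c := by
  unfold csat
  apply exists_congr
  intro j
  unfold flipC
  by_cases h : (c j).1 = x
  · rw [if_pos h, ← h]; exact litVal_flip_same σ (c j)
  · rw [if_neg h]; exact litVal_flip_ne σ x _ h

theorem flipA_flipA (σ : Assignment n) (D : Finset (Fin n)) : flipA (flipA σ D) D = σ := by
  funext x; simp only [flipA]; by_cases h : x ∈ D <;> simp [h]

theorem Zc_flip (I : Finset (Fin m)) (A : Finset (Lit n)) (l : Lit n) (hA : ∀ l' ∈ A, l'.1 ≠ l.1)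
    (Φ : Formula n k m) :
    Zc I (insert l A) Φ = Zc I (insert (ngl l) A) (fun t => flipC l.1 (Φ t)) := by
  unfold Zc
  congr 1
  apply Finset.card_bij' (fun σ _ => flipA σ {l.1}) (fun σ _ => flipA σ {l.1})
  · intro σ hσ
    simp only [sol, mem_filter, mem_univ, true_and, mem_insert, forall_eq_or_imp] at hσ ⊢
    refine ⟨fun t ht => (csat_flip _ _ _).2 (hσ.1 t ht), (litVal_flip_same _ _).2 hσ.2.1, fun l' hl' => ?_⟩
    exact (litVal_flip_ne _ _ _ (hA l' hl')).2 (hσ.2.2 l' hl')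
  · intro σ hσ
    simp only [sol, mem_filter, mem_univ, true_and, mem_insert, forall_eq_or_imp] at hσ ⊢
    refine ⟨fun t ht => ?_, ?_, fun l' hl' => ?_⟩
    · have := hσ.1 t ht
      rw [← csat_flip _ l.1, flipC_flipC] at this; exact this
    · rw [← litVal_flip_same, flipA_flipA]; exact hσ.2.1
    · exact (litVal_flip_ne _ _ _ (hA l' hl')).2 (hσ.2.2 l' hl')
  · intro σ _; exact flipA_flipA _ _
  · intro σ _; exact flipA_flipA _ _

/-- Hybrid formula: the first `s` clauses are flipped at `x`. -/
def hyb (x : Fin n) (s : ℕ) (Φ : Formula n k m) : Formula n k m :=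
  fun t => if t.val < s then flipC x (Φ t) else Φ t

theorem hyb_hyb (x : Fin n) (s : ℕ) (Φ : Formula n k m) : hyb x s (hyb x s Φ) = Φ := by
  funext t
  unfold hyb
  by_cases h : t.val < s <;> simp [h, flipC_flipC]

theorem av_hyb (x : Fin n) (s : ℕ) (f : Formula n k m → ℝ) :
    av (fun Φ => f (hyb x s Φ)) = av f :=
  av_equiv (⟨hyb x s, hyb x s, hyb_hyb x s, hyb_hyb x s⟩ : Formula n k m ≃ Formula n k m) f

/-- Loss of the truncated log-count when fixing a literal. -/
def Gl (w : ℝ) (I : Finset (Fin m)) (A : Finset (Lit n)) (l : Lit n) (Φ : Formula n k m) : ℝ :=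
  Lw w (Zc I A Φ) - Lw w (Zc I (insert l A) Φ)

theorem Gl_nonneg {w : ℝ} (hw : 0 < w) (I : Finset (Fin m)) (A : Finset (Lit n)) (l : Lit n)
    (Φ : Formula n k m) : 0 ≤ Gl w I A l Φ :=
  sub_nonneg.2 (Lw_mono hw (Zc_insert_le _ _ _ _))

theorem Gl_le {w : ℝ} (hw : 1 ≤ w) (I : Finset (Fin m)) (A : Finset (Lit n)) (l : Lit n)
    (Φ : Formula n k m) : Gl w I A l Φ ≤ n := Lw_sub_le hw (Zc_le _ _ _)

/-- Loss of the truncated log-count when adding clause `t` containing `x`. -/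
def dl (w : ℝ) (I : Finset (Fin m)) (B : Finset (Lit n)) (x : Fin n) (t : Fin m)
    (Φ : Formula n k m) : ℝ :=
  ind (has x (Φ t)) * (Lw w (Zc (I.erase t) B Φ) - Lw w (Zc I B Φ))

theorem dl_nonneg {w : ℝ} (hw : 0 < w) (I : Finset (Fin m)) (B : Finset (Lit n)) (x : Fin n)
    (t : Fin m) (Φ : Formula n k m) : 0 ≤ dl w I B x t Φ :=
  mul_nonneg (ind_nonneg _) (sub_nonneg.2 (Lw_mono hw (Zc_anti_I (erase_subset _ _) _ _)))

theorem Gl_le_sum {w : ℝ} (hw : 0 < w) (I : Finset (Fin m)) (A : Finset (Lit n)) (l : Lit n)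
    (hA : ∀ l' ∈ A, l'.1 ≠ l.1) (Φ : Formula n k m) :
    Gl w I A l Φ ≤ 1 + ∑ t ∈ I, dl w I (insert (ngl l) A) l.1 t (hyb l.1 (t.val + 1) Φ) := by
  set B := insert (ngl l) A with hB
  have hlog : Real.log 2 ≤ 1 := by have := Real.log_two_lt_d9; linarith
  have hsum : 0 ≤ ∑ t ∈ I, dl w I B l.1 t (hyb l.1 (t.val + 1) Φ) :=
    sum_nonneg fun t _ => dl_nonneg hw _ _ _ _ _
  have hsp := Zc_split I A l Φ
  unfold Gl
  rcases le_total (Zc I B Φ) (Zc I (insert l A) Φ) with h | h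
  · have : Lw w (Zc I A Φ) ≤ Real.log 2 + Lw w (Zc I (insert l A) Φ) :=
      Lw_le_of_le_mul hw (by norm_num) (by rw [hsp]; linarith)
    linarith
  · have h1 : Lw w (Zc I A Φ) ≤ Real.log 2 + Lw w (Zc I B Φ) :=
      Lw_le_of_le_mul hw (by norm_num) (by rw [hsp]; linarith)
    have h2 : Zc I (insert l A) Φ = Zc I B (hyb l.1 m Φ) := by
      rw [Zc_flip I A l hA Φ]
      apply Zc_congr
      intro t _
      simp [hyb]
    have h3 : Zc I B Φ = Zc I B (hyb l.1 0 Φ) := by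
      apply Zc_congr; intro t _; simp [hyb]
    rw [h2]
    rw [h3] at h1
    set a : ℕ → ℝ := fun s => Lw w (Zc I B (hyb l.1 s Φ)) with ha
    have tel : a 0 - a m = ∑ t : Fin m, (a t.val - a (t.val + 1)) := by
      rw [Fin.sum_univ_eq_sum_range (fun s => a s - a (s+1)), Finset.sum_range_sub']
    have hle : ∑ t : Fin m, (a t.val - a (t.val + 1)) ≤ ∑ t ∈ I, dl w I B l.1 t (hyb l.1 (t.val + 1) Φ) := by
      rw [← Finset.sum_subset (subset_univ I)]
      · apply sum_le_sum
        intro t ht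
        by_cases hh : has l.1 (Φ t)
        · have hh' : has l.1 (hyb l.1 (t.val+1) Φ t) := by
            simp only [hyb, Nat.lt_succ_self, if_true]
            exact (has_flipC _ _).2 hh
          unfold dl
          rw [ind_true hh', one_mul]
          have : Zc (I.erase t) B (hyb l.1 (t.val+1) Φ) = Zc (I.erase t) B (hyb l.1 t.val Φ) := by
            apply Zc_congr
            intro s hs
            have hne : s.val ≠ t.val := fun e => ne_of_mem_erase hs (Fin.ext e)
            have : s.val < t.val + 1 ↔ s.val < t.val := by omega
            simp only [hyb, this]
          rw [this]
          have := Lw_mono hw (Zc_anti_I (erase_subset t I) B (hyb l.1 t.val Φ))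
          simp only [ha]
          linarith
        · have : a (t.val + 1) = a t.val := by
            simp only [ha]
            congr 1
            apply Zc_congr
            intro s hs
            by_cases hst : s = t
            · subst hst; simp [hyb, flipC_of_not_has hh]
            · have hne : s.val ≠ t.val := fun e => hst (Fin.ext e)
              have : s.val < t.val + 1 ↔ s.val < t.val := by omega
              simp only [hyb, this]
          rw [this, sub_self]
          exact dl_nonneg hw _ _ _ _ _
      · intro t _ ht
        rw [sub_eq_zero]
        simp only [ha]
        congr 1
        apply Zc_congr
        intro s hs
        have hst : s ≠ t := fun e => ht (e ▸ hs)
        have hne : s.val ≠ t.val := fun e => hst (Fin.ext e)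
        have : s.val < t.val + 1 ↔ s.val < t.val := by omega
        simp only [hyb, this]
    have : a 0 - a m ≤ ∑ t ∈ I, dl w I B l.1 t (hyb l.1 (t.val + 1) Φ) := tel ▸ hle
    simp only [ha] at this
    linarith

/-- Excess over `K`. -/
def pp (K z : ℝ) : ℝ := max (z - K) 0

theorem pp_nonneg (K z : ℝ) : 0 ≤ pp K z := le_max_right _ _
theorem le_pp (K z : ℝ) : z ≤ K + pp K z := by
  have := le_max_left (z - K) 0
  unfold pp; linarith
theorem pp_mono {K z z' : ℝ} (h : z ≤ z') : pp K z ≤ pp K z' := max_le_max_right _ (by linarith)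
theorem pp_of_le {K z : ℝ} (h : z ≤ K) : pp K z = 0 := max_eq_right (by linarith)
theorem pp_le {K z : ℝ} (hK : 0 ≤ K) (hz : 0 ≤ z) : pp K z ≤ z := max_le (by linarith) hz

theorem pp_Gl_le {w K K' : ℝ} (hw : 0 < w) (hK : 1 < K) (hK' : 0 ≤ K') (I : Finset (Fin m))
    (A : Finset (Lit n)) (l : Lit n)
    (hA : ∀ l' ∈ A, l'.1 ≠ l.1) (Φ : Formula n k m) :
    pp K (Gl w I A l Φ) ≤ (∑ t ∈ I, pp K' (dl w I (insert (ngl l) A) l.1 t (hyb l.1 (t.val + 1) Φ)))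
      + K' ^ 2 / (K - 1) * (∑ t ∈ I, ind (has l.1 (Φ t))) ^ 2 := by
  set B := insert (ngl l) A with hB
  set D := ∑ t ∈ I, ind (has l.1 (Φ t)) with hD
  have hD0 : 0 ≤ D := sum_nonneg fun _ _ => ind_nonneg _
  have hS0 : 0 ≤ ∑ t ∈ I, pp K' (dl w I B l.1 t (hyb l.1 (t.val + 1) Φ)) :=
    sum_nonneg fun _ _ => pp_nonneg _ _
  have h1 := Gl_le_sum hw I A l hA Φ
  rw [← hB] at h1
  have h2 : ∑ t ∈ I, dl w I B l.1 t (hyb l.1 (t.val + 1) Φ) ≤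
      (∑ t ∈ I, pp K' (dl w I B l.1 t (hyb l.1 (t.val + 1) Φ))) + K' * D := by
    rw [hD, mul_sum, ← sum_add_distrib]
    apply sum_le_sum
    intro t _
    by_cases hh : has l.1 (Φ t)
    · rw [ind_true hh, mul_one]; linarith [le_pp K' (dl w I B l.1 t (hyb l.1 (t.val + 1) Φ))]
    · have hh' : ¬ has l.1 (hyb l.1 (t.val+1) Φ t) := by
        simp only [hyb, Nat.lt_succ_self, if_true]
        rwa [has_flipC]
      have : dl w I B l.1 t (hyb l.1 (t.val + 1) Φ) = 0 := by
        unfold dl; rw [ind_false hh', zero_mul]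
      rw [this]
      exact add_nonneg (pp_nonneg _ _) (mul_nonneg hK' (ind_nonneg _))
  have h3 : K' * D - (K - 1) ≤ K' ^ 2 / (K - 1) * D ^ 2 := by
    have hL : 0 < K - 1 := by linarith
    rw [div_mul_eq_mul_div, le_div_iff₀ hL]
    nlinarith [sq_nonneg (K' * D - (K-1)), mul_nonneg hK' hD0, hL, mul_nonneg (mul_nonneg hK' hD0) hL.le]
  have h4 : 0 ≤ K' ^ 2 / (K - 1) * D ^ 2 := by
    have hL : 0 < K - 1 := by linarith
    positivity
  unfold pp at *
  apply max_le
  · linarith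
  · linarith

end Z
end

noncomputable section
section
variable {n k m : ℕ}

/-- Literals that are rarely true among the solutions. -/
def frz (I : Finset (Fin m)) (B : Finset (Lit n)) (Φ : Formula n k m) : Finset (Lit n) :=
  univ.filter fun l => 4 * Zc I (insert l B) Φ ≤ Zc I B Φ

/-- Few frozen literals, for all large subcubes. -/
def GoodL (w b : ℝ) (I : Finset (Fin m)) (Φ : Formula n k m) : Prop :=
  ∀ B : Finset (Lit n), w < Zc I B Φ → ((frz I B Φ).card : ℝ) ≤ b * (2 * n)

theorem Zc_eq_update (I : Finset (Fin m)) (t : Fin m) (Φ : Formula n k m) (c : Clause n k) :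
    (fun B => Zc (I.erase t) B (Function.update Φ t c)) = fun B => Zc (I.erase t) B Φ := by
  funext B; exact Zc_update _ _ _ _ _

theorem frz_update (I : Finset (Fin m)) (t : Fin m) (Φ : Formula n k m) (c : Clause n k)
    (B : Finset (Lit n)) : frz (I.erase t) B (Function.update Φ t c) = frz (I.erase t) B Φ := by
  unfold frz; simp only [Zc_update]

theorem GoodL_update (w b : ℝ) (I : Finset (Fin m)) (t : Fin m) (Φ : Formula n k m)
    (c : Clause n k) : GoodL w b (I.erase t) (Function.update Φ t c) ↔ GoodL w b (I.erase t) Φ := by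
  unfold GoodL; simp only [Zc_update, frz_update]

theorem Gl_update (w : ℝ) (I : Finset (Fin m)) (t : Fin m) (Φ : Formula n k m)
    (c : Clause n k) (B : Finset (Lit n)) (l : Lit n) :
    Gl w (I.erase t) B l (Function.update Φ t c) = Gl w (I.erase t) B l Φ := by
  unfold Gl; simp only [Zc_update]

theorem lit_var_av [NeZero n] (x : Fin n) : av (fun l : Lit n => ind (l.1 = x)) = 1 / n := by
  rw [av_lit, Finset.sum_eq_single x]
  · have : (n:ℝ) ≠ 0 := by exact_mod_cast NeZero.ne n
    simp [ind]; field_simp; norm_num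
  · intro b _ hb; simp [ind, hb]
  · simp

/-- Variables occurring in a set of literals. -/
def vars (B : Finset (Lit n)) : Finset (Fin n) := B.image Prod.fst

theorem lit_vars_av [NeZero n] (B : Finset (Lit n)) :
    av (fun l : Lit n => ind (l.1 ∈ vars B)) ≤ B.card / n := by
  have hn : (0:ℝ) < n := by exact_mod_cast Nat.pos_of_ne_zero (NeZero.ne n)
  rw [av_lit]
  have h1 : ∑ x : Fin n, (ind (x ∈ vars B) + ind (x ∈ vars B)) = 2 * ((vars B).card : ℝ) := by
    have : ((vars B).card : ℝ) = ∑ x, ind (x ∈ vars B) := by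
      rw [← card_filter_eq_sum_ind]; simp
    rw [this, mul_sum]; apply sum_congr rfl; intro x _; ring
  simp only [h1]
  have h2 : ((vars B).card : ℝ) ≤ B.card := by exact_mod_cast card_image_le
  rw [mul_div_mul_left _ _ (by norm_num)]
  gcongr

theorem has_av [NeZero n] (x : Fin n) :
    av (fun c : Clause n k => ind (has x c)) ≤ k / n := by
  have h : ∀ c : Clause n k, ind (has x c) ≤ ∑ j, ind ((c j).1 = x) := by
    intro c
    by_cases h : has x c
    · obtain ⟨j, hj⟩ := h
      calc ind (has x c) ≤ 1 := ind_le_one _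
        _ = ind ((c j).1 = x) := (ind_true hj).symm
        _ ≤ _ := single_le_sum (f := fun j => ind ((c j).1 = x)) (fun _ _ => ind_nonneg _) (mem_univ j)
    · rw [ind_false h]; exact sum_nonneg fun _ _ => ind_nonneg _
  refine (av_mono h).trans ?_
  rw [av_sum]
  have : ∀ j : Fin k, av (fun c : Clause n k => ind ((c j).1 = x)) = 1 / n := by
    intro j
    have := av_pi_prod_finset (Ω := Lit n) {j} (fun (_ : Fin k) l => ind (l.1 = x))
    simp only [prod_singleton] at this
    rw [this, lit_var_av]
  simp only [this]
  simp
  rw [div_eq_mul_inv]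

theorem prod_fin_three {j p q : Fin k} (h : p ≠ j) (h2 : q ≠ j) (h3 : q ≠ p) (a a' a'' : ℝ) :
    (∏ i : Fin k, if i = j then a else if i = p then a' else if i = q then a'' else 1) = a * a' * a'' := by
  rw [← mul_prod_erase univ _ (mem_univ j), ← mul_prod_erase (univ.erase j) _ (mem_erase.2 ⟨h, mem_univ p⟩),
    ← mul_prod_erase ((univ.erase j).erase p) _ (mem_erase.2 ⟨h3, mem_erase.2 ⟨h2, mem_univ q⟩⟩)]
  simp only [if_true, h, h2, h3, if_false]
  rw [Finset.prod_eq_one]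
  · ring
  · intro i hi
    simp only [mem_erase] at hi
    simp [hi.1, hi.2.1, hi.2.2.1]

theorem exists_two_others (hk : 3 ≤ k) (j : Fin k) : ∃ p q : Fin k, p ≠ j ∧ q ≠ j ∧ q ≠ p := by
  have h : 1 < (univ.erase j).card := by
    rw [card_erase_of_mem (mem_univ j), card_univ, Fintype.card_fin]; omega
  obtain ⟨p, hp, q, hq, hpq⟩ := one_lt_card.1 h
  exact ⟨p, q, ne_of_mem_erase hp, ne_of_mem_erase hq, hpq.symm⟩

/-- Clause average, for fixed other clauses. -/
theorem clause_key [NeZero n] (hk : 3 ≤ k) {w b K' : ℝ} (hw : 1 ≤ w) (hb : 0 ≤ b) (hK' : 2 ≤ K')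
    (I : Finset (Fin m)) (t : Fin m) (B : Finset (Lit n)) (x : Fin n) (Φ : Formula n k m) :
    av (fun c => pp K' (dl w I B x t (Function.update Φ t c))) ≤
      k / n * (2 * b ^ (k - 2) * av (fun l : Lit n => ind (l.1 ∉ vars B) * pp K' (Gl w (I.erase t) B l Φ))
        + n * (B.card / n) ^ 2 + n * ind (¬ GoodL w b (I.erase t) Φ)) := by
  have hw0 : 0 < w := by linarith
  have hn : (0:ℝ) < n := by exact_mod_cast Nat.pos_of_ne_zero (NeZero.ne n)
  set I' := I.erase t with hI'
  set g : Lit n → ℝ := fun l => ind (l.1 ∉ vars B) * pp K' (Gl w I' B l Φ) with hg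
  have hg0 : ∀ l, 0 ≤ g l := fun l => mul_nonneg (ind_nonneg _) (pp_nonneg _ _)
  have hdl : ∀ c, dl w I B x t (Function.update Φ t c) ≤ n * ind (has x c) := by
    intro c
    unfold dl
    rw [Function.update_self, mul_comm]
    exact mul_le_mul_of_nonneg_right (Lw_sub_le hw (Zc_le _ _ _)) (ind_nonneg _)
  have hdl0 : ∀ c, 0 ≤ dl w I B x t (Function.update Φ t c) := fun c => dl_nonneg hw0 _ _ _ _ _
  have avg0 : 0 ≤ av g := av_nonneg hg0
  by_cases hG : GoodL w b I' Φ
  swap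
  · rw [ind_true hG]
    calc av (fun c => pp K' (dl w I B x t (Function.update Φ t c)))
        ≤ av (fun c : Clause n k => n * ind (has x c)) :=
          av_mono fun c => (pp_le (by linarith) (hdl0 c)).trans (hdl c)
      _ = n * av (fun c : Clause n k => ind (has x c)) := av_mul_left _ _
      _ ≤ n * (k / n) := by gcongr; exact has_av x
      _ ≤ _ := by
        have : 0 ≤ 2 * b ^ (k - 2) * av g + n * (B.card / n) ^ 2 := by positivity
        have h2 : (0:ℝ) ≤ k / n := by positivity
        nlinarith
  rw [ind_false (not_not.2 hG), mul_zero, add_zero]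
  by_cases hZ : w < Zc I' B Φ
  swap
  · have : ∀ c, pp K' (dl w I B x t (Function.update Φ t c)) = 0 := by
      intro c
      apply pp_of_le
      have : dl w I B x t (Function.update Φ t c) = 0 := by
        unfold dl
        have h1 : Zc (I.erase t) B (Function.update Φ t c) ≤ w := by
          rw [Zc_update]; exact not_lt.1 hZ
        have h2 := (Zc_anti_I (erase_subset t I) B (Function.update Φ t c)).trans h1
        rw [Lw_flat h1, Lw_flat h2, sub_self, mul_zero]
      linarith
    simp only [this]
    rw [av_const]
    positivity
  have hF := hG B hZ
  set Fz := frz I' B Φ with hFz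
  choose p q hp hq hpq using fun j : Fin k => exists_two_others hk j
  let h1 : Fin k → Fin k → Lit n → ℝ := fun j i =>
    if i = j then (fun l => ind (l.1 = x)) else if i = p j then g else fun l => ind (l ∈ Fz)
  let h2 : Fin k → Fin k → Lit n → ℝ := fun j i =>
    if i = j then (fun l => ind (l.1 = x)) else if i = q j then g else fun l => ind (l ∈ Fz)
  let h3 : Fin k → Fin k → Lit n → ℝ := fun j i =>
    if i = j then (fun l => ind (l.1 = x)) else if i = p j then (fun l => ind (l.1 ∈ vars B)) else
      if i = q j then (fun l => ind (l.1 ∈ vars B)) else fun _ => 1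
  have h1n : ∀ j i l, 0 ≤ h1 j i l := by
    intro j i l; simp only [h1]; split_ifs
    · exact ind_nonneg _
    · exact hg0 _
    · exact ind_nonneg _
  have h2n : ∀ j i l, 0 ≤ h2 j i l := by
    intro j i l; simp only [h2]; split_ifs
    · exact ind_nonneg _
    · exact hg0 _
    · exact ind_nonneg _
  have h3n : ∀ j i l, 0 ≤ h3 j i l := by
    intro j i l; simp only [h3]; split_ifs
    · exact ind_nonneg _
    · exact ind_nonneg _
    · exact ind_nonneg _
    · exact zero_le_one
  have pt : ∀ c : Clause n k, pp K' (dl w I B x t (Function.update Φ t c)) ≤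
      ∑ j, ((∏ i, h1 j i (c i)) + (∏ i, h2 j i (c i)) + n * ∏ i, h3 j i (c i)) := by
    intro c
    have P1 : ∀ j, 0 ≤ ∏ i, h1 j i (c i) := fun j => prod_nonneg fun _ _ => h1n _ _ _
    have P2 : ∀ j, 0 ≤ ∏ i, h2 j i (c i) := fun j => prod_nonneg fun _ _ => h2n _ _ _
    have P3 : ∀ j, 0 ≤ n * ∏ i, h3 j i (c i) := fun j => mul_nonneg hn.le (prod_nonneg fun _ _ => h3n _ _ _)
    have R0 : ∀ j, 0 ≤ (∏ i, h1 j i (c i)) + (∏ i, h2 j i (c i)) + n * ∏ i, h3 j i (c i) :=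
      fun j => add_nonneg (add_nonneg (P1 j) (P2 j)) (P3 j)
    by_cases hx : has x c
    swap
    · rw [pp_of_le]
      · exact sum_nonneg fun j _ => R0 j
      · have : dl w I B x t (Function.update Φ t c) = 0 := by
          unfold dl; rw [Function.update_self, ind_false hx, zero_mul]
        linarith
    obtain ⟨j, hj⟩ := hx
    -- loss is at most Gl of any literal
    have hle : ∀ i, dl w I B x t (Function.update Φ t c) ≤ Gl w I' B (c i) Φ := by
      intro i
      unfold dl Gl
      rw [Function.update_self, ind_true ⟨j, hj⟩, one_mul, Zc_update]
      have := Zc_clause_le (I := I) (t := t) i B (Function.update Φ t c)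
      rw [Function.update_self, Zc_update] at this
      have := Lw_mono hw0 this
      linarith
    by_cases hfr : ∀ i, c i ∈ Fz
    swap
    · rw [pp_of_le]
      · exact sum_nonneg fun j _ => R0 j
      · push Not at hfr
        obtain ⟨i, hi⟩ := hfr
        simp only [hFz, frz, mem_filter, mem_univ, true_and, not_le] at hi
        have h4 : Gl w I' B (c i) Φ ≤ Real.log 4 := by
          have := Lw_le_of_le_mul hw0 (by norm_num) hi.le
          unfold Gl; linarith
        have h5 : Real.log 4 ≤ 2 := by
          have h6 : Real.log 4 = 2 * Real.log 2 := by
            rw [show (4:ℝ) = 2 ^ 2 by norm_num, Real.log_pow]; norm_num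
          have := Real.log_two_lt_d9; linarith
        linarith [hle i]
    refine le_trans ?_ (single_le_sum (f := fun j => (∏ i, h1 j i (c i)) + (∏ i, h2 j i (c i)) + n * ∏ i, h3 j i (c i)) (fun j _ => R0 j) (mem_univ j))
    have dec1 : ∀ (p : Fin k) (hp : p ≠ j) (f : Lit n → ℝ), (∏ i, (if i = j then (fun l : Lit n => ind (l.1 = x)) else if i = p then f else fun l => ind (l ∈ Fz)) (c i)) = f (c p) := by
      intro p hp f
      have : ∀ i, (if i = j then (fun l : Lit n => ind (l.1 = x)) else if i = p then f else fun l => ind (l ∈ Fz)) (c i) = if i = j then 1 else if i = p then f (c p) else 1 := by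
        intro i
        split_ifs with h h'
        · subst h; exact ind_true hj
        · subst h'; rfl
        · exact ind_true (hfr i)
      simp only [this]
      rw [prod_fin_two j p hp]; simp
    by_cases hv1 : (c (p j)).1 ∈ vars B
    · by_cases hv2 : (c (q j)).1 ∈ vars B
      · have : ∏ i, h3 j i (c i) = 1 := by
          apply prod_eq_one
          intro i _
          simp only [h3]
          split_ifs with h h' h''
          · subst h; exact ind_true hj
          · subst h'; exact ind_true hv1
          · subst h''; exact ind_true hv2
          · rfl
        rw [this, mul_one]
        have h7 := (pp_le (by linarith) (hdl0 c) : pp K' _ ≤ _)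
        have h8 := hdl c
        rw [ind_true ⟨j, hj⟩, mul_one] at h8
        linarith [P1 j, P2 j]
      · have : ∏ i, h2 j i (c i) = pp K' (Gl w I' B (c (q j)) Φ) := by
          simp only [h2]
          rw [dec1 (q j) (hq j) g]
          simp only [hg]; rw [ind_true hv2, one_mul]
        have h9 := pp_mono (K := K') (hle (q j))
        linarith [P1 j, P3 j]
    · have : ∏ i, h1 j i (c i) = pp K' (Gl w I' B (c (p j)) Φ) := by
        simp only [h1]
        rw [dec1 (p j) (hp j) g]
        simp only [hg]; rw [ind_true hv1, one_mul]
      have h9 := pp_mono (K := K') (hle (p j))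
      linarith [P2 j, P3 j]
  have aF : av (fun l : Lit n => ind (l ∈ Fz)) ≤ b := by
    rw [av_ind]
    have : (Fintype.card (Lit n) : ℝ) = 2 * n := by simp [mul_comm]
    rw [this, div_le_iff₀ (by positivity)]
    simpa using hF
  have aF0 : 0 ≤ av (fun l : Lit n => ind (l ∈ Fz)) := av_nonneg fun _ => ind_nonneg _
  have a12 : ∀ (j p : Fin k) (hp : p ≠ j), av (fun c : Clause n k => ∏ i, (if i = j then (fun l : Lit n => ind (l.1 = x)) else if i = p then g else fun l => ind (l ∈ Fz)) (c i)) ≤ 1 / n * av g * b ^ (k - 2) := by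
    intro j p hp
    rw [av_pi_prod (fun i => if i = j then (fun l : Lit n => ind (l.1 = x)) else if i = p then g else fun l => ind (l ∈ Fz))]
    have : ∀ i, av (if i = j then (fun l : Lit n => ind (l.1 = x)) else if i = p then g else fun l => ind (l ∈ Fz)) = if i = j then (1 / (n:ℝ)) else if i = p then av g else av (fun l : Lit n => ind (l ∈ Fz)) := by
      intro i; split_ifs
      · exact lit_var_av x
      · rfl
      · rfl
    simp only [this]
    rw [prod_fin_two j p hp]
    gcongr
  have a3 : ∀ j, av (fun c : Clause n k => ∏ i, h3 j i (c i)) ≤ 1 / n * (B.card / n) ^ 2 := by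
    intro j
    rw [av_pi_prod (h3 j)]
    have : ∀ i, av (h3 j i) = if i = j then (1 / (n:ℝ)) else if i = p j then av (fun l : Lit n => ind (l.1 ∈ vars B)) else if i = q j then av (fun l : Lit n => ind (l.1 ∈ vars B)) else 1 := by
      intro i; simp only [h3]; split_ifs
      · exact lit_var_av x
      · rfl
      · rfl
      · exact av_const _
    simp only [this]
    rw [prod_fin_three (hp j) (hq j) (hpq j), mul_assoc, sq]
    have v0 : 0 ≤ av (fun l : Lit n => ind (l.1 ∈ vars B)) := av_nonneg fun _ => ind_nonneg _
    have v1 := lit_vars_av B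
    gcongr
  refine (av_mono pt).trans ?_
  rw [av_sum]
  calc _ ≤ ∑ j : Fin k, (1 / n * av g * b ^ (k - 2) + 1 / n * av g * b ^ (k - 2) + n * (1 / n * (B.card / n) ^ 2)) := by
        apply sum_le_sum
        intro j _
        rw [av_add, av_add, av_mul_left]
        gcongr
        · exact a12 j (p j) (hp j)
        · exact a12 j (q j) (hq j)
        · exact a3 j
    _ = _ := by
        simp; field_simp; ring

end
end

noncomputable section
section
variable {n k m : ℕ}

theorem av_single {ι Ω : Type*} [Fintype ι] [DecidableEq ι] [Fintype Ω] [Nonempty Ω] (t : ι) (h : Ω → ℝ) :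
    av (fun Φ : ι → Ω => h (Φ t)) = av h := by
  rw [av_update t]
  simp only [Function.update_self]
  rw [av_const]

theorem deg_sq [NeZero n] (I : Finset (Fin m)) (x : Fin n) {R : ℝ} (hI : (I.card : ℝ) ≤ R * n) :
    av (fun Φ : Formula n k m => (∑ t ∈ I, ind (has x (Φ t))) ^ 2) ≤ (k * R) ^ 2 + k * R := by
  have hn : (0:ℝ) < n := by exact_mod_cast Nat.pos_of_ne_zero (NeZero.ne n)
  have e : ∀ Φ : Formula n k m, (∑ t ∈ I, ind (has x (Φ t))) ^ 2 =
      ∑ t ∈ I, ∑ s ∈ I, ind (has x (Φ t)) * ind (has x (Φ s)) := by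
    intro Φ; rw [sq, sum_mul_sum]
  simp only [e]
  rw [av_sum]
  simp only [av_sum]
  have hp : ∀ t s : Fin m, av (fun Φ : Formula n k m => ind (has x (Φ t)) * ind (has x (Φ s))) ≤
      (k / n) ^ 2 + if t = s then (k / n : ℝ) else 0 := by
    intro t s
    by_cases hts : t = s
    · subst hts
      have h1 : av (fun Φ : Formula n k m => ind (has x (Φ t)) * ind (has x (Φ t))) ≤ k / n := by
        have e2 : ∀ Φ : Formula n k m, ind (has x (Φ t)) * ind (has x (Φ t)) = ind (has x (Φ t)) := by
          intro Φ; unfold ind; split_ifs <;> simp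
        simp only [e2]
        rw [av_single t (fun c => ind (has x c))]
        exact has_av x
      simp only [if_true]
      have : (0:ℝ) ≤ (k / n) ^ 2 := by positivity
      linarith
    · rw [if_neg hts, add_zero, av_update t]
      have e3 : ∀ Φ : Formula n k m, av (fun c => ind (has x (Function.update Φ t c t)) *
          ind (has x (Function.update Φ t c s))) ≤ (k / n) * ind (has x (Φ s)) := by
        intro Φ
        have hs : s ≠ t := fun h => hts h.symm
        simp only [Function.update_self, Function.update_of_ne hs]
        rw [av_mul_right]
        exact mul_le_mul_of_nonneg_right (has_av x) (ind_nonneg _)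
      refine (av_mono e3).trans ?_
      rw [av_mul_left, av_single s (fun c => ind (has x c)), sq]
      exact mul_le_mul_of_nonneg_left (has_av x) (by positivity)
  refine (sum_le_sum fun t _ => sum_le_sum fun s _ => hp t s).trans ?_
  simp only [sum_add_distrib, sum_const, nsmul_eq_mul, sum_ite_eq]
  rw [sum_congr rfl (fun t ht => if_pos ht), sum_const, nsmul_eq_mul]
  have h1 : (I.card : ℝ) * (k / n) ≤ k * R := by
    rw [mul_div_assoc', div_le_iff₀ hn]
    have : (0:ℝ) ≤ k := by positivity
    nlinarith
  have h0 : 0 ≤ (I.card : ℝ) * (k / n) := by positivity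
  nlinarith

/-- One step of the recursion. -/
theorem step_bound [NeZero n] (hk : 3 ≤ k) {w b K K' R U ε : ℝ} (hw : 1 ≤ w) (hb : 0 ≤ b) (hK' : 2 ≤ K')
    (hK : 1 < K) (hR : 0 ≤ R) (hU : 0 ≤ U) (hε0 : 0 ≤ ε)
    (I : Finset (Fin m)) (hI : (I.card : ℝ) ≤ R * n) (A : Finset (Lit n)) (l : Lit n)
    (hA : ∀ l' ∈ A, l'.1 ≠ l.1)
    (hUt : ∀ t ∈ I, ∀ l' : Lit n, l'.1 ∉ vars (insert (ngl l) A) →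
      av (fun Φ : Formula n k m => pp K' (Gl w (I.erase t) (insert (ngl l) A) l' Φ)) ≤ U)
    (hε : ∀ t ∈ I, av (fun Φ : Formula n k m => ind (¬ GoodL w b (I.erase t) Φ)) ≤ ε) :
    av (fun Φ : Formula n k m => pp K (Gl w I A l Φ)) ≤
      k * R * (2 * b ^ (k - 2) * U + (A.card + 1) ^ 2 / n + n * ε) +
        K' ^ 2 / (K - 1) * ((k * R) ^ 2 + k * R) := by
  have hn : (0:ℝ) < n := by exact_mod_cast Nat.pos_of_ne_zero (NeZero.ne n)
  have hw0 : 0 < w := by linarith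
  set B := insert (ngl l) A with hB
  refine (av_mono fun Φ => pp_Gl_le hw0 hK (by linarith : 0 ≤ K') I A l hA Φ).trans ?_
  rw [av_add, av_mul_left, av_sum]
  refine add_le_add ?_ (mul_le_mul_of_nonneg_left (deg_sq I l.1 hI)
    (div_nonneg (sq_nonneg _) (by linarith)))
  have hBc : (B.card : ℝ) ≤ A.card + 1 := by exact_mod_cast card_insert_le _ _
  have ht : ∀ t ∈ I, av (fun Φ : Formula n k m => pp K' (dl w I B l.1 t (hyb l.1 (t.val+1) Φ))) ≤
      k / n * (2 * b ^ (k - 2) * U + (A.card + 1) ^ 2 / n + n * ε) := by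
    intro t ht
    rw [av_hyb l.1 (t.val+1) (fun Φ => pp K' (dl w I B l.1 t Φ)), av_update t]
    refine (av_mono fun Φ => clause_key hk hw hb hK' I t B l.1 Φ).trans ?_
    rw [av_mul_left]
    refine mul_le_mul_of_nonneg_left ?_ (by positivity)
    rw [av_add, av_add, av_mul_left, av_mul_left, av_const]
    refine add_le_add (add_le_add ?_ ?_) ?_
    · refine mul_le_mul_of_nonneg_left ?_ (by positivity)
      rw [av_comm]
      refine av_le_const fun l' => ?_
      rw [av_mul_left]
      by_cases hl : l'.1 ∉ vars B
      · simpa [ind, hl] using hUt t ht l' hl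
      · simpa [ind, hl] using hU
    · have : (n:ℝ) * (B.card / n) ^ 2 = B.card ^ 2 / n := by field_simp
      rw [this]; gcongr
    · rw [av_mul_left]; exact mul_le_mul_of_nonneg_left (hε t ht) hn.le
  refine (sum_le_sum ht).trans ?_
  rw [sum_const, nsmul_eq_mul, ← mul_assoc]
  refine mul_le_mul_of_nonneg_right ?_ (by positivity)
  rw [mul_div_assoc', div_le_iff₀ hn]
  have : (0:ℝ) ≤ k := by positivity
  nlinarith

/-- The bounds produced by the recursion. -/
def vseq (n0 E M : ℝ) (K : ℕ → ℝ) : ℕ → ℝ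
  | 0 => n0
  | j + 1 => vseq n0 E M K j / 2 + E + K j ^ 2 / (K (j + 1) - 1) * M

theorem vseq_nonneg {n0 E M : ℝ} {K : ℕ → ℝ} (h0 : 0 ≤ n0) (hE : 0 ≤ E) (hM : 0 ≤ M) (hK : ∀ j, 2 ≤ K j)
    (j : ℕ) : 0 ≤ vseq n0 E M K j := by
  induction j with
  | zero => exact h0
  | succ j ih =>
    have := hK (j+1)
    have h : 0 ≤ K j ^ 2 / (K (j + 1) - 1) * M := mul_nonneg (div_nonneg (sq_nonneg _) (by linarith)) hM
    simp only [vseq]; linarith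

theorem rec_bound [NeZero n] (hk : 3 ≤ k) {w b R ε : ℝ} (hw : 1 ≤ w) (hb : 0 ≤ b) (hR : 0 ≤ R) (hε0 : 0 ≤ ε)
    (hκ : k * R * (2 * b ^ (k - 2)) ≤ 1 / 2) (K : ℕ → ℝ) (hK : ∀ j, 2 ≤ K j) (T : ℕ)
    (j : ℕ) : ∀ (I : Finset (Fin m)) (_ : (I.card : ℝ) ≤ R * n) (A : Finset (Lit n)) (l : Lit n)
    (_ : ∀ l' ∈ A, l'.1 ≠ l.1) (_ : A.card + j ≤ T)
    (_ : ∀ I' ⊆ I, I.card ≤ I'.card + j →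
      av (fun Φ : Formula n k m => ind (¬ GoodL w b I' Φ)) ≤ ε),
    av (fun Φ : Formula n k m => pp (K j) (Gl w I A l Φ)) ≤
      vseq n (k * R * ((T + 1) ^ 2 / n + n * ε)) ((k * R) ^ 2 + k * R) K j := by
  have hn : (0:ℝ) < n := by exact_mod_cast Nat.pos_of_ne_zero (NeZero.ne n)
  induction j with
  | zero =>
    intro I hI A l hA hT hG
    simp only [vseq]
    refine av_le_const fun Φ => ?_
    have h2 := hK 0
    have h1 := Gl_le hw I A l Φ
    exact max_le (by linarith) hn.le
  | succ j ih =>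
    intro I hI A l hA hT hG
    have hE : 0 ≤ k * R * ((T + 1) ^ 2 / n + n * ε) := by positivity
    have hv := vseq_nonneg (n0 := n) (E := k * R * ((T + 1) ^ 2 / n + n * ε))
      (M := (k * R) ^ 2 + k * R) (K := K) hn.le hE (by positivity) hK j
    have hK1 := hK (j+1)
    have hs := step_bound (K := K (j+1)) (K' := K j) hk hw hb (hK j) (by linarith) hR hv hε0 I hI A l hA
      (fun t ht l' hl' => by
        refine ih (I.erase t) ?_ (insert (ngl l) A) l' ?_ ?_ ?_
        · refine le_trans ?_ hI
          exact_mod_cast card_le_card (erase_subset t I)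
        · intro l'' hl'' he
          exact hl' (mem_image.2 ⟨l'', hl'', he⟩)
        · have := card_insert_le (ngl l) A
          omega
        · intro I' hI' hc
          refine hG I' (hI'.trans (erase_subset _ _)) ?_
          rw [card_erase_of_mem ht] at hc
          omega)
      (fun t ht => hG _ (erase_subset _ _) (by rw [card_erase_of_mem ht]; omega))
    refine hs.trans ?_
    simp only [vseq]
    have hAc : ((A.card : ℝ) + 1) ^ 2 / n ≤ (T + 1) ^ 2 / n := by
      have : (A.card : ℝ) ≤ T := by exact_mod_cast (by omega : A.card ≤ T)
      gcongr
    have hkR : 0 ≤ k * R := by positivity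
    have h3 := mul_le_mul_of_nonneg_left hAc hkR
    have h4 := mul_le_mul_of_nonneg_right hκ hv
    nlinarith

theorem vseq_const {n0 E M : ℝ} (h0 : 0 ≤ n0) (hE : 0 ≤ E) (hM : 0 ≤ M) (K : ℕ → ℝ) (L : ℕ)
    (hK : ∀ j ≤ L, K j = 2) : ∀ j ≤ L, vseq n0 E M K j ≤ n0 / 2 ^ j + 2 * (E + 4 * M) := by
  intro j hj
  induction j with
  | zero => simp [vseq]; positivity
  | succ j ih =>
    have := ih (by omega)
    simp only [vseq, hK j (by omega), hK (j+1) hj]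
    have e : n0 / 2 ^ (j+1) = n0 / 2 ^ j / 2 := by rw [pow_succ]; field_simp
    rw [e]
    linarith

theorem vseq_add (n0 E M : ℝ) (K : ℕ → ℝ) (L j : ℕ) :
    vseq n0 E M K (L + j) = vseq (vseq n0 E M K L) E M (fun i => K (L + i)) j := by
  induction j with
  | zero => rfl
  | succ j ih => rw [← add_assoc]; simp only [vseq]; rw [ih]; rfl

/-- Growing thresholds. -/
def Kgr (M : ℝ) : ℕ → ℝ
  | 0 => 2
  | j + 1 => 1 + Kgr M j ^ 2 * (M + 1) * 2 ^ (j + 1)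

theorem Kgr_ge {M : ℝ} (hM : 0 ≤ M) (j : ℕ) : 2 ≤ Kgr M j := by
  induction j with
  | zero => simp [Kgr]
  | succ j ih =>
    simp only [Kgr]
    have h1 : (1:ℝ) ≤ 2 ^ (j+1) := one_le_pow₀ (by norm_num)
    have h2 : 1 ≤ Kgr M j ^ 2 * (M + 1) := by nlinarith
    nlinarith

theorem vseq_gr {n0 E M : ℝ} (hE : 0 ≤ E) (hM : 0 ≤ M) (j : ℕ) :
    vseq n0 E M (Kgr M) j ≤ (n0 + j) / 2 ^ j + 2 * E := by
  induction j with
  | zero => simp [vseq]; positivity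
  | succ j ih =>
    simp only [vseq, Kgr]
    have hk := Kgr_ge hM j
    have h2 : (0:ℝ) < 2 ^ (j+1) := by positivity
    have e : Kgr M j ^ 2 / (1 + Kgr M j ^ 2 * (M + 1) * 2 ^ (j + 1) - 1) * M ≤ 1 / 2 ^ (j+1) := by
      have : Kgr M j ^ 2 / (1 + Kgr M j ^ 2 * (M + 1) * 2 ^ (j + 1) - 1) * M = M / (M + 1) / 2 ^ (j+1) := by
        field_simp; ring_nf
      rw [this]
      gcongr
      rw [div_le_one (by linarith)]; linarith
    have e2 : (n0 + ((j+1 : ℕ) : ℝ)) / 2 ^ (j+1) = (n0 + j) / 2 ^ j / 2 + 1 / 2 ^ (j+1) := by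
      rw [pow_succ]; push_cast; field_simp; ring
    rw [e2]
    linarith

theorem gl_bound [NeZero n] (hk : 3 ≤ k) {w b R ε : ℝ} (hw : 1 ≤ w) (hb : 0 ≤ b) (hR : 0 ≤ R) (hε0 : 0 ≤ ε)
    (hκ : k * R * (2 * b ^ (k - 2)) ≤ 1 / 2) (L J : ℕ) (hL : (n : ℝ) ≤ 2 ^ L) (I : Finset (Fin m))
    (hI : (I.card : ℝ) ≤ R * n) (l : Lit n)
    (hG : ∀ I' ⊆ I, I.card ≤ I'.card + (L + J) →
      av (fun Φ : Formula n k m => ind (¬ GoodL w b I' Φ)) ≤ ε)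
    {E M : ℝ} (hE : E = k * R * (((L + J : ℕ) + 1) ^ 2 / n + n * ε)) (hM : M = (k * R) ^ 2 + k * R) :
    av (fun Φ : Formula n k m => pp (Kgr M J) (Gl w I ∅ l Φ)) ≤
      (1 + 2 * (E + 4 * M) + J) / 2 ^ J + 2 * E := by
  have hn : (0:ℝ) < n := by exact_mod_cast Nat.pos_of_ne_zero (NeZero.ne n)
  have hE0 : 0 ≤ E := by rw [hE]; positivity
  have hM0 : 0 ≤ M := by rw [hM]; positivity
  set K : ℕ → ℝ := fun j => if j ≤ L then 2 else Kgr M (j - L) with hKdef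
  have hK : ∀ j, 2 ≤ K j := by
    intro j; simp only [hKdef]; split_ifs
    · exact le_rfl
    · exact Kgr_ge hM0 _
  have hKs : (fun i => K (L + i)) = Kgr M := by
    funext i
    simp only [hKdef]
    split_ifs with h
    · have : i = 0 := by omega
      subst this; rfl
    · congr 1; omega
  have h1 := rec_bound (k := k) (m := m) hk hw hb hR hε0 hκ K hK (L + J) (L + J) I hI ∅ l (by simp) (by simp) hG
  rw [← hE, ← hM, vseq_add, hKs] at h1
  have h2 : K (L + J) = Kgr M J := congrFun hKs J
  rw [h2] at h1
  have h3 := vseq_const (n0 := n) (E := E) (M := M) hn.le hE0 hM0 K L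
    (fun j hj => by simp only [hKdef, if_pos hj]) L le_rfl
  have h4 : (n:ℝ) / 2 ^ L ≤ 1 := by rw [div_le_one (by positivity)]; exact hL
  refine h1.trans ((vseq_gr hE0 hM0 J).trans ?_)
  gcongr
  linarith

end
end

noncomputable section
section
variable {n k m : ℕ}

/-- Among large sets of solutions few pairs agree much. -/
def PairGood (δ θ w : ℝ) (I : Finset (Fin m)) (Φ : Formula n k m) : Prop :=
  ∀ S ⊆ sol I ∅ Φ, w ≤ (S.card : ℝ) →
    (((S ×ˢ S).filter fun q => (1 + δ) / 2 * n < agr q.1 q.2).card : ℝ) ≤ θ * (S.card : ℝ) ^ 2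

theorem PairGood_mono {δ θ w w' : ℝ} (h : w ≤ w') {I : Finset (Fin m)} {Φ : Formula n k m}
    (hP : PairGood δ θ w I Φ) : PairGood δ θ w' I Φ :=
  fun S hS hw => hP S hS (h.trans hw)

theorem agr_le (σ τ : Assignment n) : agr σ τ ≤ n := by
  unfold agr
  exact (card_le_univ _).trans (by simp)

/-- Sum over pairs of a monotone function of the agreement. -/
theorem pair_sum_le {δ θ : ℝ} (S : Finset (Assignment n))
    (hS : (((S ×ˢ S).filter fun q => (1 + δ) / 2 * n < agr q.1 q.2).card : ℝ) ≤ θ * (S.card : ℝ) ^ 2)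
    (f : ℝ → ℝ) (hf : ∀ a b, 0 ≤ a → a ≤ b → f a ≤ f b) (hf0 : 0 ≤ f 0) (hδ : 0 ≤ δ) :
    ∑ σ ∈ S, ∑ τ ∈ S, f (agr σ τ) ≤ (f ((1 + δ) / 2 * n) + θ * f n) * (S.card : ℝ) ^ 2 := by
  rw [← sum_product']
  have h1 : ∀ q ∈ S ×ˢ S, f (agr q.1 q.2) ≤ f ((1 + δ) / 2 * n) +
      ind ((1 + δ) / 2 * n < agr q.1 q.2) * f n := by
    intro q _
    have hn0 : (0:ℝ) ≤ (1 + δ) / 2 * n := by positivity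
    by_cases h : (1 + δ) / 2 * n < agr q.1 q.2
    · rw [ind_true h, one_mul]
      have : f (agr q.1 q.2) ≤ f n := hf _ _ (by positivity) (by exact_mod_cast agr_le _ _)
      have h2 := hf 0 ((1 + δ) / 2 * n) le_rfl hn0
      linarith
    · rw [ind_false h, zero_mul, add_zero]
      exact hf _ _ (by positivity) (not_lt.1 h)
  refine (sum_le_sum h1).trans ?_
  rw [sum_add_distrib, ← sum_mul, ← card_filter_eq_sum_ind, sum_const, card_product, nsmul_eq_mul]
  have hfn : 0 ≤ f n := hf0.trans (hf 0 n le_rfl (by positivity))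
  have := mul_le_mul_of_nonneg_right hS hfn
  push_cast
  nlinarith

theorem sol_subset (I : Finset (Fin m)) (B : Finset (Lit n)) (Φ : Formula n k m) :
    sol I B Φ ⊆ sol I ∅ Φ := by
  intro σ hσ
  simp only [sol, mem_filter, mem_univ, true_and] at hσ ⊢
  exact ⟨hσ.1, by simp⟩

theorem Zc_insert_eq (I : Finset (Fin m)) (B : Finset (Lit n)) (l : Lit n) (Φ : Formula n k m) :
    Zc I (insert l B) Φ = ∑ σ ∈ sol I B Φ, ind (litVal σ l = true) := by
  rw [← card_filter_eq_sum_ind]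
  unfold Zc sol
  rw [filter_filter]
  congr 2
  ext σ
  simp only [mem_filter, mem_univ, true_and, mem_insert, forall_eq_or_imp]
  tauto

theorem sum_lit_true (σ : Assignment n) : ∑ l : Lit n, ind (litVal σ l = true) = n := by
  rw [Fintype.sum_prod_type]
  have : ∀ x : Fin n, ∑ y : Bool, ind (litVal σ (x, y) = true) = 1 := by
    intro x
    rw [Fintype.sum_bool]
    exact litVal_pair_sum σ x
  simp only [this]; simp

theorem sum_lit_both (σ τ : Assignment n) :
    ∑ l : Lit n, ind (litVal σ l = true) * ind (litVal τ l = true) = agr σ τ := by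
  rw [Fintype.sum_prod_type]
  have : ∀ x : Fin n, ∑ y : Bool, ind (litVal σ (x, y) = true) * ind (litVal τ (x, y) = true)
      = ind (σ x = τ x) := by
    intro x
    rw [Fintype.sum_bool]
    simp only [litVal_iff]
    cases σ x <;> cases τ x <;> simp [ind]
  simp only [this]
  rw [← card_filter_eq_sum_ind]
  rfl

theorem PairGood.goodL {δ θ w b : ℝ} {I : Finset (Fin m)} {Φ : Formula n k m}
    (h : PairGood δ θ w I Φ) (hw : 0 < w) (hδ : 0 ≤ δ) (hθ : θ ≤ δ / 2) (hb : b = 8 * δ) :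
    GoodL w b I Φ := by
  intro B hB
  set S := sol I B Φ with hS
  set N : ℝ := (S.card : ℝ) with hN
  have hN0 : 0 < N := hw.trans hB
  have h1 := h S (sol_subset I B Φ) hB.le
  have h2 := pair_sum_le S h1 (fun x => x) (fun a b _ h => h) le_rfl hδ
  have e1 : ∑ l : Lit n, Zc I (insert l B) Φ = n * N := by
    simp only [Zc_insert_eq]
    rw [sum_comm]
    simp only [sum_lit_true, sum_const, nsmul_eq_mul]
    rw [mul_comm]
  have e2 : ∑ l : Lit n, Zc I (insert l B) Φ ^ 2 = ∑ σ ∈ S, ∑ τ ∈ S, (agr σ τ : ℝ) := by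
    simp only [Zc_insert_eq, sq, sum_mul_sum]
    rw [sum_comm]
    refine sum_congr rfl fun σ _ => ?_
    rw [sum_comm]
    refine sum_congr rfl fun τ _ => ?_
    exact sum_lit_both σ τ
  have e3 : ∑ l : Lit n, (Zc I (insert l B) Φ - N / 2) ^ 2 ≤ (δ / 2 + θ) * n * N ^ 2 := by
    have : ∑ l : Lit n, (Zc I (insert l B) Φ - N / 2) ^ 2 =
        ∑ l : Lit n, Zc I (insert l B) Φ ^ 2 - N * ∑ l : Lit n, Zc I (insert l B) Φ + 2 * n * (N ^ 2 / 4) := by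
      rw [mul_sum, ← sum_sub_distrib]
      have hc : (2 * n * (N ^ 2 / 4) : ℝ) = ∑ l : Lit n, N ^ 2 / 4 := by
        rw [sum_const, card_univ, Fintype.card_prod, nsmul_eq_mul]; simp; left; ring
      rw [hc, ← sum_add_distrib]
      refine sum_congr rfl fun l _ => ?_
      ring
    rw [this, e1, e2]
    nlinarith
  have e4 : ((frz I B Φ).card : ℝ) * (N ^ 2 / 16) ≤ ∑ l : Lit n, (Zc I (insert l B) Φ - N / 2) ^ 2 := by
    rw [← nsmul_eq_mul, ← sum_const]
    refine (sum_le_sum fun l hl => ?_).trans (sum_le_sum_of_subset_of_nonneg (subset_univ (frz I B Φ))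
      fun _ _ _ => sq_nonneg _)
    simp only [frz, mem_filter, mem_univ, true_and] at hl
    have hl' : 4 * Zc I (insert l B) Φ ≤ N := hl
    nlinarith
  have hN2 : 0 < N ^ 2 := by positivity
  have e5 : (((frz I B Φ).card : ℝ) / 16) * N ^ 2 ≤ ((δ / 2 + θ) * n) * N ^ 2 := by linarith
  have e6 := le_of_mul_le_mul_right e5 hN2
  have hn : (0:ℝ) ≤ n := by positivity
  rw [hb]
  nlinarith [mul_le_mul_of_nonneg_right hθ hn]

theorem Zc_insert_t (I : Finset (Fin m)) (t : Fin m) (ht : t ∉ I) (Φ : Formula n k m) (c : Clause n k) :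
    Zc (insert t I) ∅ (Function.update Φ t c) = ∑ σ ∈ sol I ∅ Φ, ind (csat σ c) := by
  rw [← card_filter_eq_sum_ind]
  unfold Zc sol
  rw [filter_filter]
  congr 2
  ext σ
  have h1 : ∀ s ∈ I, Function.update Φ t c s = Φ s := fun s hs =>
    Function.update_of_ne (fun h : s = t => ht (h ▸ hs)) _ _
  simp only [mem_filter, mem_univ, true_and, mem_insert, forall_eq_or_imp, Function.update_self]
  constructor
  · rintro ⟨⟨h2, h3⟩, h4⟩
    exact ⟨⟨fun s hs => by rw [← h1 s hs]; exact h3 s hs, h4⟩, h2⟩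
  · rintro ⟨⟨h2, h3⟩, h4⟩
    exact ⟨⟨h4, fun s hs => by rw [h1 s hs]; exact h2 s hs⟩, h3⟩

theorem neg_log_le {y : ℝ} (hy : y ≤ 3 / 4) : - Real.log (1 - y) ≤ y + 4 * y ^ 2 := by
  have h1 : 0 < 1 - y := by linarith
  rw [← Real.log_inv]
  have hz : 0 < 1 + (y + 4 * y ^ 2) := by nlinarith [sq_nonneg (y + 1/8)]
  have h2 : (1 - y)⁻¹ ≤ 1 + (y + 4 * y ^ 2) := by
    rw [inv_le_iff_one_le_mul₀ h1]
    nlinarith [mul_nonneg (sq_nonneg y) (by linarith : 0 ≤ 3/4 - y)]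
  have := Real.log_le_sub_one_of_pos hz
  have h3 := Real.log_le_log (inv_pos.2 h1) h2
  linarith

theorem frz_prod_av [NeZero n] (hk : 1 ≤ k) {b : ℝ} (F : Finset (Lit n)) (hb : (F.card : ℝ) ≤ b * (2 * n))
    (j : Fin k) (g : Lit n → ℝ) (hg : ∀ l, 0 ≤ g l) :
    av (fun c : Clause n k => ind (∀ i, c i ∈ F) * g (c j)) ≤ b ^ (k - 1) * av g := by
  have hn : (0:ℝ) < n := by exact_mod_cast Nat.pos_of_ne_zero (NeZero.ne n)
  have e : ∀ c : Clause n k, ind (∀ i, c i ∈ F) * g (c j) ≤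
      ∏ i, (if i = j then g else fun l => ind (l ∈ F)) (c i) := by
    intro c
    by_cases h : ∀ i, c i ∈ F
    · rw [ind_true h, one_mul]
      have : ∀ i, (if i = j then g else fun l => ind (l ∈ F)) (c i) = if i = j then g (c j) else 1 := by
        intro i
        split_ifs with hi
        · rw [hi]
        · exact ind_true (h i)
      simp only [this]
      rw [prod_fin_one]; simp
    · rw [ind_false h, zero_mul]
      refine prod_nonneg fun i _ => ?_
      split_ifs
      · exact hg _
      · exact ind_nonneg _
  refine (av_mono e).trans ?_
  rw [av_pi_prod (fun (i : Fin k) => if i = j then g else fun l => ind (l ∈ F))]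
  have hF : av (fun l : Lit n => ind (l ∈ F)) ≤ b := by
    rw [av_ind]
    simp only [Fintype.card_prod, Fintype.card_fin, Fintype.card_bool]
    rw [div_le_iff₀ (by push_cast; positivity)]
    push_cast
    simp only [filter_mem_eq_inter, univ_inter]
    linarith
  have hF0 : 0 ≤ av (fun l : Lit n => ind (l ∈ F)) := av_nonneg fun _ => ind_nonneg _
  have : ∀ i : Fin k, av (if i = j then g else fun l => ind (l ∈ F)) =
      if i = j then av g else av (fun l : Lit n => ind (l ∈ F)) := by
    intro i; split_ifs <;> rfl
  simp only [this]
  rw [prod_fin_one, mul_comm]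
  exact mul_le_mul_of_nonneg_right (pow_le_pow_left₀ hF0 hF _) (av_nonneg hg)

theorem drift_point [NeZero n] (hk : 1 ≤ k) {w δ θ b p : ℝ} (hp : p = (1 / 2) ^ k) (hw : 1 ≤ w)
    (hδ : 0 ≤ δ) (hθ0 : 0 ≤ θ) (hθ : θ ≤ δ / 2) (hb : b = 8 * δ)
    (I : Finset (Fin m)) (t : Fin m) (ht : t ∉ I) (Φ : Formula n k m) :
    av (fun c => Lw w (Zc I ∅ Φ) - Lw ((1 - p) * w) (Zc (insert t I) ∅ (Function.update Φ t c))) ≤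
      - Real.log (1 - p) + 16 * (p ^ 2 * ((1 + δ) ^ k - 1) + θ * p)
        + b ^ (k - 1) * (av (fun l => Gl w I ∅ l Φ) + 1) + n * ind (¬ PairGood δ θ w I Φ) := by
  have hn : (0:ℝ) < n := by exact_mod_cast Nat.pos_of_ne_zero (NeZero.ne n)
  have hw0 : 0 < w := by linarith
  have hp0 : 0 < p := by rw [hp]; positivity
  have hp1 : p ≤ 1 / 2 := by
    rw [hp]; calc ((1:ℝ)/2) ^ k ≤ (1/2) ^ 1 := pow_le_pow_of_le_one (by norm_num) (by norm_num) hk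
      _ = 1 / 2 := by norm_num
  have hq : 0 < 1 - p := by linarith
  have hb0 : 0 ≤ b := by rw [hb]; linarith
  have hδk : 1 ≤ (1 + δ) ^ k := one_le_pow₀ (by linarith)
  have hG0 : 0 ≤ av (fun l => Gl w I ∅ l Φ) := av_nonneg fun l => Gl_nonneg hw0 _ _ _ _
  have t1 : 0 ≤ 16 * (p ^ 2 * ((1 + δ) ^ k - 1) + θ * p) := by
    have : 0 ≤ p ^ 2 * ((1 + δ) ^ k - 1) := mul_nonneg (sq_nonneg _) (by linarith)
    positivity
  have t2 : 0 ≤ b ^ (k - 1) * (av (fun l => Gl w I ∅ l Φ) + 1) := by positivity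
  have t3 : 0 ≤ n * ind (¬ PairGood δ θ w I Φ) := mul_nonneg hn.le (ind_nonneg _)
  -- general comparison of floors
  have hfl : ∀ z, Real.log (1 - p) + Lw w z ≤ Lw ((1 - p) * w) z := by
    intro z
    unfold Lw
    rw [← Real.log_mul hq.ne' (lt_max_of_lt_right hw0).ne']
    refine Real.log_le_log (mul_pos hq (lt_max_of_lt_right hw0)) ?_
    rcases le_total z w with h | h
    · rw [max_eq_right h]; exact le_max_right _ _
    · rw [max_eq_left h]
      refine le_trans ?_ (le_max_left _ _)
      nlinarith
  have hZ' : ∀ c, Zc (insert t I) ∅ (Function.update Φ t c) ≤ Zc I ∅ Φ := by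
    intro c
    rw [Zc_insert_t I t ht]
    unfold Zc
    calc ∑ σ ∈ sol I ∅ Φ, ind (csat σ c) ≤ ∑ σ ∈ sol I ∅ Φ, 1 := sum_le_sum fun _ _ => ind_le_one _
      _ = _ := by simp
  by_cases hZ : Zc I ∅ Φ ≤ w
  · refine (av_le_const (c := - Real.log (1 - p)) fun c => ?_).trans (by linarith)
    have := hfl (Zc (insert t I) ∅ (Function.update Φ t c))
    have h2 := Lw_ge (z := Zc (insert t I) ∅ (Function.update Φ t c)) hw0
    rw [Lw_flat hZ]
    linarith
  rw [not_le] at hZ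
  by_cases hP : PairGood δ θ w I Φ
  swap
  · rw [ind_true hP, mul_one]
    refine (av_le_const (c := - Real.log (1 - p) + n) fun c => ?_).trans (by linarith)
    have := hfl (Zc (insert t I) ∅ (Function.update Φ t c))
    have h2 := Lw_sub_le (z' := Zc (insert t I) ∅ (Function.update Φ t c)) hw (Zc_le I ∅ Φ)
    linarith
  -- main case
  have hGL := hP.goodL hw0 hδ hθ hb ∅ hZ
  set S := sol I ∅ Φ with hS
  set Z : ℝ := Zc I ∅ Φ with hZd
  have hZS : Z = (S.card : ℝ) := rfl
  have hZ0 : 0 < Z := hw0.trans hZ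
  let j0 : Fin k := ⟨0, hk⟩
  set X : Clause n k → ℝ := fun c => (∑ σ ∈ S, ind (¬ csat σ c)) / Z with hX
  have hZX : ∀ c, Zc (insert t I) ∅ (Function.update Φ t c) = Z * (1 - X c) := by
    intro c
    rw [Zc_insert_t I t ht]
    simp only [hX, ind_not, sum_sub_distrib, sum_const, nsmul_eq_mul, mul_one]
    rw [← hZS]
    field_simp; ring
  have hpt : ∀ c, Lw w Z - Lw ((1 - p) * w) (Zc (insert t I) ∅ (Function.update Φ t c)) ≤
      - Real.log (1 - p) + (X c - p) / (1 - p) + 16 * (X c - p) ^ 2 +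
        ind (∀ i, c i ∈ frz I ∅ Φ) * (Gl w I ∅ (c j0) Φ + 1) := by
    intro c
    have hX0 : 0 ≤ X c := div_nonneg (sum_nonneg fun _ _ => ind_nonneg _) hZ0.le
    by_cases hc : ∀ i, c i ∈ frz I ∅ Φ
    · rw [ind_true hc, one_mul]
      have h1 := hfl (Zc (insert t I) ∅ (Function.update Φ t c))
      have h2 : Zc I (insert (c j0) ∅) Φ ≤ Zc (insert t I) ∅ (Function.update Φ t c) := by
        have := Zc_clause_le (I := insert t I) (t := t) j0 ∅ (Function.update Φ t c)
        rw [Function.update_self, Zc_update, erase_insert ht] at this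
        exact this
      have h3 := Lw_mono hw0 h2
      have h4 : -1 ≤ (X c - p) / (1 - p) := by
        rw [le_div_iff₀ hq]; linarith
      have h5 : Gl w I ∅ (c j0) Φ = Lw w Z - Lw w (Zc I (insert (c j0) ∅) Φ) := rfl
      rw [h5]
      nlinarith [sq_nonneg (X c - p)]
    · rw [ind_false hc, zero_mul, add_zero]
      push Not at hc
      obtain ⟨i, hi⟩ := hc
      simp only [frz, mem_filter, mem_univ, true_and, not_le] at hi
      have h2 : Zc I (insert (c i) ∅) Φ ≤ Zc (insert t I) ∅ (Function.update Φ t c) := by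
        have := Zc_clause_le (I := insert t I) (t := t) i ∅ (Function.update Φ t c)
        rw [Function.update_self, Zc_update, erase_insert ht] at this
        exact this
      rw [hZX] at h2 ⊢
      have h3 : X c < 3 / 4 := by
        have : Z * (1/4) < Z * (1 - X c) := by linarith
        have := lt_of_mul_lt_mul_left this hZ0.le
        linarith
      have h4 : Lw w Z = Real.log Z := by unfold Lw; rw [max_eq_left hZ.le]
      have h5 : Real.log (Z * (1 - X c)) ≤ Lw ((1 - p) * w) (Z * (1 - X c)) :=
        Real.log_le_log (mul_pos hZ0 (by linarith)) (le_max_left _ _)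
      rw [Real.log_mul hZ0.ne' (by linarith)] at h5
      have hy : (X c - p) / (1 - p) ≤ 3 / 4 := by
        rw [div_le_iff₀ hq]; linarith
      have h6 := neg_log_le hy
      have h7 : 1 - X c = (1 - p) * (1 - (X c - p) / (1 - p)) := by field_simp; ring
      have h8 : Real.log (1 - X c) = Real.log (1 - p) + Real.log (1 - (X c - p) / (1 - p)) := by
        rw [← Real.log_mul hq.ne' (by linarith), ← h7]
      have h9 : 4 * ((X c - p) / (1 - p)) ^ 2 ≤ 16 * (X c - p) ^ 2 := by
        rw [div_pow, mul_div_assoc', div_le_iff₀ (by positivity)]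
        have : (1:ℝ)/4 ≤ (1-p)^2 := by nlinarith
        nlinarith [sq_nonneg (X c - p)]
      rw [h4]
      linarith
  refine (av_mono hpt).trans ?_
  have hXav : av X = p := by
    have e : X = fun c => (∑ σ ∈ S, ind (¬ csat σ c)) * Z⁻¹ := by
      funext c; simp only [hX]; rw [div_eq_mul_inv]
    rw [e, av_mul_right, av_sum]
    simp only [viol_av (Nat.pos_of_ne_zero (NeZero.ne n)), sum_const, nsmul_eq_mul]
    rw [← hZS, hp]; field_simp
  have hX2 : av (fun c => (X c) ^ 2) ≤ p ^ 2 * (1 + δ) ^ k + θ * p := by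
    have e : (fun c => (X c) ^ 2) = fun c => (∑ σ ∈ S, ∑ τ ∈ S, ind (¬ csat σ c ∧ ¬ csat τ c)) * (Z^2)⁻¹ := by
      funext c; simp only [hX, ind_and]; rw [div_pow, div_eq_mul_inv, sq (∑ σ ∈ S, ind (¬ csat σ c)), sum_mul_sum]
    rw [e, av_mul_right, av_sum]
    simp only [av_sum, viol_both_av]
    have h1 := pair_sum_le S (hP S (subset_refl _) hZ.le) (fun x => (x / (2 * n)) ^ k)
      (fun a b ha hab => by gcongr) (by positivity) hδ
    rw [← div_eq_mul_inv, div_le_iff₀ (by positivity)]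
    refine h1.trans (le_of_eq ?_)
    have e1 : (1 + δ) / 2 * n / (2 * n) = (1 / 2) * (1 / 2) * (1 + δ) := by field_simp
    have e2 : (n:ℝ) / (2 * n) = 1 / 2 := by field_simp
    simp only [e1, e2]
    rw [← hZS, mul_pow, mul_pow, ← hp]; ring
  have hXv : av (fun c => (X c - p) ^ 2) ≤ p ^ 2 * ((1 + δ) ^ k - 1) + θ * p := by
    have e : (fun c => (X c - p) ^ 2) = fun c => (X c) ^ 2 - (2 * p) * X c + p ^ 2 := by
      funext c; ring
    rw [e, av_add, av_sub, av_mul_left, av_const, hXav]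
    linarith
  have hXd : av (fun c => (X c - p) / (1 - p)) = 0 := by
    have e : (fun c => (X c - p) / (1 - p)) = fun c => (1 - p)⁻¹ * (X c - p) := by
      funext c; rw [div_eq_mul_inv, mul_comm]
    rw [e, av_mul_left, av_sub, hXav, av_const, sub_self, mul_zero]
  rw [av_add, av_add, av_add, av_const, hXd, av_mul_left]
  have hF := frz_prod_av hk (frz I ∅ Φ) hGL j0 (fun l => Gl w I ∅ l Φ + 1)
    (fun l => by have := Gl_nonneg hw0 I ∅ l Φ; linarith)
  rw [av_add (fun l => Gl w I ∅ l Φ), av_const] at hF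
  linarith

end
end

noncomputable section
section
variable {n k m : ℕ}

/-- Floors: the expected number of solutions after `i` clauses, times `exp (-s n)`. -/
def Wf (n : ℕ) (p s : ℝ) (i : ℕ) : ℝ := 2 ^ n * (1 - p) ^ i * Real.exp (-(s * n))

theorem Wf_pos {p s : ℝ} (hp : p < 1) (i : ℕ) : 0 < Wf n p s i := by
  unfold Wf
  have : 0 < 1 - p := by linarith
  positivity

theorem log_Wf {p s : ℝ} (hp : p < 1) (i : ℕ) :
    Real.log (Wf n p s i) = n * Real.log 2 + i * Real.log (1 - p) - s * n := by
  unfold Wf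
  have : 0 < 1 - p := by linarith
  rw [Real.log_mul (by positivity) (Real.exp_pos _).ne', Real.log_mul (by positivity) (by positivity),
    Real.log_pow, Real.log_pow, Real.log_exp]
  ring

theorem Wf_succ (p s : ℝ) (i : ℕ) : Wf n p s (i + 1) = (1 - p) * Wf n p s i := by
  unfold Wf; ring

/-- The first `i` clause indices. -/
def fstI (m i : ℕ) : Finset (Fin m) := univ.filter fun t => t.val < i

theorem fstI_card {i : ℕ} (hi : i ≤ m) : (fstI m i).card = i := by
  unfold fstI
  rw [Fin.card_filter_val_lt]
  omega

theorem fstI_succ {i : ℕ} (hi : i < m) : fstI m (i + 1) = insert ⟨i, hi⟩ (fstI m i) := by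
  ext t
  simp only [fstI, mem_filter, mem_univ, true_and, mem_insert, Fin.ext_iff]
  omega

theorem drift_total [NeZero n] (hk : 1 ≤ k) {s δ θ b p ε G : ℝ} (hp : p = (1 / 2) ^ k)
    (hδ : 0 ≤ δ) (hθ0 : 0 ≤ θ) (hθ : θ ≤ δ / 2) (hb : b = 8 * δ) (hs : 0 ≤ s)
    (hw : ∀ i ≤ m, 1 ≤ Wf n p s i)
    (hG : ∀ i < m, ∀ l, av (fun Φ : Formula n k m => Gl (Wf n p s i) (fstI m i) ∅ l Φ) ≤ G)
    (hε : ∀ i < m, av (fun Φ : Formula n k m => ind (¬ PairGood δ θ (Wf n p s i) (fstI m i) Φ)) ≤ ε) :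
    n * Real.log 2 + m * Real.log (1 - p) -
      m * (16 * (p ^ 2 * ((1 + δ) ^ k - 1) + θ * p) + b ^ (k - 1) * (G + 1) + n * ε) ≤
      av (fun Φ : Formula n k m => Lw (Wf n p s m) (Zc univ ∅ Φ)) := by
  have hn : (0:ℝ) < n := by exact_mod_cast Nat.pos_of_ne_zero (NeZero.ne n)
  have hp0 : 0 < p := by rw [hp]; positivity
  have hp1 : p ≤ 1 / 2 := by
    rw [hp]; calc ((1:ℝ)/2) ^ k ≤ (1/2) ^ 1 := pow_le_pow_of_le_one (by norm_num) (by norm_num) hk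
      _ = 1 / 2 := by norm_num
  have hb0 : 0 ≤ b := by rw [hb]; linarith
  set err := 16 * (p ^ 2 * ((1 + δ) ^ k - 1) + θ * p) + b ^ (k - 1) * (G + 1) + n * ε with herr
  have key : ∀ i ≤ m, n * Real.log 2 + i * Real.log (1 - p) - i * err ≤
      av (fun Φ : Formula n k m => Lw (Wf n p s i) (Zc (fstI m i) ∅ Φ)) := by
    intro i hi
    induction i with
    | zero =>
      have h0 : ∀ Φ : Formula n k m, Lw (Wf n p s 0) (Zc (fstI m 0) ∅ Φ) = n * Real.log 2 := by
        intro Φ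
        have e : Zc (fstI m 0) ∅ Φ = 2 ^ n := by
          unfold Zc sol fstI
          simp
        rw [e]
        unfold Lw
        rw [max_eq_left, Real.log_pow]
        unfold Wf
        have : Real.exp (-(s * n)) ≤ 1 := Real.exp_le_one_iff.2 (by have := mul_nonneg hs hn.le; linarith)
        have h2 : (0:ℝ) < 2 ^ n := by positivity
        rw [pow_zero, mul_one]
        nlinarith
      simp only [h0]
      rw [av_const]
      simp
    | succ i ih =>
      have hi' : i < m := hi
      have ih := ih hi'.le
      have hd : av (fun Φ : Formula n k m => Lw (Wf n p s i) (Zc (fstI m i) ∅ Φ) -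
          Lw (Wf n p s (i+1)) (Zc (fstI m (i+1)) ∅ Φ)) ≤ - Real.log (1 - p) + err := by
        rw [av_update (⟨i, hi'⟩ : Fin m)]
        have ht : (⟨i, hi'⟩ : Fin m) ∉ fstI m i := by simp [fstI]
        have e : ∀ (Φ : Formula n k m) c, Zc (fstI m i) ∅ (Function.update Φ ⟨i, hi'⟩ c) = Zc (fstI m i) ∅ Φ := by
          intro Φ c
          have := Zc_update (insert ⟨i, hi'⟩ (fstI m i)) ∅ Φ ⟨i, hi'⟩ c
          rwa [erase_insert ht] at this
        simp only [e, fstI_succ hi', Wf_succ]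
        refine (av_mono fun Φ => drift_point hk hp (hw i hi'.le) hδ hθ0 hθ hb (fstI m i) ⟨i, hi'⟩ ht Φ).trans ?_
        rw [av_add, av_add, av_const, av_mul_left, av_mul_left, av_add, av_const, av_comm]
        have h1 : av (fun l : Lit n => av (fun Φ : Formula n k m => Gl (Wf n p s i) (fstI m i) ∅ l Φ)) ≤ G :=
          av_le_const (hG i hi')
        have h2 := mul_le_mul_of_nonneg_left (hε i hi') hn.le
        have h3 := mul_le_mul_of_nonneg_left h1 (pow_nonneg hb0 (k-1))
        linarith
      rw [av_sub] at hd
      push_cast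
      linarith
  have := key m le_rfl
  have e : fstI m m = univ := by ext t; simp [fstI]
  rwa [e] at this

theorem variance_bound [NeZero n] (hk : 1 ≤ k) {w K η : ℝ} (hw : 1 ≤ w) (hK : 0 ≤ K)
    (hη : ∀ t l, av (fun Φ : Formula n k m => pp K (Gl w (univ.erase t) ∅ l Φ)) ≤ η) :
    av (fun Φ : Formula n k m => (Lw w (Zc univ ∅ Φ) - av (fun Φ : Formula n k m => Lw w (Zc univ ∅ Φ))) ^ 2) ≤
      m * (4 * K ^ 2 + 2 * n * η) := by
  have hn : (0:ℝ) < n := by exact_mod_cast Nat.pos_of_ne_zero (NeZero.ne n)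
  have hw0 : 0 < w := by linarith
  refine (efron_stein m (fun Φ : Formula n k m => Lw w (Zc univ ∅ Φ))
    (fun t Φ => Lw w (Zc (univ.erase t) ∅ Φ)) (fun t Φ c => by rw [Zc_update])).trans ?_
  let j0 : Fin k := ⟨0, hk⟩
  have h1 : ∀ t : Fin m, av (fun Φ : Formula n k m => (Lw w (Zc univ ∅ Φ) - Lw w (Zc (univ.erase t) ∅ Φ)) ^ 2) ≤
      4 * K ^ 2 + 2 * n * η := by
    intro t
    have h2 : ∀ Φ : Formula n k m, (Lw w (Zc univ ∅ Φ) - Lw w (Zc (univ.erase t) ∅ Φ)) ^ 2 ≤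
        4 * K ^ 2 + 2 * n * pp K (Gl w (univ.erase t) ∅ (Φ t j0) Φ) := by
      intro Φ
      have a1 := Lw_mono hw0 (Zc_clause_le (I := univ) (t := t) j0 ∅ Φ)
      have a2 := Lw_mono hw0 (Zc_anti_I (erase_subset t univ) ∅ Φ)
      have a3 := Gl_nonneg hw0 (univ.erase t) ∅ (Φ t j0) Φ
      have a4 := Gl_le hw (univ.erase t) ∅ (Φ t j0) Φ
      set g := Gl w (univ.erase t) ∅ (Φ t j0) Φ with hg
      have hgd : g = Lw w (Zc (univ.erase t) ∅ Φ) - Lw w (Zc (univ.erase t) (insert (Φ t j0) ∅) Φ) := rfl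
      have a5 : (Lw w (Zc univ ∅ Φ) - Lw w (Zc (univ.erase t) ∅ Φ)) ^ 2 ≤ g ^ 2 := by
        apply sq_le_sq'
        · linarith
        · linarith
      refine a5.trans ?_
      have a6 := le_pp K g
      have a7 := pp_nonneg K g
      by_cases hg2 : g ≤ 2 * K
      · nlinarith [mul_nonneg hn.le a7]
      · nlinarith [mul_nonneg a3 hn.le, sq_nonneg K]
    refine (av_mono h2).trans ?_
    rw [av_add, av_const, av_mul_left, av_update t]
    simp only [Gl_update, Function.update_self]
    have h3 : av (fun Φ : Formula n k m => av fun c : Clause n k => pp K (Gl w (univ.erase t) ∅ (c j0) Φ)) ≤ η := by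
      rw [av_comm]
      exact av_le_const fun c => hη t (c j0)
    have := mul_le_mul_of_nonneg_left h3 (by positivity : (0:ℝ) ≤ 2 * n)
    linarith
  refine (sum_le_sum fun t _ => h1 t).trans ?_
  rw [sum_const, card_univ, Fintype.card_fin, nsmul_eq_mul]

theorem av_Zc [NeZero n] (I : Finset (Fin m)) :
    av (fun Φ : Formula n k m => Zc I ∅ Φ) = 2 ^ n * (1 - (1 / 2) ^ k) ^ I.card := by
  have e : ∀ Φ : Formula n k m, Zc I ∅ Φ = ∑ σ : Assignment n, ∏ t ∈ I, ind (csat σ (Φ t)) := by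
    intro Φ
    unfold Zc sol
    rw [card_filter_eq_sum_ind]
    refine sum_congr rfl fun σ _ => ?_
    rw [← ind_forall_finset]
    simp
  simp only [e]
  rw [av_sum]
  have : ∀ σ : Assignment n, av (fun Φ : Formula n k m => ∏ t ∈ I, ind (csat σ (Φ t))) = (1 - (1/2)^k) ^ I.card := by
    intro σ
    rw [av_pi_prod_finset I (fun _ c => ind (csat σ c))]
    simp only [sat_av, prod_const]
  simp only [this]
  simp

theorem satCount_eq (Φ : Formula n k m) : (satCount n k m Φ : ℝ) = Zc univ ∅ Φ := by
  unfold satCount satSet Zc sol Satisfies csat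
  simp
  congr!

theorem goodL_at {a p δ θ b ε : ℝ} (hp0 : 0 ≤ p) (hp1 : p ≤ 1 / 2)
    (hδ : 0 ≤ δ) (hθ : θ ≤ δ / 2) (hb : b = 8 * δ)
    (hI : ∀ I : Finset (Fin m), av (fun Φ : Formula n k m => ind (¬ PairGood δ θ (Wf n p (3 * a) I.card) I Φ)) ≤ ε)
    (s : ℕ) (hs : (s : ℝ) ≤ a * n) (I : Finset (Fin m)) (i : ℕ) (hi : i ≤ I.card + s) :
    av (fun Φ : Formula n k m => ind (¬ PairGood δ θ (Wf n p (2 * a) i) I Φ)) ≤ ε ∧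
    av (fun Φ : Formula n k m => ind (¬ GoodL (Wf n p (2 * a) i) b I Φ)) ≤ ε := by
  have hq : 0 < 1 - p := by linarith
  have hle : Wf n p (3 * a) I.card ≤ Wf n p (2 * a) i := by
    rw [← Real.log_le_log_iff (Wf_pos (by linarith) _) (Wf_pos (by linarith) _), log_Wf (by linarith),
      log_Wf (by linarith)]
    have h1 : Real.log (1 - p) ≤ 0 := Real.log_nonpos (by linarith) (by linarith)
    have h2 : -1 ≤ Real.log (1 - p) := by
      have := Real.one_sub_inv_le_log_of_pos hq
      have h3 : (1 - p)⁻¹ ≤ 2 := by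
        rw [inv_le_comm₀ hq (by norm_num)]; linarith
      linarith
    have h4 : (i : ℝ) ≤ I.card + s := by exact_mod_cast hi
    have h5 : (0:ℝ) ≤ s := by positivity
    nlinarith
  have h1 : ∀ Φ : Formula n k m, ind (¬ PairGood δ θ (Wf n p (2 * a) i) I Φ) ≤
      ind (¬ PairGood δ θ (Wf n p (3 * a) I.card) I Φ) := fun Φ =>
    ind_mono fun h h' => h (PairGood_mono hle h')
  have h2 : ∀ Φ : Formula n k m, ind (¬ GoodL (Wf n p (2 * a) i) b I Φ) ≤
      ind (¬ PairGood δ θ (Wf n p (3 * a) I.card) I Φ) := fun Φ =>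
    ind_mono fun h h' => h ((PairGood_mono hle h').goodL (Wf_pos (by linarith) _) hδ hθ hb)
  exact ⟨(av_mono h1).trans (hI I), (av_mono h2).trans (hI I)⟩

set_option maxHeartbeats 1600000 in
/-- Failure probability at a fixed `n`. -/
theorem fail_bound [NeZero n] (hk : 3 ≤ k) {r a p δ θ b ε η M K : ℝ} (hp : p = (1 / 2) ^ k) (hr : 0 < r)
    (ha : 0 < a) (hδ : 0 ≤ δ) (hθ0 : 0 ≤ θ) (hθ : θ ≤ δ / 2) (hb : b = 8 * δ)
    (hm : (m : ℝ) ≤ r * n)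
    (hM : M = (k * r) ^ 2 + k * r)
    (hκ : k * r * (2 * b ^ (k - 2)) ≤ 1 / 2)
    (herr : r * (16 * (p ^ 2 * ((1 + δ) ^ k - 1) + θ * p) + b ^ (k - 1) * (8 + 8 * M)) ≤ a / 4)
    (hlow : 2 * a ≤ Real.log 2 + r * Real.log (1 - p))
    (hI : ∀ I : Finset (Fin m), av (fun Φ : Formula n k m => ind (¬ PairGood δ θ (Wf n p (3 * a) I.card) I Φ)) ≤ ε)
    (L J : ℕ) (hL : (n:ℝ) ≤ 2 ^ L) (hLJ : ((L + J + 1 : ℕ) : ℝ) ≤ a * n) (hK : K = Kgr M J)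
    (hη : k * r * (((L + J : ℕ) + 1) ^ 2 / n + n * ε) ≤ η) (hη1 : η ≤ 1) (hnε : r * (n * ε) ≤ a / 4) (hε0 : 0 ≤ ε) :
    av (fun Φ : Formula n k m => ind (¬ (2 ^ n * (1 - p) ^ m * Real.exp (-(a * n)) ≤ Zc univ ∅ Φ))) ≤
      r * (4 * K ^ 2 / n + 2 * ((3 + 8 * M + J) / 2 ^ J + 2 * η)) * (4 / a ^ 2) := by
  have hn : (0:ℝ) < n := by exact_mod_cast Nat.pos_of_ne_zero (NeZero.ne n)
  have hp0 : 0 < p := by rw [hp]; positivity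
  have hp1 : p ≤ 1 / 2 := by
    rw [hp]; calc ((1:ℝ)/2) ^ k ≤ (1/2) ^ 1 :=
          pow_le_pow_of_le_one (by norm_num) (by norm_num) (by omega)
      _ = 1 / 2 := by norm_num
  have hb0 : 0 ≤ b := by rw [hb]; linarith
  have hM0 : 0 ≤ M := by rw [hM]; positivity
  have hq : p < 1 := by linarith
  have hlq : Real.log (1 - p) ≤ 0 := Real.log_nonpos (by linarith) (by linarith)
  have hw : ∀ i ≤ m, 1 ≤ Wf n p (2 * a) i := by
    intro i hi
    rw [← Real.log_nonneg_iff (Wf_pos hq _), log_Wf hq]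
    have h1 : (i:ℝ) ≤ r * n := le_trans (by exact_mod_cast hi) hm
    have h2 : r * n * Real.log (1 - p) ≤ i * Real.log (1 - p) := mul_le_mul_of_nonpos_right h1 hlq
    nlinarith
  have hIm : ∀ I : Finset (Fin m), (I.card : ℝ) ≤ r * n := by
    intro I
    refine le_trans ?_ hm
    have := card_le_univ I
    rw [Fintype.card_fin] at this
    exact_mod_cast this
  have hgood := fun s hs I i hi => goodL_at (b := b) hp0.le hp1 hδ hθ hb hI s hs I i hi
  -- first moments
  have hE0 : (0:ℝ) ≤ k * r * (((L + J : ℕ) + 1) ^ 2 / n + n * ε) := by positivity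
  have hG : ∀ i < m, ∀ l, av (fun Φ : Formula n k m => Gl (Wf n p (2 * a) i) (fstI m i) ∅ l Φ) ≤ 7 + 8 * M := by
    intro i hi l
    have hE : k * r * (((L + 0 : ℕ) + 1) ^ 2 / n + n * ε) ≤ η := by
      refine le_trans ?_ hη
      have : ((L + 0 : ℕ) : ℝ) ≤ ((L + J : ℕ) : ℝ) := by exact_mod_cast (by omega : L + 0 ≤ L + J)
      gcongr
    have h := gl_bound (k := k) (m := m) hk (hw i hi.le) hb0 hr.le hε0 hκ L 0 hL (fstI m i) (hIm _) l
      (fun I' hI' hc => (hgood (L + 0) (by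
        refine le_trans ?_ hLJ
        exact_mod_cast (by omega : L + 0 ≤ L + J + 1)) I' i (by rw [fstI_card hi.le] at hc; omega)).2) rfl hM
    have h2 : ∀ Φ : Formula n k m, Gl (Wf n p (2 * a) i) (fstI m i) ∅ l Φ ≤
        2 + pp (Kgr M 0) (Gl (Wf n p (2 * a) i) (fstI m i) ∅ l Φ) := by
      intro Φ
      have := le_pp (Kgr M 0) (Gl (Wf n p (2 * a) i) (fstI m i) ∅ l Φ)
      simp only [Kgr] at this ⊢
      linarith
    refine (av_mono h2).trans ?_
    rw [av_add, av_const]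
    simp only [pow_zero, div_one, Nat.cast_zero, add_zero] at h hE
    linarith
  have hdr := drift_total (k := k) (m := m) (by omega) hp hδ hθ0 hθ hb (by linarith : 0 ≤ 2 * a) hw hG
    (fun i hi => (hgood 0 (by simp; positivity) (fstI m i) i (by rw [fstI_card hi.le]; omega)).1)
  -- variance
  set w := Wf n p (2 * a) m with hwd
  have hv : ∀ t l, av (fun Φ : Formula n k m => pp K (Gl w (univ.erase t) ∅ l Φ)) ≤
      (3 + 8 * M + J) / 2 ^ J + 2 * η := by
    intro t l
    have h := gl_bound (k := k) (m := m) hk (hw m le_rfl) hb0 hr.le hε0 hκ L J hL (univ.erase t) (hIm _) l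
      (fun I' hI' hc => (hgood (L + J + 1) hLJ I' m (by
        rw [card_erase_of_mem (mem_univ t), card_univ, Fintype.card_fin] at hc
        omega)).2) rfl hM
    rw [← hK] at h
    refine h.trans ?_
    have h2 : 1 + 2 * (k * r * (((L + J : ℕ) + 1) ^ 2 / n + n * ε) + 4 * M) + J ≤ 3 + 8 * M + J := by linarith
    have h3 := div_le_div_of_nonneg_right h2 (by positivity : (0:ℝ) ≤ 2 ^ J)
    linarith
  have hvar := variance_bound (k := k) (m := m) (by omega) (hw m le_rfl)
    (by rw [hK]; exact le_trans (by norm_num) (Kgr_ge hM0 J)) hv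
  set μ := av (fun Φ : Formula n k m => Lw w (Zc univ ∅ Φ)) with hμ
  set lE := n * Real.log 2 + m * Real.log (1 - p) with hlE
  have hμl : lE - a * n / 2 ≤ μ := by
    refine le_trans ?_ hdr
    have h0 : 0 ≤ 16 * (p ^ 2 * ((1 + δ) ^ k - 1) + θ * p) + b ^ (k - 1) * (7 + 8 * M + 1) + n * ε := by
      have : 1 ≤ (1 + δ) ^ k := one_le_pow₀ (by linarith)
      have : 0 ≤ p ^ 2 * ((1 + δ) ^ k - 1) := mul_nonneg (sq_nonneg _) (by linarith)
      positivity
    have h1 := mul_le_mul_of_nonneg_right hm h0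
    have h2 : r * n * (16 * (p ^ 2 * ((1 + δ) ^ k - 1) + θ * p) + b ^ (k - 1) * (7 + 8 * M + 1) + n * ε) ≤
        n * (a / 2) := by
      have : r * n * (16 * (p ^ 2 * ((1 + δ) ^ k - 1) + θ * p) + b ^ (k - 1) * (7 + 8 * M + 1) + n * ε) =
        n * (r * (16 * (p ^ 2 * ((1 + δ) ^ k - 1) + θ * p) + b ^ (k - 1) * (8 + 8 * M)) + r * (n * ε)) := by ring
      rw [this]
      exact mul_le_mul_of_nonneg_left (by linarith) hn.le
    linarith
  have hpt : ∀ Φ : Formula n k m, ind (¬ (2 ^ n * (1 - p) ^ m * Real.exp (-(a * n)) ≤ Zc univ ∅ Φ)) ≤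
      ind ((a * n / 2) ^ 2 ≤ (Lw w (Zc univ ∅ Φ) - μ) ^ 2) := by
    intro Φ
    refine ind_mono fun h => ?_
    rw [not_le] at h
    have h1 : Lw w (Zc univ ∅ Φ) ≤ lE - a * n := by
      have hW : Wf n p a m = 2 ^ n * (1 - p) ^ m * Real.exp (-(a * n)) := rfl
      rw [← hW] at h
      rw [hlE, ← log_Wf hq]
      refine Real.log_le_log (lt_max_of_lt_right (Wf_pos hq _)) (max_le h.le ?_)
      rw [hwd, ← Real.log_le_log_iff (Wf_pos hq _) (Wf_pos hq _), log_Wf hq, log_Wf hq]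
      nlinarith
    have h2 : a * n / 2 ≤ μ - Lw w (Zc univ ∅ Φ) := by linarith
    have h3 : 0 ≤ a * n / 2 := by positivity
    have h4 := pow_le_pow_left₀ h3 h2 2
    have h5 : (Lw w (Zc univ ∅ Φ) - μ) ^ 2 = (μ - Lw w (Zc univ ∅ Φ)) ^ 2 := by ring
    rw [h5]; exact h4
  refine (av_mono hpt).trans ((av_markov _ (fun _ => sq_nonneg _) (by positivity)).trans ?_)
  rw [div_le_iff₀ (by positivity)]
  refine hvar.trans ?_
  have hJ0 : 0 ≤ (3 + 8 * M + J) / 2 ^ J + 2 * η := by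
    have : 0 ≤ η := hE0.trans hη
    positivity
  refine (mul_le_mul_of_nonneg_right hm (by positivity)).trans (le_of_eq ?_)
  field_simp
  ring

end
end

noncomputable section
section

theorem tendsto_log_sq (C : ℕ) :
    Tendsto (fun n : ℕ => ((Nat.log 2 n + C : ℕ) : ℝ) ^ 2 / n) atTop (nhds 0) := by
  have h1 : Tendsto (fun n : ℕ => Real.log n ^ 2 / (n:ℝ)) atTop (nhds 0) :=
    ((Real.isLittleO_pow_log_id_atTop (n := 2)).tendsto_div_nhds_zero).comp tendsto_natCast_atTop_atTop
  have h2 : Tendsto (fun n : ℕ => (2 * (C:ℝ) ^ 2) / (n:ℝ)) atTop (nhds 0) :=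
    tendsto_const_nhds.div_atTop tendsto_natCast_atTop_atTop
  have h3 : Tendsto (fun n : ℕ => 8 * (Real.log n ^ 2 / (n:ℝ)) + (2 * (C:ℝ) ^ 2) / (n:ℝ)) atTop (nhds 0) := by
    simpa using (h1.const_mul 8).add h2
  refine tendsto_of_tendsto_of_tendsto_of_le_of_le' tendsto_const_nhds h3
    (Eventually.of_forall fun n => by positivity) ?_
  filter_upwards [eventually_ge_atTop 1] with n hn
  have hn' : (0:ℝ) < n := by exact_mod_cast hn
  have hl : (Nat.log 2 n : ℝ) ≤ 2 * Real.log n := by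
    have := Real.natLog_le_logb n 2
    refine this.trans ?_
    unfold Real.logb
    have hln : 0 ≤ Real.log n := Real.log_nonneg (by exact_mod_cast hn)
    have h2 : (1:ℝ)/2 < Real.log 2 := by have := Real.log_two_gt_d9; linarith
    push_cast
    rw [div_le_iff₀ (by linarith)]
    nlinarith
  have e : 8 * (Real.log n ^ 2 / (n:ℝ)) + (2 * (C:ℝ) ^ 2) / (n:ℝ) = (8 * Real.log n ^ 2 + 2 * (C:ℝ) ^ 2) / n := by
    field_simp
  rw [e]
  gcongr
  push_cast
  have h0 : (0:ℝ) ≤ Nat.log 2 n := by positivity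
  have hc : (0:ℝ) ≤ C := by positivity
  nlinarith [sq_nonneg ((Nat.log 2 n : ℝ) - C)]

theorem tendsto_n_exp {c : ℝ} (hc : 0 < c) :
    Tendsto (fun n : ℕ => (n:ℝ) * Real.exp (-(c * n))) atTop (nhds 0) := by
  have h := (Real.tendsto_pow_mul_exp_neg_atTop_nhds_zero 1).comp
    (tendsto_natCast_atTop_atTop.const_mul_atTop hc : Tendsto (fun n : ℕ => c * (n:ℝ)) atTop atTop)
  have h2 := h.const_mul c⁻¹
  simp only [mul_zero, Function.comp_def, pow_one] at h2
  refine h2.congr fun n => ?_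
  field_simp

theorem part3 {k : ℕ} (hk : 3 ≤ k) {r a p δ θ b M : ℝ} (hp : p = (1 / 2) ^ k) (hr : 0 < r)
    (ha : 0 < a) (hδ : 0 ≤ δ) (hθ0 : 0 ≤ θ) (hθ : θ ≤ δ / 2) (hb : b = 8 * δ)
    (hM : M = (k * r) ^ 2 + k * r)
    (hκ : k * r * (2 * b ^ (k - 2)) ≤ 1 / 2)
    (herr : r * (16 * (p ^ 2 * ((1 + δ) ^ k - 1) + θ * p) + b ^ (k - 1) * (8 + 8 * M)) ≤ a / 4)
    (hlow : 2 * a ≤ Real.log 2 + r * Real.log (1 - p))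
    (HI : ∃ c : ℝ, 0 < c ∧ ∀ᶠ n : ℕ in atTop, ∀ I : Finset (Fin ⌊r * n⌋₊),
      av (fun Φ : Formula n k ⌊r * n⌋₊ => ind (¬ PairGood δ θ (Wf n p (3 * a) I.card) I Φ)) ≤ Real.exp (-(c * n))) :
    Tendsto (fun n : ℕ => prF n k ⌊r * n⌋₊ fun Φ =>
      expF n k ⌊r * n⌋₊ (fun Ψ => (satCount n k ⌊r * n⌋₊ Ψ : ℝ)) * Real.exp (-(a * n)) ≤
        (satCount n k ⌊r * n⌋₊ Φ : ℝ)) atTop (nhds 1) := by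
  obtain ⟨c, hc, HI⟩ := HI
  have hM0 : 0 ≤ M := by rw [hM]; positivity
  set F : ℕ → ℝ := fun n => av (fun Φ : Formula n k ⌊r * n⌋₊ =>
    ind (¬ (2 ^ n * (1 - p) ^ ⌊r * n⌋₊ * Real.exp (-(a * n)) ≤ Zc univ ∅ Φ))) with hF
  have hF0 : Tendsto F atTop (nhds 0) := by
    refine squeeze_zero' (g := fun n => F n) (Eventually.of_forall fun n => av_nonneg fun _ => ind_nonneg _)
      (Eventually.of_forall fun n => le_rfl) ?_
    rw [Metric.tendsto_atTop']
    intro e he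
    have hJ : Tendsto (fun J : ℕ => r * (2 * ((3 + 8 * M + J) / 2 ^ J)) * (4 / a ^ 2)) atTop (nhds 0) := by
      have h1 : Tendsto (fun J : ℕ => (3 + 8 * M) / (2:ℝ) ^ J) atTop (nhds 0) :=
        tendsto_const_nhds.div_atTop (tendsto_pow_atTop_atTop_of_one_lt (by norm_num))
      have h2 : Tendsto (fun J : ℕ => (J:ℝ) / (2:ℝ) ^ J) atTop (nhds 0) := by
        have := tendsto_self_mul_const_pow_of_lt_one (r := (1/2:ℝ)) (by norm_num) (by norm_num)
        refine this.congr fun J => ?_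
        rw [div_pow, one_pow, mul_one_div]
      have h3 := ((h1.add h2).const_mul (r * 2)).mul_const (4 / a ^ 2)
      simp only [add_zero, mul_zero, zero_mul] at h3
      refine h3.congr fun J => ?_
      ring
    obtain ⟨J, hJ⟩ := (hJ.eventually (gt_mem_nhds (show (0:ℝ) < e / 4 by positivity))).exists
    set K := Kgr M J with hK
    obtain ⟨η, hη0, hη1, hηe⟩ : ∃ η : ℝ, 0 < η ∧ η ≤ 1 ∧ r * (2 * (2 * η)) * (4 / a ^ 2) ≤ e / 4 := by
      refine ⟨min 1 (e / 4 / (r * 4 * (4 / a ^ 2))), by positivity, min_le_left _ _, ?_⟩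
      have h1 := min_le_right 1 (e / 4 / (r * 4 * (4 / a ^ 2)))
      calc r * (2 * (2 * min 1 (e / 4 / (r * 4 * (4 / a ^ 2))))) * (4 / a ^ 2)
          = (r * 4 * (4 / a ^ 2)) * min 1 (e / 4 / (r * 4 * (4 / a ^ 2))) := by ring
        _ ≤ (r * 4 * (4 / a ^ 2)) * (e / 4 / (r * 4 * (4 / a ^ 2))) := by gcongr; 
        _ = e / 4 := by field_simp
    have hKn : Tendsto (fun n : ℕ => r * (4 * K ^ 2 / (n:ℝ)) * (4 / a ^ 2)) atTop (nhds 0) := by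
      have h1 : Tendsto (fun n : ℕ => (4 * K ^ 2) / (n:ℝ)) atTop (nhds 0) :=
        tendsto_const_nhds.div_atTop tendsto_natCast_atTop_atTop
      simpa using (h1.const_mul r).mul_const (4 / a ^ 2)
    have hE : Tendsto (fun n : ℕ => k * r * (((Nat.log 2 n + (1 + J + 1) : ℕ):ℝ) ^ 2 / n +
        (n:ℝ) * Real.exp (-(c * n)))) atTop (nhds 0) := by
      simpa using ((tendsto_log_sq (1 + J + 1)).add (tendsto_n_exp hc)).const_mul ((k:ℝ) * r)
    have hnε : Tendsto (fun n : ℕ => r * ((n:ℝ) * Real.exp (-(c * n)))) atTop (nhds 0) := by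
      simpa using (tendsto_n_exp hc).const_mul r
    have hev := (((hKn.eventually (gt_mem_nhds (show (0:ℝ) < e / 4 by positivity))).and
      (hE.eventually (gt_mem_nhds hη0))).and
      (hnε.eventually (gt_mem_nhds (show (0:ℝ) < a / 4 by positivity)))).and
      ((((tendsto_log_sq (1 + J + 1)).eventually (gt_mem_nhds ha)).and HI).and (eventually_gt_atTop 0))
    obtain ⟨N, hN⟩ := eventually_atTop.1 hev
    refine ⟨N, fun n hn => ?_⟩
    obtain ⟨⟨⟨e1, e2⟩, e3⟩, ⟨⟨e4, e5⟩, e6⟩⟩ := hN n (le_of_lt hn)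
    haveI : NeZero n := ⟨by omega⟩
    have hn0 : (0:ℝ) < n := by exact_mod_cast e6
    have hm : ((⌊r * n⌋₊ : ℕ) : ℝ) ≤ r * n := Nat.floor_le (by positivity)
    have hb := fail_bound (k := k) hk hp hr ha hδ hθ0 hθ hb hm hM hκ herr hlow e5 (Nat.log 2 n + 1) J
      (by exact_mod_cast (Nat.lt_pow_succ_log_self (by norm_num : 1 < 2) n).le)
      (by
        rw [div_lt_iff₀ hn0] at e4
        refine le_trans ?_ e4.le
        have : (1:ℝ) ≤ ((Nat.log 2 n + (1 + J + 1) : ℕ):ℝ) := by exact_mod_cast (by omega : 1 ≤ Nat.log 2 n + (1 + J + 1))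
        have e : ((Nat.log 2 n + 1 + J + 1 : ℕ):ℝ) = ((Nat.log 2 n + (1 + J + 1) : ℕ):ℝ) := by
          congr 1; omega
        rw [e]
        nlinarith) hK (η := η)
      (by
        refine le_trans (le_of_eq ?_) e2.le
        push_cast
        ring) hη1 e3.le (Real.exp_pos _).le
    rw [Real.dist_eq, sub_zero, abs_of_nonneg (av_nonneg fun _ => ind_nonneg _)]
    refine lt_of_le_of_lt hb ?_
    have : r * (4 * K ^ 2 / n + 2 * ((3 + 8 * M + J) / 2 ^ J + 2 * η)) * (4 / a ^ 2) =
      r * (4 * K ^ 2 / n) * (4 / a ^ 2) + r * (2 * ((3 + 8 * M + J) / 2 ^ J)) * (4 / a ^ 2) +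
        r * (2 * (2 * η)) * (4 / a ^ 2) := by ring
    rw [this]
    linarith
  have h1 : Tendsto (fun n => 1 - F n) atTop (nhds 1) := by
    simpa using hF0.const_sub 1
  refine h1.congr' ?_
  filter_upwards [eventually_gt_atTop 0] with n hn
  haveI : NeZero n := ⟨by omega⟩
  have hE : expF n k ⌊r * n⌋₊ (fun Ψ => (satCount n k ⌊r * n⌋₊ Ψ : ℝ)) = 2 ^ n * (1 - p) ^ ⌊r * n⌋₊ := by
    have h2 := av_Zc (n := n) (k := k) (m := ⌊r * n⌋₊) univ
    rw [card_univ, Fintype.card_fin, ← hp] at h2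
    rw [← h2]
    unfold expF av
    simp only [satCount_eq]
  rw [hE]
  unfold prF
  rw [← av_ind]
  simp only [hF, ind_not]
  rw [av_sub, av_const]
  simp only [satCount_eq]
  ring

end
end

noncomputable section
section
variable {n k m : ℕ}

theorem sum_D_pow (β γ : ℝ) : ∑ D : Finset (Fin n), β ^ D.card * γ ^ (n - D.card) = (β + γ) ^ n := by
  have h := Finset.sum_pow_mul_eq_add_pow β γ (univ : Finset (Fin n))
  rw [powerset_univ, card_univ, Fintype.card_fin] at h
  exact h

/-- Both `σ` and its flip are solutions. -/
def bs (I : Finset (Fin m)) (σ : Assignment n) (D : Finset (Fin n)) (Φ : Formula n k m) : ℝ :=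
  ∏ t ∈ I, ind (csat σ (Φ t) ∧ csat (flipA σ D) (Φ t))

theorem bs_eq (I : Finset (Fin m)) (σ : Assignment n) (D : Finset (Fin n)) (Φ : Formula n k m) :
    bs I σ D Φ = ind (σ ∈ sol I ∅ Φ ∧ flipA σ D ∈ sol I ∅ Φ) := by
  unfold bs
  rw [← ind_forall_finset]
  congr 1
  simp only [sol, mem_filter, mem_univ, true_and, eq_iff_iff]
  constructor
  · intro h
    exact ⟨⟨fun t ht => (h t ht).1, by simp⟩, ⟨fun t ht => (h t ht).2, by simp⟩⟩
  · rintro ⟨⟨h1, _⟩, ⟨h2, _⟩⟩ t ht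
    exact ⟨h1 t ht, h2 t ht⟩

/-- The number of free variables. -/
def fr (I : Finset (Fin m)) (σ : Assignment n) (Φ : Formula n k m) : ℝ :=
  ∑ x : Fin n, ind (∀ t ∈ I, ¬ crit σ x (Φ t))

theorem fr_le (I : Finset (Fin m)) (σ : Assignment n) (Φ : Formula n k m) : fr I σ Φ ≤ n := by
  unfold fr
  calc ∑ x : Fin n, ind (∀ t ∈ I, ¬ crit σ x (Φ t)) ≤ ∑ x : Fin n, (1:ℝ) := sum_le_sum fun _ _ => ind_le_one _
    _ = n := by simp

theorem av_bs [NeZero n] (I : Finset (Fin m)) (σ : Assignment n) (D : Finset (Fin n)) :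
    av (fun Φ : Formula n k m => bs I σ D Φ) =
      (1 - 2 * (1 / 2) ^ k + (1 / 2) ^ k * (1 - D.card / n) ^ k) ^ I.card := by
  have hn : (0:ℝ) < n := by exact_mod_cast Nat.pos_of_ne_zero (NeZero.ne n)
  unfold bs
  rw [av_pi_prod_finset I (fun _ c => ind (csat σ c ∧ csat (flipA σ D) c))]
  simp only [sat_both_av, agr_flipA, prod_const]
  have : ((n:ℝ) - D.card) / (2 * n) = 1 / 2 * (1 - D.card / n) := by field_simp
  rw [this, mul_pow]

/-- Reduction to first moments. -/
theorem pairgood_prob {δ θ w f : ℝ} (hθ : 0 < θ) (hw : 0 < w) (I : Finset (Fin m))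
    (Rm Rn : Finset (Fin n) → Prop)
    (hR : ∀ D : Finset (Fin n), (D.card : ℝ) < (1 - δ) / 2 * n → Rm D ∨ Rn D) :
    av (fun Φ : Formula n k m => ind (¬ PairGood δ θ w I Φ)) ≤
      (∑ σ : Assignment n, ∑ D : Finset (Fin n), ind (Rm D) * av (fun Φ : Formula n k m => bs I σ D Φ) +
        ∑ σ : Assignment n, ∑ D : Finset (Fin n), ind (Rn D) *
          av (fun Φ : Formula n k m => bs I σ D Φ * ind (fr I σ Φ ≤ f))) / (θ * w ^ 2 / 2) +
      (∑ σ : Assignment n, av (fun Φ : Formula n k m => (∏ t ∈ I, ind (csat σ (Φ t))) * ind (f < fr I σ Φ))) /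
        (θ * w / 2) := by
  set P : Formula n k m → ℝ := fun Φ => ∑ σ : Assignment n, ∑ D : Finset (Fin n),
    (ind (Rm D) * bs I σ D Φ + ind (Rn D) * (bs I σ D Φ * ind (fr I σ Φ ≤ f))) with hP
  set N : Formula n k m → ℝ := fun Φ => ∑ σ : Assignment n, (∏ t ∈ I, ind (csat σ (Φ t))) * ind (f < fr I σ Φ)
    with hN
  have hbs0 : ∀ σ D (Φ : Formula n k m), 0 ≤ bs I σ D Φ := fun σ D Φ => by rw [bs_eq]; exact ind_nonneg _
  have hP0 : ∀ Φ, 0 ≤ P Φ := fun Φ => sum_nonneg fun σ _ => sum_nonneg fun D _ =>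
    add_nonneg (mul_nonneg (ind_nonneg _) (hbs0 _ _ _))
      (mul_nonneg (ind_nonneg _) (mul_nonneg (hbs0 _ _ _) (ind_nonneg _)))
  have hN0 : ∀ Φ, 0 ≤ N Φ := fun Φ => sum_nonneg fun σ _ =>
    mul_nonneg (prod_nonneg fun _ _ => ind_nonneg _) (ind_nonneg _)
  have hpt : ∀ Φ, ind (¬ PairGood δ θ w I Φ) ≤ ind (θ * w ^ 2 / 2 ≤ P Φ) + ind (θ * w / 2 ≤ N Φ) := by
    intro Φ
    by_cases hG : PairGood δ θ w I Φ
    · rw [ind_false (not_not.2 hG)]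
      exact add_nonneg (ind_nonneg _) (ind_nonneg _)
    by_cases h1 : θ * w ^ 2 / 2 ≤ P Φ
    · rw [ind_true h1]
      linarith [ind_le_one (¬ PairGood δ θ w I Φ), ind_nonneg (θ * w / 2 ≤ N Φ)]
    by_cases h2 : θ * w / 2 ≤ N Φ
    · rw [ind_true h2]
      linarith [ind_le_one (¬ PairGood δ θ w I Φ), ind_nonneg (θ * w ^ 2 / 2 ≤ P Φ)]
    exfalso
    apply hG
    intro S hS hSw
    rw [not_le] at h1 h2
    have hcount : (((S ×ˢ S).filter fun q => (1 + δ) / 2 * n < agr q.1 q.2).card : ℝ) ≤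
        P Φ + N Φ * S.card := by
      rw [card_filter_eq_sum_ind, sum_product]
      have hrow : ∀ σ ∈ S, ∑ τ ∈ S, ind ((1 + δ) / 2 * n < agr σ τ) ≤
          (∑ D : Finset (Fin n), (ind (Rm D) * bs I σ D Φ + ind (Rn D) * (bs I σ D Φ * ind (fr I σ Φ ≤ f)))) +
          ((∏ t ∈ I, ind (csat σ (Φ t))) * ind (f < fr I σ Φ)) * S.card := by
        intro σ hσ
        have hσ1 : ∏ t ∈ I, ind (csat σ (Φ t)) = 1 := by
          refine prod_eq_one fun t ht => ind_true ?_
          have := hS hσ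
          simp only [sol, mem_filter] at this
          exact this.2.1 t ht
        rw [hσ1, one_mul]
        have hD0 : 0 ≤ ∑ D : Finset (Fin n), (ind (Rm D) * bs I σ D Φ + ind (Rn D) * (bs I σ D Φ * ind (fr I σ Φ ≤ f))) :=
          sum_nonneg fun D _ => add_nonneg (mul_nonneg (ind_nonneg _) (hbs0 _ _ _))
            (mul_nonneg (ind_nonneg _) (mul_nonneg (hbs0 _ _ _) (ind_nonneg _)))
        by_cases hf : f < fr I σ Φ
        · rw [ind_true hf, one_mul]
          have : ∑ τ ∈ S, ind ((1 + δ) / 2 * n < agr σ τ) ≤ ∑ τ ∈ S, (1:ℝ) := sum_le_sum fun _ _ => ind_le_one _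
          rw [sum_const, nsmul_eq_mul, mul_one] at this
          linarith
        · rw [ind_false hf, zero_mul, add_zero]
          rw [not_lt] at hf
          have e : ∑ τ ∈ S, ind ((1 + δ) / 2 * n < agr σ τ) = ∑ τ, ind (τ ∈ S) * ind ((1 + δ) / 2 * n < agr σ τ) := by
            rw [← sum_filter_add_sum_filter_not univ (· ∈ S) (fun τ => ind (τ ∈ S) * ind ((1 + δ) / 2 * n < agr σ τ))]
            rw [sum_eq_zero (s := univ.filter (fun τ => ¬ τ ∈ S)), add_zero]
            · simp only [filter_mem_eq_inter, univ_inter]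
              refine sum_congr rfl fun τ hτ => ?_
              rw [ind_true hτ, one_mul]
            · intro τ hτ
              rw [ind_false (mem_filter.1 hτ).2, zero_mul]
          rw [e, sum_flipA σ]
          refine sum_le_sum fun D _ => ?_
          by_cases hDS : flipA σ D ∈ S
          swap
          · rw [ind_false hDS, zero_mul]
            exact add_nonneg (mul_nonneg (ind_nonneg _) (hbs0 _ _ _))
              (mul_nonneg (ind_nonneg _) (mul_nonneg (hbs0 _ _ _) (ind_nonneg _)))
          have hb1 : bs I σ D Φ = 1 := by rw [bs_eq]; exact ind_true ⟨hS hσ, hS hDS⟩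
          rw [ind_true hDS, hb1, ind_true hf, agr_flipA]
          simp only [one_mul, mul_one]
          by_cases hc : (1 + δ) / 2 * n < (n:ℝ) - D.card
          · rw [ind_true hc]
            rcases hR D (by linarith) with h | h
            · rw [ind_true h]; linarith [ind_nonneg (Rn D)]
            · rw [ind_true h]; linarith [ind_nonneg (Rm D)]
          · rw [ind_false hc]; linarith [ind_nonneg (Rn D), ind_nonneg (Rm D)]
      refine (sum_le_sum hrow).trans ?_
      rw [sum_add_distrib, ← sum_mul]
      refine add_le_add ?_ (mul_le_mul_of_nonneg_right ?_ (by positivity))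
      · exact sum_le_sum_of_subset_of_nonneg (subset_univ S) fun σ _ _ => sum_nonneg fun D _ =>
          add_nonneg (mul_nonneg (ind_nonneg _) (hbs0 _ _ _))
            (mul_nonneg (ind_nonneg _) (mul_nonneg (hbs0 _ _ _) (ind_nonneg _)))
      · exact sum_le_sum_of_subset_of_nonneg (subset_univ S) fun σ _ _ =>
          mul_nonneg (prod_nonneg fun _ _ => ind_nonneg _) (ind_nonneg _)
    refine hcount.trans ?_
    have hS0 : 0 < (S.card : ℝ) := hw.trans_le hSw
    have h3 : θ * w ^ 2 / 2 ≤ θ * (S.card : ℝ) ^ 2 / 2 := by gcongr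
    have h4 : N Φ * S.card ≤ (θ * (S.card : ℝ) / 2) * S.card := by
      refine mul_le_mul_of_nonneg_right (h2.le.trans ?_) hS0.le
      gcongr
    nlinarith
  refine (av_mono hpt).trans ?_
  rw [av_add]
  refine add_le_add ?_ ?_
  · refine (av_markov P hP0 (by positivity)).trans (le_of_eq ?_)
    congr 1
    simp only [hP]
    rw [av_sum, ← sum_add_distrib]
    refine sum_congr rfl fun σ _ => ?_
    rw [av_sum, ← sum_add_distrib]
    refine sum_congr rfl fun D _ => ?_
    rw [av_add, av_mul_left, av_mul_left]
  · refine (av_markov N hN0 (by positivity)).trans (le_of_eq ?_)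
    congr 1
    simp only [hN]
    rw [av_sum]

end
end

noncomputable section
section
variable {n k m : ℕ}

lemma region_sum (hn : 0 < n) {A y c : ℝ} (hy : 0 < y) (R : Finset (Fin n) → Prop)
    (h : ∀ D, R D → Real.log (1+y) - (D.card:ℝ)/n * Real.log y + A * (1 - (D.card:ℝ)/n)^k
      - Real.log 2 ≤ -c) :
    (1/2:ℝ)^n * ∑ D : Finset (Fin n), ind (R D) * Real.exp (n * (A * (1 - (D.card:ℝ)/n)^k))
      ≤ Real.exp (-(c*n)) := by
  have hn' : (0:ℝ) < n := by exact_mod_cast hn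
  have key : ∀ D : Finset (Fin n), ind (R D) * Real.exp (n * (A * (1 - (D.card:ℝ)/n)^k))
      ≤ Real.exp (n * (-c + Real.log 2 - Real.log (1+y))) * (y^D.card * 1^(n - D.card)) := by
    intro D
    by_cases hR : R D
    · rw [ind_true hR, one_mul, one_pow, mul_one]
      have e1 : y^D.card = Real.exp (n * ((D.card:ℝ)/n * Real.log y)) := by
        rw [← mul_assoc, mul_div_cancel₀ _ hn'.ne', ← Real.log_pow, Real.exp_log (by positivity)]
      rw [e1, ← Real.exp_add, ← mul_add]
      apply Real.exp_le_exp.mpr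
      apply mul_le_mul_of_nonneg_left _ hn'.le
      have := h D hR
      linarith
    · rw [ind_false hR, zero_mul]; positivity
  calc _ ≤ (1/2:ℝ)^n * ∑ D : Finset (Fin n), Real.exp (n * (-c + Real.log 2 - Real.log (1+y))) * (y^D.card * 1^(n - D.card)) := by
        apply mul_le_mul_of_nonneg_left (sum_le_sum fun D _ => key D) (by positivity)
    _ = (1/2:ℝ)^n * (Real.exp (n * (-c + Real.log 2 - Real.log (1+y))) * (y+1)^n) := by
        rw [← mul_sum, sum_D_pow]
    _ = Real.exp (-(c*n)) := by
        have e1 : (y+1)^n = Real.exp (n * Real.log (1+y)) := by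
          rw [← Real.log_pow, Real.exp_log (by positivity), add_comm]
        have e2 : (1/2:ℝ)^n = Real.exp (n * (-Real.log 2)) := by
          rw [← Real.log_inv, ← Real.log_pow, Real.exp_log (by positivity)]; norm_num
        rw [e1, e2, ← Real.exp_add, ← Real.exp_add]
        congr 1; ring
    _ ≤ _ := le_rfl

lemma far_bound [NeZero n] (hn : 0 < n) (hk : 1 ≤ k) {A s Y : ℝ} (I : Finset (Fin m))
    (hA : (I.card:ℝ) * (1/2)^k/(1-(1/2)^k)^2 ≤ n * A) (Rm : Finset (Fin n) → Prop)
    (hY : (1/2:ℝ)^n * ∑ D : Finset (Fin n), ind (Rm D) * Real.exp (n * (A * (1 - (D.card:ℝ)/n)^k)) ≤ Y) :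
    ∑ σ : Assignment n, ∑ D : Finset (Fin n), ind (Rm D) * av (bs (k := k) I σ D)
      ≤ (Wf n ((1/2)^k) s I.card)^2 * Real.exp (2*s*n) * Y := by
  set p : ℝ := (1/2)^k with hp
  have hp0 : 0 < p := by positivity
  have hp1 : p ≤ 1/2 := by
    rw [hp]; calc (1/2:ℝ)^k ≤ (1/2)^1 := pow_le_pow_of_le_one (by norm_num) (by norm_num) hk
      _ = _ := by norm_num
  have hn' : (0:ℝ) < n := by exact_mod_cast hn
  have key : ∀ D : Finset (Fin n), (1 - 2*p + p*(1 - (D.card:ℝ)/n)^k)^I.card ≤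
      (1-p)^(2*I.card) * Real.exp (n * (A * (1 - (D.card:ℝ)/n)^k)) := by
    intro D
    have hx : (D.card:ℝ)/n ≤ 1 := by
      rw [div_le_one hn']; exact_mod_cast (card_le_univ D).trans (by simp)
    set u := (1 - (D.card:ℝ)/n)^k with hu
    have hu0 : 0 ≤ u := pow_nonneg (by linarith) _
    have h1 : (0:ℝ) < (1-p)^2 := by have : 0 < 1 - p := by linarith
                                    positivity
    have h2 : 1 - 2*p + p*u ≤ (1-p)^2 * Real.exp (p*u/(1-p)^2) := by
      have := Real.add_one_le_exp (p*u/(1-p)^2)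
      calc 1 - 2*p + p*u ≤ (1-p)^2 * (p*u/(1-p)^2 + 1) := by
            rw [mul_add, mul_div_cancel₀ _ h1.ne']; nlinarith
        _ ≤ _ := by gcongr
    have h0 : 0 ≤ 1 - 2*p + p*u := by nlinarith [mul_nonneg hp0.le hu0]
    calc _ ≤ ((1-p)^2 * Real.exp (p*u/(1-p)^2))^I.card := pow_le_pow_left₀ h0 h2 _
      _ = (1-p)^(2*I.card) * Real.exp (((I.card:ℝ)*p/(1-p)^2) * u) := by
          rw [mul_pow, ← pow_mul, ← Real.exp_nat_mul]; congr 2; ring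
      _ ≤ _ := by
          have : 0 ≤ (1-p)^(2*I.card) := pow_nonneg (by linarith) _
          apply mul_le_mul_of_nonneg_left _ this
          apply Real.exp_le_exp.mpr
          rw [← mul_assoc]
          exact mul_le_mul_of_nonneg_right hA hu0
  have e : ∀ σ : Assignment n, ∑ D : Finset (Fin n), ind (Rm D) * av (bs (k := k) I σ D)
      ≤ (1-p)^(2*I.card) * ∑ D : Finset (Fin n), ind (Rm D) * Real.exp (n * (A * (1 - (D.card:ℝ)/n)^k)) := by
    intro σ
    rw [mul_sum]
    apply sum_le_sum
    intro D _
    rw [av_bs, ← hp, mul_left_comm]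
    exact mul_le_mul_of_nonneg_left (key D) (ind_nonneg _)
  have hcard : (Fintype.card (Assignment n) : ℝ) = 2^n := by simp [Assignment]
  calc _ ≤ ∑ σ : Assignment n, ((1-p)^(2*I.card) * ∑ D : Finset (Fin n), ind (Rm D) * Real.exp (n * (A * (1 - (D.card:ℝ)/n)^k))) := sum_le_sum fun σ _ => e σ
    _ = 2^n * ((1-p)^(2*I.card) * ∑ D : Finset (Fin n), ind (Rm D) * Real.exp (n * (A * (1 - (D.card:ℝ)/n)^k))) := by
        rw [sum_const, nsmul_eq_mul, card_univ, hcard]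
    _ = (Wf n p s I.card)^2 * Real.exp (2*s*n) * ((1/2:ℝ)^n * ∑ D : Finset (Fin n), ind (Rm D) * Real.exp (n * (A * (1 - (D.card:ℝ)/n)^k))) := by
        have e3 : (2:ℝ)^n * (1/2)^n = 1 := by rw [← mul_pow]; norm_num
        have e4 : Real.exp (-(s*n))^2 * Real.exp (2*s*n) = 1 := by
          rw [← Real.exp_nat_mul, ← Real.exp_add]; push_cast; ring_nf; simp
        unfold Wf
        generalize (∑ D : Finset (Fin n), ind (Rm D) * Real.exp (n * (A * (1 - (D.card:ℝ)/n)^k))) = Z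
        rw [pow_mul']
        calc _ = (2^n*(1/2)^n) * (Real.exp (-(s*n))^2 * Real.exp (2*s*n)) * (2^n * (((1-p)^I.card)^2*Z)) := by rw [e3, e4]; ring
          _ = _ := by ring
    _ ≤ _ := by
        apply mul_le_mul_of_nonneg_left hY; positivity
end
end

noncomputable section
section
variable {n k m : ℕ}

lemma exp_fr {v : ℝ} (hv : 0 < v) (I : Finset (Fin m)) (σ : Assignment n) (Φ : Formula n k m) :
    Real.exp (Real.log v * fr I σ Φ) = ∏ x : Fin n, (1 - (1 - v) * ind (∀ t ∈ I, ¬ crit σ x (Φ t))) := by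
  unfold fr
  rw [mul_sum, Real.exp_sum]
  apply prod_congr rfl
  intro x _
  by_cases h : ∀ t ∈ I, ¬ crit σ x (Φ t)
  · rw [ind_true h, mul_one, mul_one, Real.exp_log hv]; ring
  · rw [ind_false h]; simp

lemma tail_bound [NeZero n] (hn : 0 < n) (hk : 1 ≤ k) {s f κ ζ : ℝ} (hκ : 0 ≤ κ) (I : Finset (Fin m))
    (hz : (1 - k * (1/2)^k / n / (1 - (1/2)^k))^I.card ≤ ζ)
    (hz1 : (k:ℝ) * (1/2)^k / n / (1 - (1/2)^k) ≤ 1) :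
    ∑ σ : Assignment n, av (fun Φ : Formula n k m => (∏ t ∈ I, ind (csat σ (Φ t))) * ind (f < fr I σ Φ))
      ≤ Wf n ((1/2)^k) s I.card * Real.exp (s*n) * Real.exp (n * (κ*ζ) - f * Real.log (1+κ)) := by
  set p : ℝ := (1/2)^k with hp
  have hp0 : 0 < p := by positivity
  have hp1 : p ≤ 1/2 := by
    rw [hp]; calc (1/2:ℝ)^k ≤ (1/2)^1 := pow_le_pow_of_le_one (by norm_num) (by norm_num) hk
      _ = _ := by norm_num
  have hn' : (0:ℝ) < n := by exact_mod_cast hn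
  have hv : 0 < 1 + κ := by linarith
  have hl : 0 ≤ Real.log (1+κ) := Real.log_nonneg (by linarith)
  have hcard : (Fintype.card (Assignment n) : ℝ) = 2^n := by simp [Assignment]
  have e : ∀ σ : Assignment n, av (fun Φ : Formula n k m => (∏ t ∈ I, ind (csat σ (Φ t))) * ind (f < fr I σ Φ))
      ≤ (1-p)^I.card * Real.exp (n * (κ*ζ) - f * Real.log (1+κ)) := by
    intro σ
    have hg : av (fun c : Clause n k => ind (csat σ c)) = 1 - p := sat_av σ
    have hna := na_prod (ι := Fin m) I (fun c : Clause n k => ind (csat σ c)) (fun _ => ind_nonneg _)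
      (by rw [hg]; linarith) (fun x : Fin n => crit σ x) (fun x y c h h' => crit_unique x y c h h') (1 - (1+κ))
      (by linarith) univ
    have hw : ∀ x : Fin n, av (fun c : Clause n k => ind (csat σ c) * ind (crit σ x c)) = k * p / n := by
      intro x
      rw [← crit_av hn σ x]
      congr 1; funext c
      by_cases h : crit σ x c
      · rw [ind_true h, ind_true (crit_csat h)]; simp
      · rw [ind_false h]; simp
    simp only [hg, hw] at hna
    have hpt : ∀ Φ : Formula n k m, (∏ t ∈ I, ind (csat σ (Φ t))) * ind (f < fr I σ Φ) ≤
        Real.exp (-(f * Real.log (1+κ))) * ((∏ t ∈ I, ind (csat σ (Φ t))) *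
          ∏ x : Fin n, (1 - (1 - (1+κ)) * ind (∀ t ∈ I, ¬ crit σ x (Φ t)))) := by
      intro Φ
      rw [← exp_fr hv, mul_left_comm]
      apply mul_le_mul_of_nonneg_left _ (prod_nonneg fun _ _ => ind_nonneg _)
      rw [← Real.exp_add]
      by_cases h : f < fr I σ Φ
      · rw [ind_true h]
        apply Real.one_le_exp
        nlinarith [mul_nonneg hl (sub_nonneg.2 h.le)]
      · rw [ind_false h]; positivity
    refine (av_mono hpt).trans ?_
    rw [av_mul_left]
    refine (mul_le_mul_of_nonneg_left hna (Real.exp_pos _).le).trans ?_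
    rw [mul_left_comm, sub_eq_add_neg (n * (κ*ζ)), add_comm (n * (κ*ζ)), Real.exp_add]
    apply mul_le_mul_of_nonneg_left _ (pow_nonneg (by linarith) _)
    apply mul_le_mul_of_nonneg_left _ (Real.exp_pos _).le
    rw [prod_const, card_univ, Fintype.card_fin, Real.exp_nat_mul]
    have h1p : (0:ℝ) < 1 - p := by linarith
    have e1 : (1 - p - k*p/n)/(1-p) = 1 - k*p/n/(1-p) := by
      rw [sub_div, div_self h1p.ne']
    rw [e1]
    have h0 : 0 ≤ (1 - k*p/n/(1-p))^I.card := pow_nonneg (by linarith) _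
    apply pow_le_pow_left₀
    · nlinarith [mul_nonneg hκ h0]
    · have := Real.add_one_le_exp (κ*ζ)
      nlinarith [mul_le_mul_of_nonneg_left hz hκ]
  calc _ ≤ ∑ σ : Assignment n, (1-p)^I.card * Real.exp (n * (κ*ζ) - f * Real.log (1+κ)) := sum_le_sum fun σ _ => e σ
    _ = 2^n * ((1-p)^I.card * Real.exp (n * (κ*ζ) - f * Real.log (1+κ))) := by
        rw [sum_const, nsmul_eq_mul, card_univ, hcard]
    _ = _ := by
        have e4 : Real.exp (-(s*n)) * Real.exp (s*n) = 1 := by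
          rw [← Real.exp_add]; simp
        unfold Wf
        calc _ = 2^n * ((1-p)^I.card * Real.exp (n * (κ*ζ) - f * Real.log (1+κ))) * (Real.exp (-(s*n)) * Real.exp (s*n)) := by rw [e4]; ring
          _ = _ := by ring

lemma near_bound [NeZero n] (hn : 0 < n) (hk : 2 ≤ k) {s f ζ₁ ζ₂ B : ℝ} (I : Finset (Fin m))
    (hB : 0 ≤ B) (h1 : ζ₁ ≤ 1) (h2 : ζ₂ ≤ 1)
    (hz : (k:ℝ) * (1/2)^k / n / (1 - 2*(1/2)^k) ≤ 1)
    (hz1 : ζ₁ ≤ (1 - k * (1/2)^k / n / (1 - 2*(1/2)^k))^I.card)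
    (Rn : Finset (Fin n) → Prop)
    (hz3 : ∀ D, Rn D → ((k:ℝ)^2 * (D.card / n) * (1/2)^k / n) / (1 - 2*(1/2)^k) ≤ 1)
    (hz2 : ∀ D, Rn D → ζ₂ ≤ (1 - ((k:ℝ)^2 * (D.card / n) * (1/2)^k / n) / (1 - 2*(1/2)^k))^I.card)
    (hq : ∀ D, Rn D → (1 - 2 * (1 / 2) ^ k + (1 / 2) ^ k * (1 - (D.card:ℝ) / n) ^ k) ^ I.card ≤
      (1 - (1/2)^k)^I.card * B^D.card) :
    ∑ σ : Assignment n, ∑ D : Finset (Fin n), ind (Rn D) *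
          av (fun Φ : Formula n k m => bs I σ D Φ * ind (fr I σ Φ ≤ f))
      ≤ Wf n ((1/2)^k) s I.card * Real.exp (s*n) * (Real.exp (f * Real.log 2) *
        (B*(1-1/2*ζ₂) + (1 - 1/2*ζ₁))^n) := by
  set p : ℝ := (1/2)^k with hp
  have hp0 : 0 < p := by positivity
  have hp1 : p ≤ 1/4 := by
    rw [hp]; calc (1/2:ℝ)^k ≤ (1/2)^2 := pow_le_pow_of_le_one (by norm_num) (by norm_num) hk
      _ = _ := by norm_num
  have h2p : 0 < 1 - 2*p := by linarith
  have hn' : (0:ℝ) < n := by exact_mod_cast hn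
  have hcard : (Fintype.card (Assignment n) : ℝ) = 2^n := by simp [Assignment]
  have e : ∀ (σ : Assignment n) (D : Finset (Fin n)), ind (Rn D) * av (fun Φ : Formula n k m => bs I σ D Φ * ind (fr I σ Φ ≤ f))
      ≤ ((1-p)^I.card * Real.exp (f * Real.log 2)) * ((B*(1-1/2*ζ₂))^D.card * (1 - 1/2*ζ₁)^(n - D.card)) := by
    intro σ D
    have hβ : 0 ≤ 1 - 1/2*ζ₂ := by linarith
    have hγ : 0 ≤ 1 - 1/2*ζ₁ := by linarith
    by_cases hR : Rn D
    swap
    · rw [ind_false hR, zero_mul]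
      have : 0 ≤ 1 - p := by linarith
      positivity
    rw [ind_true hR, one_mul]
    set g : Clause n k → ℝ := fun c => ind (csat σ c ∧ csat (flipA σ D) c) with hgdef
    set x := (D.card:ℝ)/n with hx
    have hx1 : x ≤ 1 := by
      rw [hx, div_le_one hn']; exact_mod_cast (card_le_univ D).trans (by simp)
    set W := 1 - 2 * p + p * (1 - x) ^ k with hWdef
    have hg : av g = W := by
      rw [hgdef, sat_both_av, agr_flipA, hWdef, hp, ← mul_pow, hx]
      congr 2
      field_simp
    have hW2 : 1 - 2*p ≤ W := by
      have : 0 ≤ (1-x)^k := pow_nonneg (by linarith) _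
      nlinarith [mul_nonneg hp0.le this]
    have hW : 0 < W := by linarith
    have hna := na_prod (ι := Fin m) I g (fun _ => ind_nonneg _)
      (by rw [hg]; exact hW) (fun x : Fin n => crit σ x) (fun x y c h h' => crit_unique x y c h h') (1 - 1/2)
      (by norm_num) univ
    rw [hg] at hna
    have hpt : ∀ Φ : Formula n k m, bs I σ D Φ * ind (fr I σ Φ ≤ f) ≤
        Real.exp (f * Real.log 2) * ((∏ t ∈ I, g (Φ t)) *
          ∏ x : Fin n, (1 - (1 - 1/2) * ind (∀ t ∈ I, ¬ crit σ x (Φ t)))) := by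
      intro Φ
      rw [← exp_fr (by norm_num), mul_left_comm]
      apply mul_le_mul_of_nonneg_left _ (prod_nonneg fun _ _ => ind_nonneg _)
      rw [← Real.exp_add]
      by_cases h : fr I σ Φ ≤ f
      · rw [ind_true h]
        apply Real.one_le_exp
        have : Real.log (1/2) = - Real.log 2 := by rw [one_div, Real.log_inv]
        rw [this]
        nlinarith [mul_nonneg (Real.log_nonneg (by norm_num : (1:ℝ) ≤ 2)) (sub_nonneg.2 h)]
      · rw [ind_false h]; positivity
    refine (av_mono hpt).trans ?_
    rw [av_mul_left]
    refine (mul_le_mul_of_nonneg_left hna (Real.exp_pos _).le).trans ?_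
    -- key product bound
    have hfac : ∀ u c : ℝ, u ≤ c → c / (1-2*p) ≤ 1 → 0 ≤ c → (1 - c/(1-2*p))^I.card ≤ ((W - u)/W)^I.card := by
      intro u c huc hc hc0
      apply pow_le_pow_left₀ (by linarith)
      rw [sub_div, div_self hW.ne']
      have : u/W ≤ c/(1-2*p) := div_le_div₀ hc0 huc h2p hW2
      linarith
    have hprod : ∏ x : Fin n, (1 - (1 - 1/2) * ((W - av (fun c => g c * ind (crit σ x c))) / W) ^ I.card)
        ≤ (1-1/2*ζ₂)^D.card * (1 - 1/2*ζ₁)^(n - D.card) := by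
      have hWu : ∀ y : Fin n, 0 ≤ (W - av (fun c => g c * ind (crit σ y c))) / W ∧ (W - av (fun c => g c * ind (crit σ y c))) / W ≤ 1 := by
        intro y
        have a1 : av (fun c => g c * ind (crit σ y c)) ≤ W := by
          rw [← hg]; apply av_mono; intro c
          exact mul_le_of_le_one_right (ind_nonneg _) (ind_le_one _)
        have a2 : 0 ≤ av (fun c => g c * ind (crit σ y c)) :=
          av_nonneg fun c => mul_nonneg (ind_nonneg _) (ind_nonneg _)
        constructor
        · exact div_nonneg (by linarith) hW.le
        · rw [div_le_one hW]; linarith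
      calc _ ≤ ∏ y : Fin n, (if y ∈ D then (1-1/2*ζ₂) else (1 - 1/2*ζ₁)) := by
            apply Finset.prod_le_prod
            · intro y _
              have := pow_le_one₀ (hWu y).1 (hWu y).2 (n := I.card)
              linarith
            · intro y _
              split_ifs with hy
              · have := (hz2 D hR).trans (hfac _ _ (crit_two_av hn σ D y hy) (hz3 D hR) (by positivity))
                linarith
              · have hc : av (fun c => g c * ind (crit σ y c)) ≤ k * p / n := by
                  rw [← crit_av hn σ y]; apply av_mono; intro c
                  exact mul_le_of_le_one_left (ind_nonneg _) (ind_le_one _)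
                have := hz1.trans (hfac _ _ hc hz (by positivity))
                linarith
        _ = _ := by
            rw [prod_ite, prod_const, prod_const]
            congr 2
            · congr 1; ext y; simp
            · have : (univ.filter fun y => y ∉ D) = Dᶜ := by ext y; simp
              rw [this, card_compl, Fintype.card_fin]
    calc Real.exp (f * Real.log 2) * (W ^ I.card * ∏ x : Fin n, (1 - (1 - 1/2) * ((W - av (fun c => g c * ind (crit σ x c))) / W) ^ I.card))
        ≤ Real.exp (f * Real.log 2) * (((1-p)^I.card * B^D.card) * ((1-1/2*ζ₂)^D.card * (1 - 1/2*ζ₁)^(n - D.card))) := by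
          apply mul_le_mul_of_nonneg_left _ (Real.exp_pos _).le
          have : 0 ≤ (1-1/2*ζ₂)^D.card * (1 - 1/2*ζ₁)^(n - D.card) := by positivity
          calc _ ≤ W^I.card * ((1-1/2*ζ₂)^D.card * (1 - 1/2*ζ₁)^(n - D.card)) :=
                mul_le_mul_of_nonneg_left hprod (by positivity)
            _ ≤ _ := mul_le_mul_of_nonneg_right (hq D hR) this
      _ = _ := by rw [mul_pow]; ring
  calc _ ≤ ∑ σ : Assignment n, ∑ D : Finset (Fin n), ((1-p)^I.card * Real.exp (f * Real.log 2)) * ((B*(1-1/2*ζ₂))^D.card * (1 - 1/2*ζ₁)^(n - D.card)) := sum_le_sum fun σ _ => sum_le_sum fun D _ => e σ D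
    _ = 2^n * (((1-p)^I.card * Real.exp (f * Real.log 2)) * (B*(1-1/2*ζ₂) + (1 - 1/2*ζ₁))^n) := by
        rw [sum_const, nsmul_eq_mul, card_univ, hcard, ← mul_sum, sum_D_pow]
    _ = _ := by
        have e4 : Real.exp (-(s*n)) * Real.exp (s*n) = 1 := by
          rw [← Real.exp_add]; simp
        unfold Wf
        calc _ = 2^n * (((1-p)^I.card * Real.exp (f * Real.log 2)) * (B*(1-1/2*ζ₂) + (1 - 1/2*ζ₁))^n) * (Real.exp (-(s*n)) * Real.exp (s*n)) := by rw [e4]; ring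
          _ = _ := by ring
end
end

noncomputable section
section

/-- Numerical facts valid for all large `k`. -/
structure NumF (k : ℕ) (p r : ℝ) : Prop where
  hk : (1000:ℝ) ≤ k
  hp : p = (1/2)^k
  hkp : (k:ℝ)^23 * p ≤ 1/1000
  hlog4 : 4 ≤ Real.log k
  hlogk : Real.log k ≤ k/100
  h9 : (9/10:ℝ)^k * 4 * (k:ℝ)^22 ≤ 1
  hr : r * p = Real.log 2 - (3/2 * Real.log 2 + 2/k) * p

lemma exp_neg_quad {z : ℝ} (hz : 0 ≤ z) : Real.exp (-z) ≤ 1 - z + z^2/2 := by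
  have h := Real.quadratic_le_exp_of_nonneg hz
  rw [Real.exp_neg, inv_le_comm₀ (Real.exp_pos _) (by nlinarith [sq_nonneg (z-1)])]
  refine le_trans ?_ h
  rw [inv_le_iff_one_le_mul₀ (by nlinarith [sq_nonneg (z-1)])]
  nlinarith [sq_nonneg (z^2)]

lemma pow_le_exp' {x : ℝ} (hx : x ≤ 1) (k : ℕ) : (1-x)^k ≤ Real.exp (-(k*x)) := by
  have := Real.one_sub_le_exp_neg x
  calc (1-x)^k ≤ (Real.exp (-x))^k := pow_le_pow_left₀ (by linarith) this k
    _ = _ := by rw [← Real.exp_nat_mul]; ring_nf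

lemma pow_quad {x : ℝ} (hx0 : 0 ≤ x) (hx : x ≤ 1) (k : ℕ) :
    (1-x)^k ≤ 1 - k*x + (k*x)^2/2 :=
  (pow_le_exp' hx k).trans (exp_neg_quad (by positivity))

namespace NumF
variable {k : ℕ} {p r : ℝ}

lemma p0 (N : NumF k p r) : 0 < p := by rw [N.hp]; positivity
lemma k0 (N : NumF k p r) : (0:ℝ) < k := by linarith [N.hk]
lemma kpow (N : NumF k p r) (j : ℕ) (hj : j ≤ 23) : (k:ℝ)^j * p ≤ 1/1000 := by
  have h1 : (1:ℝ) ≤ k := by linarith [N.hk]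
  have := pow_le_pow_right₀ h1 hj
  have := mul_le_mul_of_nonneg_right this N.p0.le
  linarith [N.hkp]
lemma kpow' (N : NumF k p r) (j l : ℕ) (hj : j + l ≤ 23) : (k:ℝ)^j * p ≤ 1/1000 / k^l := by
  have := N.kpow (j+l) hj
  rw [le_div_iff₀ (pow_pos N.k0 l)]
  calc _ = (k:ℝ)^(j+l)*p := by rw [pow_add]; ring
    _ ≤ _ := this
lemma p1 (N : NumF k p r) : p ≤ 1/1000 := by simpa using N.kpow 0 (by norm_num)
lemma logp (N : NumF k p r) : Real.log p = -(k * Real.log 2) := by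
  rw [N.hp, Real.log_pow, one_div, Real.log_inv]; ring
lemma invk (N : NumF k p r) : 0 < 2/(k:ℝ) ∧ 2/(k:ℝ) ≤ 1/500 := by
  have := N.hk; have := N.k0
  constructor
  · positivity
  · rw [div_le_iff₀ N.k0]; linarith
lemma rp_le (N : NumF k p r) : r * p ≤ Real.log 2 - p := by
  have := N.hr; have := N.invk; have := N.p0; have := Real.log_two_gt_d9
  nlinarith [mul_pos N.p0 N.invk.1]
lemma rp_le' (N : NumF k p r) : r * p ≤ Real.log 2 := by linarith [N.rp_le, N.p0]
lemma rp_ge (N : NumF k p r) : Real.log 2 - 2*p ≤ r * p := by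
  have := N.hr; have := N.invk; have := N.p0; have := Real.log_two_lt_d9
  nlinarith [mul_le_mul_of_nonneg_left N.invk.2 N.p0.le]

lemma A0 (N : NumF k p r) : r * p ≤ (Real.log 2 + p) * (1-p)^2 := by
  have := N.rp_le; have := N.p0; have := N.p1
  have h1 := Real.log_two_gt_d9
  have h2 := Real.log_two_lt_d9
  nlinarith [mul_pos N.p0 N.p0, mul_nonneg N.p0.le (sub_nonneg.2 h2.le), pow_pos N.p0 3, mul_nonneg (mul_pos N.p0 N.p0).le (sub_nonneg.2 h1.le)]

lemma A1 (N : NumF k p r) : (r - 4) * p ≤ (Real.log 2 - 3*p) * (1-p)^2 := by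
  have := N.rp_le; have := N.p0; have := N.p1
  have h1 := Real.log_two_gt_d9
  have h2 := Real.log_two_lt_d9
  nlinarith [mul_pos N.p0 N.p0, mul_nonneg N.p0.le (sub_nonneg.2 h2.le), mul_nonneg (mul_pos N.p0 N.p0).le (sub_nonneg.2 N.p1), mul_nonneg (mul_pos N.p0 N.p0).le (sub_nonneg.2 h1.le)]

lemma psi1 (N : NumF k p r) {x : ℝ} (h1 : k*p ≤ x) (h2 : x ≤ 1/(k:ℝ)^2) :
    Real.log (1 + k*p) - x * Real.log (k*p) + (Real.log 2 + p) * (1-x)^k - Real.log 2 ≤ -p := by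
  have hk := N.hk; have hk0 := N.k0; have hp0 := N.p0
  have hL1 := Real.log_two_gt_d9
  have hL2 := Real.log_two_lt_d9
  have hkp : 0 < k*p := by positivity
  have hx0 : 0 < x := by linarith
  have hx1 : x ≤ 1 := h2.trans (by rw [div_le_one (by positivity)]; nlinarith)
  have hkx : (k*x)^2 ≤ x := by
    rw [le_div_iff₀ (by positivity)] at h2
    nlinarith
  have a1 : Real.log (1+k*p) ≤ x := by
    have := Real.log_le_sub_one_of_pos (show 0 < 1 + k*p by linarith); linarith
  have a2 : Real.log (k*p) = Real.log k - k * Real.log 2 := by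
    rw [Real.log_mul hk0.ne' hp0.ne', N.logp]; ring
  have a3 := pow_quad hx0.le hx1 k
  have a4 : (1-x)^k ≤ 1 := pow_le_one₀ (by linarith) (by linarith)
  have a5 : p ≤ x := by nlinarith
  have a6 : Real.log 2 * (1-x)^k ≤ Real.log 2 * (1 - k*x + x/2) := by
    apply mul_le_mul_of_nonneg_left _ (by linarith); linarith
  have a7 : p * (1-x)^k ≤ p := by nlinarith
  have a8 := mul_le_mul_of_nonneg_left N.hlog4 hx0.le
  rw [a2]
  have : Real.log 2 * x ≤ x := by nlinarith
  nlinarith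

lemma psi2 (N : NumF k p r) {x : ℝ} (h1 : 1/(k:ℝ)^2 ≤ x) (h2 : x ≤ 1/(k:ℝ)) :
    Real.log (1 + 1/(k:ℝ)^2) - x * Real.log (1/(k:ℝ)^2) + (Real.log 2 + p) * (1-x)^k - Real.log 2 ≤ -p := by
  have hk := N.hk; have hk0 := N.k0; have hp0 := N.p0
  have hL1 := Real.log_two_gt_d9
  have hL2 := Real.log_two_lt_d9
  have hk2 : 0 < 1/(k:ℝ)^2 := by positivity
  have hx0 : 0 < x := by linarith
  have hkx1 : k*x ≤ 1 := by rw [le_div_iff₀ hk0] at h2; linarith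
  have hx1 : x ≤ 1 := by nlinarith
  have a1 : Real.log (1+1/(k:ℝ)^2) ≤ x := by
    have := Real.log_le_sub_one_of_pos (show 0 < 1 + 1/(k:ℝ)^2 by linarith); linarith
  have a2 : Real.log (1/(k:ℝ)^2) = -(2*Real.log k) := by
    rw [one_div, Real.log_inv, Real.log_pow]; norm_num
  have a3 := pow_quad hx0.le hx1 k
  have a4 : (1-x)^k ≤ 1 := pow_le_one₀ (by linarith) (by linarith)
  have a5 : p ≤ x := by
    have := N.kpow' 0 2 (by norm_num)
    refine le_trans ?_ h1
    rw [pow_zero, one_mul] at this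
    refine this.trans ?_
    gcongr; norm_num
  have hkx2 : (k*x)^2 ≤ k*x := by nlinarith [mul_pos hk0 hx0]
  have a6 : Real.log 2 * (1-x)^k ≤ Real.log 2 * (1 - k*x/2) := by
    apply mul_le_mul_of_nonneg_left _ (by linarith); linarith
  have a7 : p * (1-x)^k ≤ p := by nlinarith
  have a8 := mul_le_mul_of_nonneg_left N.hlogk hx0.le
  have a9 : 0.69 * (k*x/2) ≤ Real.log 2 * (k*x/2) := by
    apply mul_le_mul_of_nonneg_right _ (by positivity); linarith
  have a10 : 1000*x ≤ k*x := by nlinarith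
  rw [a2]
  nlinarith

lemma psi3 (N : NumF k p r) {x : ℝ} (h1 : 1/(k:ℝ) ≤ x) (h2 : x ≤ 1/10) :
    Real.log (1 + 1/8) - x * Real.log (1/8) + (Real.log 2 + p) * (1-x)^k - Real.log 2 ≤ -p := by
  have hk := N.hk; have hk0 := N.k0; have hp0 := N.p0
  have hL1 := Real.log_two_gt_d9
  have hL2 := Real.log_two_lt_d9
  have hk2 : 0 < 1/(k:ℝ) := by positivity
  have hx0 : 0 < x := by linarith
  have hkx1 : 1 ≤ k*x := by rw [div_le_iff₀ hk0] at h1; linarith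
  have a1 : Real.log (1+1/8) ≤ 1/8 := by
    have := Real.log_le_sub_one_of_pos (show (0:ℝ) < 1 + 1/8 by norm_num); linarith
  have a2 : Real.log (1/8) = -(3*Real.log 2) := by
    rw [one_div, Real.log_inv, show (8:ℝ) = 2^3 by norm_num, Real.log_pow]; norm_num
  have a3 : (1-x)^k ≤ 0.37 := by
    refine (pow_le_exp' (by linarith) k).trans ?_
    refine (Real.exp_le_exp.mpr (show -(k*x) ≤ -1 by linarith)).trans ?_
    have := Real.exp_neg_one_lt_d9
    linarith
  have a4 : 0 ≤ (1-x)^k := pow_nonneg (by linarith) _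
  have a5 : (Real.log 2 + p) * (1-x)^k ≤ 0.7 * 0.37 := by
    apply mul_le_mul _ a3 a4 (by norm_num)
    linarith [N.p1]
  have a6 : x * Real.log 2 ≤ 1/10 * 0.6931471808 := by
    apply mul_le_mul h2 hL2.le (by linarith) (by norm_num)
  rw [a2]
  have := N.p1
  nlinarith

lemma psi4 (N : NumF k p r) {x δ : ℝ} (hδ : δ = 1/(k:ℝ)^11) (h1 : 1/10 ≤ x) (h2 : x ≤ (1-δ)/2) :
    Real.log (1 + Real.exp (-(2*δ))) - x * Real.log (Real.exp (-(2*δ))) + (Real.log 2 + p) * (1-x)^k - Real.log 2 ≤ -p := by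
  have hk := N.hk; have hk0 := N.k0; have hp0 := N.p0
  have hL1 := Real.log_two_gt_d9
  have hL2 := Real.log_two_lt_d9
  have hδ0 : 0 < δ := by rw [hδ]; positivity
  rw [Real.log_exp]
  have e1 : 1 + Real.exp (-(2*δ)) = 2 * Real.exp (-δ) * Real.cosh δ := by
    rw [Real.cosh_eq, show -(2*δ) = -δ + -δ by ring, Real.exp_add]
    have : Real.exp (-δ) * Real.exp δ = 1 := by rw [← Real.exp_add]; simp
    nlinarith
  have a1 : Real.log (1 + Real.exp (-(2*δ))) ≤ Real.log 2 - δ + δ^2/2 := by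
    rw [e1]
    have hc : 2 * Real.exp (-δ) * Real.cosh δ ≤ 2 * Real.exp (-δ) * Real.exp (δ^2/2) := by
      gcongr; exact Real.cosh_le_exp_half_sq δ
    have hc0 : 0 < 2 * Real.exp (-δ) * Real.cosh δ := by have := Real.cosh_pos δ; positivity
    refine (Real.log_le_log hc0 hc).trans ?_
    rw [mul_assoc, ← Real.exp_add, Real.log_mul (by norm_num) (Real.exp_pos _).ne', Real.log_exp]
    linarith
  have hd2 : δ^2 = 1/(k:ℝ)^22 := by rw [hδ, div_pow, one_pow, ← pow_mul]
  have a2 : (9/10:ℝ)^k * 4 ≤ δ^2 := by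
    rw [hd2, le_div_iff₀ (by positivity)]; exact N.h9
  have a3 : (1-x)^k ≤ (9/10:ℝ)^k := pow_le_pow_left₀ (by linarith) (by linarith) _
  have a4 : 0 ≤ (1-x)^k := pow_nonneg (by linarith) _
  have a5 : (Real.log 2 + p) * (1-x)^k ≤ 1 * (δ^2/4) := by
    apply mul_le_mul _ (by linarith) a4 (by norm_num)
    linarith [N.p1]
  have a6 : p ≤ δ^2/1000 := by
    have := N.kpow' 0 22 (by norm_num)
    rw [pow_zero, one_mul] at this
    rw [hd2]; refine this.trans (le_of_eq ?_); ring
  nlinarith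

lemma psi0 (N : NumF k p r) {x : ℝ} (h0 : 0 ≤ x) (h1 : x < k*p) :
    Real.log (1 + p) - x * Real.log p + (Real.log 2 - 3*p) * (1-x)^k - Real.log 2 ≤ -p := by
  have hk := N.hk; have hk0 := N.k0; have hp0 := N.p0
  have hL1 := Real.log_two_gt_d9
  have hL2 := Real.log_two_lt_d9
  have hp1 := N.p1
  have hkp := N.kpow 1 (by norm_num)
  rw [pow_one] at hkp
  have a1 : Real.log (1+p) ≤ p := by
    have := Real.log_le_sub_one_of_pos (show 0 < 1 + p by linarith); linarith
  have a3 := pow_quad h0 (by linarith) k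
  have b1 : k*x ≤ k^2*p := by nlinarith
  have b0 : 0 ≤ k*x := by positivity
  have b2 : (k*x)^2 ≤ (k^4*p)*p := by
    calc (k*x)^2 ≤ (k^2*p)^2 := pow_le_pow_left₀ b0 b1 2
      _ = _ := by ring
  have c4 := N.kpow 4 (by norm_num)
  have c2 := N.kpow 2 (by norm_num)
  have b3 : (k*x)^2 ≤ 1/1000*p := b2.trans (mul_le_mul_of_nonneg_right c4 hp0.le)
  have a6 : (Real.log 2 - 3*p) * (1-x)^k ≤ (Real.log 2 - 3*p) * (1 - k*x + (k*x)^2/2) :=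
    mul_le_mul_of_nonneg_left a3 (by linarith)
  have b4 : 3*p*(k*x) ≤ 3*p*(1/1000) := mul_le_mul_of_nonneg_left (by linarith) (by linarith)
  have b5 : (Real.log 2 - 3*p)* ((k*x)^2/2) ≤ 1 * ((k*x)^2/2) :=
    mul_le_mul_of_nonneg_right (by linarith) (by positivity)
  rw [N.logp]
  nlinarith
end NumF
end
end

noncomputable section
section
lemma exp_le_two {t : ℝ} (h0 : 0 ≤ t) (h1 : t ≤ 1/2) : Real.exp t ≤ 1 + 2*t := by
  have h := Real.one_sub_le_exp_neg t
  have e : Real.exp t * Real.exp (-t) = 1 := by rw [← Real.exp_add]; simp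
  have := mul_le_mul_of_nonneg_left h (Real.exp_pos t).le
  nlinarith [Real.exp_pos t, mul_nonneg h0 (sub_nonneg.2 h1)]

namespace NumF
variable {k n : ℕ} {p r : ℝ}

lemma expk (N : NumF k p r) (c : ℝ) : Real.exp (-(k*Real.log 2) + c) = p * Real.exp c := by
  rw [Real.exp_add, ← N.logp, Real.exp_log N.p0]

lemma r0 (N : NumF k p r) : 0 < r := by
  have h := N.rp_ge
  have := N.p1; have hp := N.p0; have := Real.log_two_gt_d9
  by_contra hr
  push Not at hr
  nlinarith

lemma G (N : NumF k p r) : p * (Real.log 2 + 2/k) - 2*p^2 ≤ Real.log 2 + r * Real.log (1-p) := by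
  have hp := N.p0; have hp1 := N.p1; have hr := N.r0
  have h := Real.abs_log_sub_add_sum_range_le (x := p) (by rw [abs_of_pos hp]; linarith) 2
  rw [abs_of_pos hp] at h
  simp only [Finset.sum_range_succ, Finset.sum_range_zero] at h
  norm_num at h
  have h3 : p^3/(1-p) ≤ 2*p^3 := by
    rw [div_le_iff₀ (by linarith)]; nlinarith [pow_pos hp 3]
  have h4 := neg_abs_le (p + p^2/2 + Real.log (1-p))
  have h5 : -p - p^2/2 - 2*p^3 ≤ Real.log (1-p) := by linarith
  have h6 := mul_le_mul_of_nonneg_left h5 hr.le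
  have h7 := N.hr
  have h8 := N.rp_le'
  have h9 : (r*p)*(p/2) ≤ Real.log 2 * (p/2) := mul_le_mul_of_nonneg_right h8 (by linarith)
  have h10 : (r*p)*(2*p^2) ≤ Real.log 2 * (2*p^2) := mul_le_mul_of_nonneg_right h8 (by positivity)
  have := Real.log_two_lt_d9
  nlinarith [mul_pos hp hp]

lemma tail_z (N : NumF k p r) (hn : 0 < n) {i : ℕ} (hi : (r-4)*n ≤ i) :
    (1 - k * p / n / (1 - p))^i ≤ p * Real.exp (6*k*p) := by
  have hp := N.p0; have hp1 := N.p1; have hk := N.k0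
  have hn' : (0:ℝ) < n := by exact_mod_cast hn
  have hn1 : (1:ℝ) ≤ n := by exact_mod_cast hn
  have hkp := N.kpow 1 (by norm_num)
  rw [pow_one] at hkp
  have b1 : k*p/n ≤ 1/1000 := by rw [div_le_iff₀ hn']; nlinarith
  have b2 : k*p/n/(1-p) ≤ 1 := by rw [div_le_one (by linarith)]; linarith
  have b3 : k*p/n ≤ k*p/n/(1-p) := by
    rw [le_div_iff₀ (by linarith)]
    have : 0 < k*p/n := by positivity
    nlinarith
  have hge := N.rp_ge
  calc _ ≤ Real.exp (-(i * (k*p/n/(1-p)))) := pow_le_exp' b2 i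
    _ ≤ Real.exp (-(k*Real.log 2) + 6*k*p) := by
        apply Real.exp_le_exp.mpr
        have c1 : (i:ℝ) * (k*p/n) ≤ i * (k*p/n/(1-p)) := mul_le_mul_of_nonneg_left b3 (by positivity)
        have c2 : (r-4)*n * (k*p/n) ≤ i * (k*p/n) := mul_le_mul_of_nonneg_right hi (by positivity)
        have c3 : (r-4)*n * (k*p/n) = k * ((r-4)*p) := by field_simp
        have c4 : k * (Real.log 2 - 6*p) ≤ k * ((r-4)*p) := mul_le_mul_of_nonneg_left (by linarith) hk.le
        nlinarith
    _ = _ := N.expk _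

lemma tail_e (N : NumF k p r) :
    (1/k:ℝ) * (p * Real.exp (6*k*p)) - (1+1/k)*p * Real.log (1+1/k) ≤ -(p/(4*k^2)) := by
  have hp := N.p0; have hp1 := N.p1; have hk := N.k0; have hk1 := N.hk
  have hkp := N.kpow' 1 1 (by norm_num)
  rw [pow_one] at hkp
  have hkp0 : 0 ≤ (k:ℝ)*p := by positivity
  have hu : 1/1000/(k:ℝ) ≤ 1/1000 := by
    rw [div_le_iff₀ hk]; nlinarith
  have e1 : Real.exp (6*k*p) ≤ 1 + 2*(6*k*p) := exp_le_two (by nlinarith) (by nlinarith)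
  have e2 : Real.exp (6*k*p) ≤ 1 + 12/1000/k := by
    have : (12:ℝ)/1000/k = 12 * (1/1000/k) := by ring
    rw [this]; nlinarith
  have l1 := Real.le_log_one_add_of_nonneg (x := (1/k:ℝ)) (by positivity)
  have l2 : (1+1/k:ℝ) * (2*(1/k)/((1/k)+2)) = 1/k * (1 + 1/(2*k+1)) := by
    field_simp; ring
  have l3 : (1/k:ℝ) * (1 + 1/(2*k+1)) ≤ (1+1/k) * Real.log (1+1/k) := by
    rw [← l2]; exact mul_le_mul_of_nonneg_left l1 (by positivity)
  have l4 : 1/(3*(k:ℝ)) ≤ 1/(2*k+1) := by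
    apply one_div_le_one_div_of_le (by positivity); linarith
  have key : (1/k:ℝ) * Real.exp (6*k*p) - (1+1/k) * Real.log (1+1/k) ≤ -(1/(4*k^2)) := by
    have m1 : (1/k:ℝ) * Real.exp (6*k*p) ≤ 1/k * (1 + 12/1000/k) := mul_le_mul_of_nonneg_left e2 (by positivity)
    have m2 : (1/k:ℝ) * (1 + 1/(3*k)) ≤ 1/k * (1 + 1/(2*k+1)) := mul_le_mul_of_nonneg_left (by linarith) (by positivity)
    have m3 : (1/k:ℝ) * (1 + 12/1000/k) - 1/k*(1+1/(3*k)) = -((1/3-12/1000) * (1/k^2)) := by field_simp; ring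
    have m4 : (1/(4*k^2):ℝ) = 1/4*(1/k^2) := by field_simp
    have m5 : (0:ℝ) < 1/k^2 := by positivity
    rw [m4]; nlinarith
  have := mul_le_mul_of_nonneg_left key hp.le
  have e3 : p * (-(1/(4*k^2):ℝ)) = -(p/(4*k^2)) := by ring
  rw [e3] at this
  nlinarith

lemma near_z1 (N : NumF k p r) (hn : k ≤ n) {i : ℕ} (hi : (i:ℝ) ≤ r*n) :
    p*(1-4*k*p) ≤ (1 - k * p / n / (1 - 2*p))^i := by
  have hp := N.p0; have hp1 := N.p1; have hk := N.k0
  have hkn : (k:ℝ) ≤ n := by exact_mod_cast hn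
  have hn' : (0:ℝ) < n := by linarith
  have b0 : k*p/n ≤ p := by rw [div_le_iff₀ hn']; nlinarith
  have b00 : 0 < k*p/n := by positivity
  have h2p : 0 < 1 - 2*p := by linarith
  set u := k*p/n/(1-2*p) with hu
  have hu0 : 0 < u := by positivity
  have hu1 : u * (1-2*p) = k*p/n := by rw [hu]; exact div_mul_cancel₀ _ h2p.ne'
  have hu2 : u < 1 := by rw [hu, div_lt_one h2p]; linarith
  have a1 : Real.exp (-(u/(1-u))) ≤ 1 - u := by
    rw [Real.exp_neg, inv_le_comm₀ (Real.exp_pos _) (by linarith)]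
    have := Real.add_one_le_exp (u/(1-u))
    have e : u/(1-u) + 1 = (1-u)⁻¹ := by field_simp [show 1-u ≠ 0 by linarith]; ring
    linarith
  have a2 : u/(1-u) ≤ k*p/n*(1+4*p) := by
    rw [div_le_iff₀ (by linarith), ← hu1]
    have c1 : 1 ≤ (1-2*p)*(1+4*p)*(1-u) := by
      have : (1-2*p)*(1-u) ≥ 1 - 3*p := by nlinarith
      nlinarith
    nlinarith
  have a3 : (i:ℝ)*(u/(1-u)) ≤ k*Real.log 2 + 4*k*p := by
    calc (i:ℝ)*(u/(1-u)) ≤ r*n*(k*p/n*(1+4*p)) := by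
          apply mul_le_mul hi a2 (div_nonneg hu0.le (by linarith))
          have := N.r0
          positivity
      _ = k*((r*p)*(1+4*p)) := by field_simp
      _ ≤ k*(Real.log 2*(1+4*p)) := by
          apply mul_le_mul_of_nonneg_left _ hk.le
          exact mul_le_mul_of_nonneg_right N.rp_le' (by linarith)
      _ ≤ _ := by
          have := Real.log_two_lt_d9
          nlinarith [mul_pos hk hp]
  calc p*(1-4*k*p) ≤ p * Real.exp (-(4*k*p)) := by
        apply mul_le_mul_of_nonneg_left _ hp.le
        exact Real.one_sub_le_exp_neg _
    _ = Real.exp (-(k*Real.log 2) + -(4*k*p)) := (N.expk _).symm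
    _ ≤ Real.exp (i*(-(u/(1-u)))) := by apply Real.exp_le_exp.mpr; linarith
    _ = (Real.exp (-(u/(1-u))))^i := Real.exp_nat_mul _ _
    _ ≤ _ := pow_le_pow_left₀ (Real.exp_pos _).le a1 i

lemma near_u (N : NumF k p r) (hn : 0 < n) {x : ℝ} (hx0 : 0 ≤ x) (hx : x ≤ k*p) :
    (k:ℝ)^2*x*p/n/(1-2*p) ≤ k^3*p^2/n/(1-2*p) ∧ (k:ℝ)^3*p^2/n/(1-2*p) ≤ 1 := by
  have hp := N.p0; have hp1 := N.p1; have hk := N.k0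
  have hn' : (0:ℝ) < n := by exact_mod_cast hn
  have hn1 : (1:ℝ) ≤ n := by exact_mod_cast hn
  have h2p : 0 < 1 - 2*p := by linarith
  constructor
  · apply div_le_div_of_nonneg_right _ h2p.le
    apply div_le_div_of_nonneg_right _ hn'.le
    have := mul_le_mul_of_nonneg_left hx (show 0 ≤ (k:ℝ)^2*p by positivity)
    nlinarith
  · rw [div_le_one h2p, div_le_iff₀ hn']
    have := N.kpow 3 (by norm_num)
    nlinarith [mul_le_mul_of_nonneg_right this hp.le]

lemma near_z2 (N : NumF k p r) (hn : 0 < n) {i : ℕ} (hi : (i:ℝ) ≤ r*n) {x : ℝ} (hx0 : 0 ≤ x) (hx : x ≤ k*p) :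
    1 - k^3*p ≤ (1 - (k:ℝ)^2*x*p/n/(1-2*p))^i := by
  have hp := N.p0; have hp1 := N.p1; have hk := N.k0
  have hn' : (0:ℝ) < n := by exact_mod_cast hn
  have h2p : 0 < 1 - 2*p := by linarith
  obtain ⟨h1, h2⟩ := N.near_u hn hx0 hx
  set u := (k:ℝ)^2*x*p/n/(1-2*p) with hu
  have hb := one_add_mul_le_pow (show (-2:ℝ) ≤ -u by linarith) i
  have h3 : (i:ℝ)*u ≤ k^3*p := by
    calc (i:ℝ)*u ≤ r*n*(k^3*p^2/n/(1-2*p)) := by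
          apply mul_le_mul hi h1 (by positivity)
          have := N.r0
          positivity
      _ = (r*p)/(1-2*p) * (k^3*p) := by field_simp
      _ ≤ 1*(k^3*p) := by
          apply mul_le_mul_of_nonneg_right _ (by positivity)
          rw [div_le_one h2p]
          have := N.rp_le'; have := Real.log_two_lt_d9
          linarith
      _ = _ := one_mul _
  calc _ ≤ 1 + (i:ℝ) * -u := by linarith
    _ ≤ (1 + -u)^i := hb
    _ = _ := by rw [← sub_eq_add_neg]

set_option maxHeartbeats 1000000 in
lemma near_q (N : NumF k p r) (hn : 0 < n) {i d : ℕ} (hi : (r-4)*n ≤ i) (hd : (d:ℝ)/n ≤ k*p) :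
    (1 - 2*p + p*(1-(d:ℝ)/n)^k)^i ≤ (1-p)^i * (p*Real.exp (k^3*p))^d := by
  have hp := N.p0; have hp1 := N.p1; have hk := N.k0; have hk1 := N.hk
  have hn' : (0:ℝ) < n := by exact_mod_cast hn
  have hL1 := Real.log_two_gt_d9
  have hL2 := Real.log_two_lt_d9
  set x := (d:ℝ)/n with hx
  have hdx : (d:ℝ) = n*x := by rw [hx]; field_simp
  have hx0 : 0 ≤ x := by positivity
  have hkp := N.kpow 1 (by norm_num)
  rw [pow_one] at hkp
  have hx1 : x ≤ 1 := by linarith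
  have a3 := pow_quad hx0 hx1 k
  have k2p := N.kpow 2 (by norm_num)
  have hkx : k*x ≤ k^2*p := by nlinarith
  set y := k*x - (k*x)^2/2 with hy
  have hkx0 : 0 ≤ k*x := by positivity
  have hy0 : 0 ≤ y := by nlinarith
  have a4 : 1 - 2*p + p*(1-x)^k ≤ (1-p)*Real.exp (-(p*y)) := by
    have := Real.one_sub_le_exp_neg (p*y)
    have h1 : 1 - 2*p + p*(1-x)^k ≤ (1-p)*(1-p*y) := by
      have : p*(1-x)^k ≤ p*(1-y) := mul_le_mul_of_nonneg_left (by linarith) hp.le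
      nlinarith [mul_nonneg (mul_nonneg hp.le hp.le) hy0]
    exact h1.trans (mul_le_mul_of_nonneg_left this (by linarith))
  have h0 : 0 ≤ 1 - 2*p + p*(1-x)^k := by
    have : 0 ≤ p*(1-x)^k := mul_nonneg hp.le (pow_nonneg (by linarith) _)
    linarith
  have a5 : -((i:ℝ)*(p*y)) ≤ d*(-(k*Real.log 2) + k^3*p) := by
    have c1 : (r-4)*n*(p*y) ≤ i*(p*y) := mul_le_mul_of_nonneg_right hi (by positivity)
    have c2 : (Real.log 2 - 6*p)*(n*y) ≤ ((r-4)*p)*(n*y) :=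
      mul_le_mul_of_nonneg_right (by linarith [N.rp_ge]) (by positivity)
    have c3 : x*(k - k^3*p/2) ≤ y := by
      have : (k*x)^2 ≤ (k*x)*(k^2*p) := by nlinarith
      rw [hy]; nlinarith
    have c4 : (Real.log 2 - 6*p)*(n*(x*(k - k^3*p/2))) ≤ (Real.log 2 - 6*p)*(n*y) :=
      mul_le_mul_of_nonneg_left (mul_le_mul_of_nonneg_left c3 hn'.le) (by linarith)
    have c5 : k*Real.log 2 - k^3*p ≤ (Real.log 2 - 6*p)*(k - k^3*p/2) := by
      have e1 : Real.log 2 * (k^3*p) ≤ 1*(k^3*p) := mul_le_mul_of_nonneg_right (by linarith) (by positivity)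
      have e2 : 12*(k*p) ≤ k^3*p := by
        have : (12:ℝ)*k ≤ k^3 := by nlinarith [sq_nonneg ((k:ℝ)), mul_pos hk hk]
        nlinarith
      have e3 : 0 ≤ p*(k^3*p) := by positivity
      have e4 : (Real.log 2 - 6*p)*(k - k^3*p/2) =
        k*Real.log 2 - Real.log 2*(k^3*p)/2 - 6*(k*p) + 3*(p*(k^3*p)) := by ring
      rw [e4]
      linarith
    have c6 : (n*x)*(k*Real.log 2 - k^3*p) ≤ (n*x)*((Real.log 2 - 6*p)*(k - k^3*p/2)) :=
      mul_le_mul_of_nonneg_left c5 (by positivity)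
    rw [hdx]
    have g1 : (Real.log 2 - 6*p)*(n*(x*(k - k^3*p/2))) = (n*x)*((Real.log 2 - 6*p)*(k - k^3*p/2)) := by ring
    have g2 : (r-4)*n*(p*y) = ((r-4)*p)*(n*y) := by ring
    have g3 : (n*x)*(-(k*Real.log 2) + k^3*p) = -((n*x)*(k*Real.log 2 - k^3*p)) := by ring
    rw [g3]
    linarith
  calc _ ≤ ((1-p)*Real.exp (-(p*y)))^i := pow_le_pow_left₀ h0 a4 i
    _ = (1-p)^i * Real.exp (-((i:ℝ)*(p*y))) := by
        rw [mul_pow, ← Real.exp_nat_mul]; ring_nf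
    _ ≤ (1-p)^i * Real.exp (d*(-(k*Real.log 2) + k^3*p)) := by
        apply mul_le_mul_of_nonneg_left _ (pow_nonneg (by linarith) _)
        exact Real.exp_le_exp.mpr a5
    _ = _ := by rw [Real.exp_nat_mul, N.expk]

lemma near_base (N : NumF k p r) :
    (p*Real.exp (k^3*p))*(1-1/2*(1-k^3*p)) + (1-1/2*(p*(1-4*k*p))) ≤ Real.exp (4*k^3*p^2) := by
  have hp := N.p0; have hp1 := N.p1; have hk := N.k0; have hk1 := N.hk
  have k3 := N.kpow 3 (by norm_num)
  set t := (k:ℝ)^3*p with ht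
  have ht0 : 0 < t := by positivity
  have e1 := exp_le_two ht0.le (by linarith)
  have e2 := Real.add_one_le_exp (4*k^3*p^2)
  have e3 : 4*(k:ℝ)^3*p^2 = 4*t*p := by rw [ht]; ring
  have e4 : (k:ℝ)*p ≤ t := by
    have : (k:ℝ) ≤ k^3 := by nlinarith [mul_pos hk hk]
    nlinarith
  have e5 : Real.exp t * (1+t) ≤ 1+4*t := by nlinarith
  have e6 := mul_le_mul_of_nonneg_left e5 hp.le
  have e7 := mul_le_mul_of_nonneg_left e4 hp.le
  rw [e3] at e2 ⊢
  nlinarith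

lemma near_e (N : NumF k p r) {a : ℝ} (ha : a ≤ p/(1000*k^2)) :
    6*a + (1+1/k)*p*Real.log 2 + 4*k^3*p^2 + p/(8*k^2) ≤ Real.log 2 + r*Real.log (1-p) := by
  have hp := N.p0; have hk := N.k0; have hk1 := N.hk
  have hL1 := Real.log_two_gt_d9
  have hL2 := Real.log_two_lt_d9
  refine le_trans ?_ N.G
  have h3 := N.kpow' 3 1 (by norm_num)
  have h0 := N.kpow' 0 1 (by norm_num)
  rw [pow_one] at h3
  rw [pow_zero, one_mul, pow_one] at h0
  set u := 1/(k:ℝ) with hu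
  have hu0 : 0 < u := by positivity
  have hu1 : u ≤ 1/1000 := by rw [hu]; apply one_div_le_one_div_of_le (by norm_num) hk1
  have e1 : p/(1000*(k:ℝ)^2) = p*u^2/1000 := by rw [hu]; field_simp
  have e2 : p/(8*(k:ℝ)^2) = p*u^2/8 := by rw [hu]; field_simp
  have e3 : (2:ℝ)/k = 2*u := by rw [hu]; ring
  have e4 : (1:ℝ)/1000/k = u/1000 := by rw [hu]; ring
  rw [e4] at h3 h0
  rw [e1] at ha
  rw [e2, e3]
  have f1 : p*(k^3*p) ≤ p*(u/1000) := mul_le_mul_of_nonneg_left h3 hp.le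
  have f2 : p*p ≤ p*(u/1000) := mul_le_mul_of_nonneg_left h0 hp.le
  have f3 : p*u^2 ≤ p*u*(1/1000) := by
    have := mul_le_mul_of_nonneg_left hu1 (mul_pos hp hu0).le
    nlinarith
  have f4 : (p*u)*Real.log 2 ≤ (p*u)*0.7 := mul_le_mul_of_nonneg_left (by linarith) (by positivity)
  have f5 : 0 < p*u := by positivity
  nlinarith
end NumF
end
end

noncomputable section
section
variable {n k m : ℕ}

lemma ind_or_le (P Q : Prop) : ind (P ∨ Q) ≤ ind P + ind Q := by
  by_cases hP : P
  · rw [ind_true hP]; linarith [ind_le_one (P ∨ Q), ind_nonneg Q]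
  · by_cases hQ : Q
    · rw [ind_true hQ]; linarith [ind_le_one (P ∨ Q), ind_nonneg P]
    · rw [ind_false (by tauto : ¬ (P ∨ Q))]; linarith [ind_nonneg P, ind_nonneg Q]

lemma farY {p r δ : ℝ} (N : NumF k p r) (hn : 0 < n) (hδ : δ = 1/(k:ℝ)^11) :
    (1/2:ℝ)^n * ∑ D : Finset (Fin n), ind (k*p*n ≤ D.card ∧ (D.card:ℝ) < (1-δ)/2*n) *
      Real.exp (n * ((Real.log 2 + p) * (1 - (D.card:ℝ)/n)^k)) ≤ 4 * Real.exp (-(p*n)) := by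
  have hn' : (0:ℝ) < n := by exact_mod_cast hn
  have hp := N.p0; have hk := N.k0
  have g1 := region_sum (k := k) hn (A := Real.log 2 + p) (y := k*p) (c := p) (by positivity)
    (fun D => k*p ≤ (D.card:ℝ)/n ∧ (D.card:ℝ)/n ≤ 1/(k:ℝ)^2) (fun D h => N.psi1 h.1 h.2)
  have g2 := region_sum (k := k) hn (A := Real.log 2 + p) (y := 1/(k:ℝ)^2) (c := p) (by positivity)
    (fun D => 1/(k:ℝ)^2 ≤ (D.card:ℝ)/n ∧ (D.card:ℝ)/n ≤ 1/(k:ℝ)) (fun D h => N.psi2 h.1 h.2)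
  have g3 := region_sum (k := k) hn (A := Real.log 2 + p) (y := 1/8) (c := p) (by positivity)
    (fun D => 1/(k:ℝ) ≤ (D.card:ℝ)/n ∧ (D.card:ℝ)/n ≤ 1/10) (fun D h => N.psi3 h.1 h.2)
  have g4 := region_sum (k := k) hn (A := Real.log 2 + p) (y := Real.exp (-(2*δ))) (c := p) (by positivity)
    (fun D => 1/10 ≤ (D.card:ℝ)/n ∧ (D.card:ℝ)/n ≤ (1-δ)/2) (fun D h => N.psi4 hδ h.1 h.2)
  have key : ∀ D : Finset (Fin n), ind (k*p*n ≤ D.card ∧ (D.card:ℝ) < (1-δ)/2*n) ≤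
      ind (k*p ≤ (D.card:ℝ)/n ∧ (D.card:ℝ)/n ≤ 1/(k:ℝ)^2) +
      ind (1/(k:ℝ)^2 ≤ (D.card:ℝ)/n ∧ (D.card:ℝ)/n ≤ 1/(k:ℝ)) +
      ind (1/(k:ℝ) ≤ (D.card:ℝ)/n ∧ (D.card:ℝ)/n ≤ 1/10) +
      ind (1/10 ≤ (D.card:ℝ)/n ∧ (D.card:ℝ)/n ≤ (1-δ)/2) := by
    intro D
    refine le_trans (ind_mono ?_) (le_trans (ind_or_le _ _) (add_le_add_left (le_trans (ind_or_le _ _) (add_le_add_left (ind_or_le _ _) _)) _))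
    rintro ⟨h1, h2⟩
    have h1' : k*p ≤ (D.card:ℝ)/n := by rw [le_div_iff₀ hn']; exact h1
    have h2' : (D.card:ℝ)/n ≤ (1-δ)/2 := by rw [div_le_iff₀ hn']; exact h2.le
    rcases le_total ((D.card:ℝ)/n) (1/(k:ℝ)^2) with ha | ha
    · exact Or.inl (Or.inl (Or.inl ⟨h1', ha⟩))
    rcases le_total ((D.card:ℝ)/n) (1/(k:ℝ)) with hb | hb
    · exact Or.inl (Or.inl (Or.inr ⟨ha, hb⟩))
    rcases le_total ((D.card:ℝ)/n) (1/10) with hc | hc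
    · exact Or.inl (Or.inr ⟨hb, hc⟩)
    · exact Or.inr ⟨hc, h2'⟩
  have hsum := sum_le_sum (s := univ) fun (D : Finset (Fin n)) _ =>
    mul_le_mul_of_nonneg_right (key D) (Real.exp_pos (n * ((Real.log 2 + p) * (1 - (D.card:ℝ)/n)^k))).le
  simp only [add_mul, sum_add_distrib] at hsum g1 g2 g3 g4 ⊢
  have := mul_le_mul_of_nonneg_left hsum (show 0 ≤ (1/2:ℝ)^n by positivity)
  rw [mul_add, mul_add, mul_add] at this
  linarith

lemma PG_core [NeZero n] {p r a δ θ : ℝ} (N : NumF k p r) (hkn : k ≤ n) (ha0 : 0 ≤ a)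
    (ha : a ≤ p/(1000*k^2)) (hδ : δ = 1/(k:ℝ)^11) (hθ : 0 < θ) (I : Finset (Fin m))
    (hI : (I.card:ℝ) ≤ r*n) :
    av (fun Φ : Formula n k m => ind (¬ PairGood δ θ (Wf n p (3*a) I.card) I Φ)) ≤
      12/θ * Real.exp (-(p/(8*k^2)*n)) := by
  have hpeq := N.hp
  have hp := N.p0; have hk := N.k0; have hp1 := N.p1; have hk1 := N.hk
  have hn : 0 < n := Nat.pos_of_ne_zero (NeZero.ne n)
  have hn' : (0:ℝ) < n := by exact_mod_cast hn
  have hkN : 1 ≤ k := by exact_mod_cast (by linarith : (1:ℝ) ≤ k)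
  have hkN2 : 2 ≤ k := by exact_mod_cast (by linarith : (2:ℝ) ≤ k)
  have hk2 : (1:ℝ) ≤ k^2 := by nlinarith
  have ha6 : a ≤ p/1000 := ha.trans (div_le_div_of_nonneg_left hp.le (by norm_num) (by nlinarith))
  set c := p/(8*(k:ℝ)^2) with hc
  have hcp : c ≤ p/8 := div_le_div_of_nonneg_left hp.le (by norm_num) (by nlinarith)
  have hac : 8*a ≤ c := by
    have e : p/(1000*(k:ℝ)^2) = c*8/1000 := by rw [hc]; field_simp
    have : 0 < c := by positivity
    linarith
  set w := Wf n p (3*a) I.card with hw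
  have hw0 : 0 < w := Wf_pos (by linarith) _
  have h1p : 0 < (1-p)^2 := by have : 0 < 1 - p := by linarith
                               positivity
  set E := Real.exp (-(c*n)) with hE
  have hE0 : 0 < E := Real.exp_pos _
  set Rm : Finset (Fin n) → Prop := fun D => k*p*n ≤ D.card ∧ (D.card:ℝ) < (1-δ)/2*n with hRm
  set Rn : Finset (Fin n) → Prop := fun D => (D.card:ℝ) < k*p*n with hRn
  have hR : ∀ D : Finset (Fin n), (D.card : ℝ) < (1 - δ) / 2 * n → Rm D ∨ Rn D := by
    intro D hD
    rcases le_or_gt ((k:ℝ)*p*n) D.card with h | h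
    · exact Or.inl ⟨h, hD⟩
    · exact Or.inr h
  -- far part
  have hexp : Real.exp (2*(3*a)*n) * Real.exp (-(p*n)) ≤ E := by
    rw [← Real.exp_add]; apply Real.exp_le_exp.mpr
    have : (6*a + c)*n ≤ p*n := mul_le_mul_of_nonneg_right (by linarith) hn'.le
    linarith
  have T1 : ∑ σ : Assignment n, ∑ D : Finset (Fin n), ind (Rm D) * av (fun Φ : Formula n k m => bs I σ D Φ)
      ≤ w^2 * (4*E) := by
    have h := far_bound (n := n) (k := k) hn hkN (A := Real.log 2 + p) (s := 3*a) I (by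
      rw [← hpeq, div_le_iff₀ h1p]
      calc (I.card:ℝ)*p ≤ r*n*p := mul_le_mul_of_nonneg_right hI hp.le
        _ = n*(r*p) := by ring
        _ ≤ n*((Real.log 2 + p)*(1-p)^2) := mul_le_mul_of_nonneg_left N.A0 hn'.le
        _ = _ := by ring) Rm (farY N hn hδ)
    rw [← hpeq, ← hw] at h
    refine h.trans ?_
    rw [mul_assoc]
    apply mul_le_mul_of_nonneg_left _ (by positivity)
    linarith
  -- the two cases
  have hcase : ∃ f : ℝ, ∑ σ : Assignment n, ∑ D : Finset (Fin n), ind (Rn D) *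
          av (fun Φ : Formula n k m => bs I σ D Φ * ind (fr I σ Φ ≤ f)) ≤ w^2 * E ∧
      ∑ σ : Assignment n, av (fun Φ : Formula n k m => (∏ t ∈ I, ind (csat σ (Φ t))) * ind (f < fr I σ Φ))
        ≤ w * E := by
    rcases le_total (I.card:ℝ) ((r-4)*n) with hi | hi
    · refine ⟨n, ?_, ?_⟩
      · have hY := region_sum (k := k) hn (A := Real.log 2 - 3*p) (y := p) (c := p) hp
          Rn (fun D h => N.psi0 (by positivity) (by rw [div_lt_iff₀ hn']; exact h))
        have h := far_bound (n := n) (k := k) hn hkN (A := Real.log 2 - 3*p) (s := 3*a) I (by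
          rw [← hpeq, div_le_iff₀ h1p]
          calc (I.card:ℝ)*p ≤ (r-4)*n*p := mul_le_mul_of_nonneg_right hi hp.le
            _ = n*((r-4)*p) := by ring
            _ ≤ n*((Real.log 2 - 3*p)*(1-p)^2) := mul_le_mul_of_nonneg_left N.A1 hn'.le
            _ = _ := by ring) Rn hY
        rw [← hpeq, ← hw] at h
        refine le_trans ?_ (h.trans ?_)
        · apply sum_le_sum; intro σ _
          apply sum_le_sum; intro D _
          apply mul_le_mul_of_nonneg_left _ (ind_nonneg _)
          apply av_mono; intro Φ
          apply mul_le_of_le_one_right _ (ind_le_one _)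
          rw [bs_eq]; exact ind_nonneg _
        · rw [mul_assoc]
          exact mul_le_mul_of_nonneg_left hexp (by positivity)
      · refine le_trans (le_of_eq ?_) (mul_pos hw0 hE0).le
        apply sum_eq_zero; intro σ _
        have : (fun Φ : Formula n k m => (∏ t ∈ I, ind (csat σ (Φ t))) * ind ((n:ℝ) < fr I σ Φ)) = fun _ => 0 := by
          funext Φ
          rw [ind_false (not_lt.2 (fr_le I σ Φ)), mul_zero]
        rw [this, av_const]
    · refine ⟨(1+1/k)*p*n, ?_, ?_⟩
      · have hDle : ∀ D : Finset (Fin n), Rn D → (D.card:ℝ)/n ≤ k*p := by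
          intro D h; rw [div_le_iff₀ hn']; exact le_of_lt h
        have k3 := N.kpow 3 (by norm_num)
        have kp1 : (k:ℝ)*p ≤ 1/1000 := by simpa using N.kpow 1 (by norm_num)
        have hkp0 : 0 < (k:ℝ)*p := by positivity
        have h := near_bound (n := n) (k := k) (s := 3*a) (f := (1+1/k)*p*n) (ζ₁ := p*(1-4*k*p))
          (ζ₂ := 1 - k^3*p) (B := p*Real.exp (k^3*p)) hn hkN2 I (by positivity) (by nlinarith)
          (by have : 0 < (k:ℝ)^3*p := by positivity
              linarith)
          (by rw [← hpeq, div_le_one (by linarith), div_le_iff₀ hn']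
              have : (1:ℝ) ≤ n := by exact_mod_cast hn
              nlinarith)
          (by rw [← hpeq]; exact N.near_z1 hkn hI) Rn
          (by intro D hD
              rw [← hpeq]
              obtain ⟨a1, a2⟩ := N.near_u hn (by positivity) (hDle D hD)
              exact a1.trans a2)
          (by intro D hD
              rw [← hpeq]
              exact N.near_z2 hn hI (by positivity) (hDle D hD))
          (by intro D hD
              rw [← hpeq]
              exact N.near_q hn hi (hDle D hD))
        rw [← hpeq, ← hw] at h
        refine h.trans ?_
        rw [mul_assoc w, pow_two, mul_assoc w w]
        apply mul_le_mul_of_nonneg_left _ hw0.le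
        have hb0 : 0 ≤ (p*Real.exp (k^3*p))*(1-1/2*(1-k^3*p)) + (1-1/2*(p*(1-4*k*p))) := by
          have q1 : 0 ≤ (p*Real.exp (k^3*p))*(1-1/2*(1-k^3*p)) := by
            apply mul_nonneg (by positivity)
            have : 0 < (k:ℝ)^3*p := by positivity
            linarith
          nlinarith
        have hb := pow_le_pow_left₀ hb0 N.near_base n
        rw [← Real.exp_nat_mul] at hb
        have hwlog : w = Real.exp (n*Real.log 2 + I.card*Real.log (1-p) - 3*a*n) := by
          rw [← log_Wf (by linarith), ← hw, Real.exp_log hw0]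
        calc _ ≤ Real.exp (3*a*n) * (Real.exp ((1+1/k)*p*n*Real.log 2) * Real.exp (n*(4*k^3*p^2))) := by
              gcongr
          _ ≤ w*E := by
              rw [hwlog, hE, ← Real.exp_add, ← Real.exp_add, ← Real.exp_add]
              apply Real.exp_le_exp.mpr
              have q1 := mul_le_mul_of_nonneg_left (N.near_e ha) hn'.le
              have q2 : r*n*Real.log (1-p) ≤ I.card*Real.log (1-p) :=
                mul_le_mul_of_nonpos_right hI (Real.log_nonpos (by linarith) (by linarith))
              rw [← hc] at q1
              linarith
      · have kp1 : (k:ℝ)*p ≤ 1/1000 := by simpa using N.kpow 1 (by norm_num)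
        have h := tail_bound (n := n) (k := k) (s := 3*a) (f := (1+1/k)*p*n) (κ := 1/k)
          (ζ := p*Real.exp (6*k*p)) hn hkN (by positivity) I
          (by rw [← hpeq]; exact N.tail_z hn hi)
          (by rw [← hpeq, div_le_one (by linarith), div_le_iff₀ hn']
              have : (1:ℝ) ≤ n := by exact_mod_cast hn
              nlinarith)
        rw [← hpeq, ← hw] at h
        refine h.trans ?_
        rw [mul_assoc]
        apply mul_le_mul_of_nonneg_left _ hw0.le
        rw [← Real.exp_add]
        apply Real.exp_le_exp.mpr
        have q1 := mul_le_mul_of_nonneg_left N.tail_e hn'.le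
        have q2 : p/(4*(k:ℝ)^2) = 2*c := by rw [hc]; field_simp; norm_num
        rw [q2] at q1
        have q3 := mul_le_mul_of_nonneg_right hac hn'.le
        have q4 := mul_nonneg ha0 hn'.le
        linarith
  obtain ⟨f, T2, T3⟩ := hcase
  have hfin := pairgood_prob (k := k) (δ := δ) (f := f) hθ hw0 I Rm Rn hR
  refine hfin.trans ?_
  calc _ ≤ (w^2*(4*E) + w^2*E)/(θ*w^2/2) + (w*E)/(θ*w/2) := by gcongr
    _ = _ := by field_simp; norm_num

theorem HI_main {p r a δ θ : ℝ} (N : NumF k p r) (ha0 : 0 ≤ a)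
    (ha : a ≤ p/(1000*k^2)) (hδ : δ = 1/(k:ℝ)^11) (hθ : 0 < θ) :
    ∃ c, 0 < c ∧ ∀ᶠ n : ℕ in atTop, ∀ I : Finset (Fin ⌊r*n⌋₊),
      av (fun Φ : Formula n k ⌊r*n⌋₊ => ind (¬ PairGood δ θ (Wf n p (3*a) I.card) I Φ)) ≤ Real.exp (-(c*n)) := by
  have hp := N.p0; have hk := N.k0
  set c := p/(8*(k:ℝ)^2) with hc
  have hc0 : 0 < c := by positivity
  refine ⟨c/2, by positivity, ?_⟩
  have ht : Tendsto (fun n : ℕ => Real.exp (c/2*n)) atTop atTop :=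
    Real.tendsto_exp_atTop.comp (tendsto_natCast_atTop_atTop.const_mul_atTop (by positivity))
  filter_upwards [eventually_ge_atTop k, eventually_ge_atTop 1, ht.eventually_ge_atTop (12/θ)] with n h1 h2 h3 I
  haveI : NeZero n := ⟨by omega⟩
  have hcard : (I.card:ℝ) ≤ r*n := by
    have q1 : I.card ≤ ⌊r*n⌋₊ := by simpa using card_le_univ I
    have q2 : (⌊r*n⌋₊:ℝ) ≤ r*n := Nat.floor_le (by have := N.r0; positivity)
    exact (by exact_mod_cast q1 : (I.card:ℝ) ≤ ⌊r*n⌋₊).trans q2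
  refine (PG_core N h1 ha0 ha hδ hθ I hcard).trans ?_
  rw [← hc]
  calc _ ≤ Real.exp (c/2*n) * Real.exp (-(c*n)) := by gcongr
    _ = _ := by rw [← Real.exp_add]; congr 1; ring
end
end

noncomputable section
section

lemma num_eventually : ∀ᶠ k : ℕ in atTop, NumF k ((1/2)^k)
    (2^k * Real.log 2 - ((3/2)*Real.log 2 - (-(2/(k:ℝ))))) := by
  have t1 := tendsto_pow_const_mul_const_pow_of_lt_one 23 (r := (1/2:ℝ)) (by norm_num) (by norm_num)
  have t2 := tendsto_pow_const_mul_const_pow_of_lt_one 22 (r := (9/10:ℝ)) (by norm_num) (by norm_num)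
  have t3 : Tendsto (fun k : ℕ => Real.log (k:ℝ)) atTop atTop :=
    Real.tendsto_log_atTop.comp tendsto_natCast_atTop_atTop
  have t4 := tendsto_natCast_atTop_atTop (R := ℝ) |>.eventually
    ((Real.isLittleO_log_id_atTop).bound (show (0:ℝ) < 1/100 by norm_num))
  filter_upwards [eventually_ge_atTop 1000, t1.eventually_le_const (show (0:ℝ) < 1/1000 by norm_num),
    t2.eventually_le_const (show (0:ℝ) < 1/4 by norm_num), t3.eventually_ge_atTop 4, t4] with k h0 h1 h2 h3 h4
  have hk : (1000:ℝ) ≤ k := by exact_mod_cast h0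
  refine ⟨hk, rfl, h1, h3, ?_, ?_, ?_⟩
  · rw [Real.norm_eq_abs, Real.norm_eq_abs, abs_of_nonneg (by linarith), id, abs_of_nonneg (by linarith)] at h4
    linarith
  · linarith
  · have e : (2:ℝ)^k * (1/2)^k = 1 := by rw [← mul_pow]; norm_num
    have : (2^k * Real.log 2 - ((3/2)*Real.log 2 - (-(2/(k:ℝ))))) * (1/2:ℝ)^k =
      (2^k*(1/2)^k) * Real.log 2 - (3/2 * Real.log 2 + 2/k) * (1/2)^k := by ring
    rw [this, e, one_mul]

lemma b_pow {k : ℕ} {p r : ℝ} (N : NumF k p r) {j : ℕ} (hj : k ≤ j + 2) :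
    (8*(1/(k:ℝ)^11))^j ≤ p^8 := by
  have hk := N.hk; have hk0 := N.k0
  have hkN : 1000 ≤ k := by exact_mod_cast hk
  have h1 : 8*(1/(k:ℝ)^11) ≤ (1/2)^9 := by
    have : (1000:ℝ)^11 ≤ (k:ℝ)^11 := pow_le_pow_left₀ (by norm_num) hk 11
    rw [mul_one_div, div_le_iff₀ (by positivity)]
    norm_num at this ⊢
    linarith
  calc (8*(1/(k:ℝ)^11))^j ≤ ((1/2)^9)^j := pow_le_pow_left₀ (by positivity) h1 j
    _ = (1/2:ℝ)^(9*j) := by rw [pow_mul]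
    _ ≤ (1/2:ℝ)^(k*8) := pow_le_pow_of_le_one (by norm_num) (by norm_num) (by omega)
    _ = p^8 := by rw [N.hp, pow_mul]

theorem main_k {k : ℕ} {p r a : ℝ} (N : NumF k p r) (ha : a = r*p^2/k^9) :
    Tendsto (fun n : ℕ => prF n k ⌊r * n⌋₊ fun Φ =>
      expF n k ⌊r * n⌋₊ (fun Ψ => (satCount n k ⌊r * n⌋₊ Ψ : ℝ)) * Real.exp (-(a * n)) ≤
        (satCount n k ⌊r * n⌋₊ Φ : ℝ)) atTop (nhds 1) := by
  have hp := N.p0; have hp1 := N.p1; have hk := N.hk; have hk0 := N.k0; have hr := N.r0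
  have hL1 := Real.log_two_gt_d9
  have hL2 := Real.log_two_lt_d9
  have hrp : r*p ≤ 1 := by linarith [N.rp_le']
  have hrp2 : 1/2 ≤ r*p := by linarith [N.rp_ge]
  have hkN : 1000 ≤ k := by exact_mod_cast hk
  have ha0 : 0 < a := by rw [ha]; positivity
  set δ := 1/(k:ℝ)^11 with hδ
  have hδ0 : 0 < δ := by positivity
  have ha' : a ≤ p/(1000*k^2) := by
    rw [ha, div_le_div_iff₀ (by positivity) (by positivity)]
    have h7 : (1000:ℝ) ≤ k^7 := by
      calc (1000:ℝ) ≤ k := hk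
        _ ≤ k^7 := le_self_pow₀ (by linarith) (by norm_num)
    have e : r*p^2*(1000*(k:ℝ)^2) = (r*p)*(p*(1000*k^2)) := by ring
    have e2 : p*(k:ℝ)^9 = p*(k^7*k^2) := by ring
    rw [e, e2]
    calc (r*p)*(p*(1000*(k:ℝ)^2)) ≤ 1*(p*(1000*k^2)) := mul_le_mul_of_nonneg_right hrp (by positivity)
      _ = p*(1000*k^2) := one_mul _
      _ ≤ _ := by gcongr
  have hkr1 : 1 ≤ k*r := by
    have : r ≥ 1/2 := by nlinarith
    nlinarith
  have kp1 : (k:ℝ)*p ≤ 1/1000 := by simpa using N.kpow 1 (by norm_num)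
  refine part3 (k := k) (p := p) (δ := δ) (θ := p*δ) (b := 8*δ) (M := (k*r)^2+k*r) (by omega) N.hp hr ha0
    hδ0.le (by positivity) (by nlinarith) rfl rfl ?_ ?_ ?_ (HI_main N ha0.le ha' hδ (by positivity))
  · have hb := b_pow N (j := k-2) (by omega)
    calc k*r*(2*(8*δ)^(k-2)) ≤ k*r*(2*p^8) := by
          rw [hδ]; gcongr
      _ = 2*(k*p)*(r*p)*p^6 := by ring
      _ ≤ 2*(1/1000)*1*1 := by
          gcongr
          exact pow_le_one₀ hp.le (by linarith)
      _ ≤ _ := by norm_num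
  · have hb := b_pow N (j := k-1) (by omega)
    have hkδ : (k:ℝ)*δ = 1/k^10 := by rw [hδ]; field_simp
    have hkδ1 : (k:ℝ)*δ ≤ 1/2 := by
      rw [hkδ]; apply one_div_le_one_div_of_le (by norm_num)
      calc (2:ℝ) ≤ k := by linarith
        _ ≤ k^10 := le_self_pow₀ (by linarith) (by norm_num)
    have h1 : (1+δ)^k - 1 ≤ 2*(k*δ) := by
      have : (1+δ)^k ≤ Real.exp (k*δ) := by
        rw [Real.exp_nat_mul]
        apply pow_le_pow_left₀ (by positivity)
        linarith [Real.add_one_le_exp δ]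
      have := exp_le_two (t := k*δ) (by positivity) hkδ1
      linarith
    have h2 : δ ≤ k*δ := by nlinarith
    have hM : 8+8*((k*r)^2+k*r) ≤ 24*(k*r)^2 := by nlinarith
    have t1 : 16*(p^2*((1+δ)^k-1) + p*δ*p) ≤ 48*p^2*(k*δ) := by
      have := mul_le_mul_of_nonneg_left h1 (show 0 ≤ p^2 by positivity)
      have := mul_le_mul_of_nonneg_left h2 (show 0 ≤ p^2 by positivity)
      nlinarith
    have t2 : (8*δ)^(k-1)*(8+8*((k*r)^2+k*r)) ≤ 24*(k^2*p^4)*p^2 := by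
      calc (8*δ)^(k-1)*(8+8*((k*r)^2+k*r)) ≤ p^8*(24*(k*r)^2) := by
            apply mul_le_mul _ hM (by positivity) (by positivity)
            rw [hδ]; exact hb
        _ = 24*(k^2*p^4)*p^2*(r*p)^2 := by ring
        _ ≤ 24*(k^2*p^4)*p^2*1 := by
            apply mul_le_mul_of_nonneg_left _ (by positivity)
            exact pow_le_one₀ (by positivity) hrp
        _ = _ := mul_one _
    have t3 : (k:ℝ)^2*p^4 ≤ 1/1000 * (1/k^9) := by
      have q := N.kpow' 2 9 (by norm_num)
      calc (k:ℝ)^2*p^4 = (k^2*p)*p^3 := by ring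
        _ ≤ (1/1000/(k:ℝ)^9)*1 := by
            apply mul_le_mul q _ (by positivity) (by positivity)
            exact pow_le_one₀ hp.le (by linarith)
        _ = _ := by ring
    have t4 : (k:ℝ)*δ ≤ 1/1000*(1/k^9) := by
      rw [hkδ]
      have e : (1:ℝ)/k^10 = 1/k*(1/k^9) := by field_simp
      rw [e]
      apply mul_le_mul_of_nonneg_right _ (by positivity)
      exact one_div_le_one_div_of_le (by norm_num) hk
    have e : a/4 = r*(1/4*(p^2*(1/k^9))) := by rw [ha]; ring
    rw [e]
    apply mul_le_mul_of_nonneg_left _ hr.le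
    have t5 := mul_le_mul_of_nonneg_left t3 (show 0 ≤ p^2 by positivity)
    have t6 := mul_le_mul_of_nonneg_left t4 (show 0 ≤ p^2 by positivity)
    have t7 : 0 < p^2*(1/(k:ℝ)^9) := by positivity
    linarith
  · have h := N.near_e ha'
    have q1 : 0 ≤ (1+1/k)*p*Real.log 2 := by positivity
    have q2 : 0 ≤ 4*(k:ℝ)^3*p^2 := by positivity
    have q3 : 0 ≤ p/(8*(k:ℝ)^2) := by positivity
    linarith
end
end

/-- There are `k0` and a sequence `eps k → 0` such that for every
`k ≥ k0`, with `ρ = (3/2) ln 2 - eps k` and `r = 2^k ln 2 - ρ`, whp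
`|S(Φ)| ≥ E[|S(Φ)|] exp(-n r/(k^9 4^k))`. -/
theorem statement18 :
    ∃ (k0 : ℕ) (eps : ℕ → ℝ),
      Tendsto eps atTop (nhds 0) ∧
      ∀ k : ℕ, k0 ≤ k →
        Tendsto
          (fun n : ℕ =>
            let r := 2 ^ k * Real.log 2 - ((3 / 2) * Real.log 2 - eps k)
            let m := ⌊r * (n : ℝ)⌋₊
            prF n k m fun Φ =>
              expF n k m (fun Ψ => (satCount n k m Ψ : ℝ)) *
                  Real.exp (-(n : ℝ) * r / ((k : ℝ) ^ 9 * 4 ^ k)) ≤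
                (satCount n k m Φ : ℝ))
          atTop (nhds 1) := by
  obtain ⟨k0, hk0⟩ := eventually_atTop.1 num_eventually
  refine ⟨k0, fun k => -(2/(k:ℝ)), ?_, ?_⟩
  · have := (tendsto_const_div_atTop_nhds_zero_nat (2:ℝ)).neg
    simpa using this
  · intro k hk
    have h := main_k (hk0 k hk) rfl
    refine h.congr ?_
    intro n
    dsimp only
    have e4 : ((1/2:ℝ)^k)^2 = (4^k)⁻¹ := by
      rw [← pow_mul, mul_comm, pow_mul, ← inv_pow]; norm_num
    have e : ∀ r : ℝ, -(r * ((1/2:ℝ)^k)^2/(k:ℝ)^9 * n) = -(n:ℝ) * r / ((k:ℝ)^9*4^k) := by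
      intro r
      rw [e4, div_eq_mul_inv, div_eq_mul_inv, mul_inv]; ring
    simp only [e]
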